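/- There exist a universal constant C > 0 and a function L that is polylogarithmic in K, S, A, H and 1/δ with the following property. In the partially adversarial setting where the set Λ of adversarial steps (|Λ| = λ) is known to the learner, and with bandit feedback (the learner observes in each episode only the realized trajectory and the losses along it), there is a learning algorithm (COM-OMD with step size and implicit-exploration parameter η = γ = 1/√(K·A^{λ+1}·S)) such that for every δ ∈ (0,1), with probability at least 1 − 9δ, its regret satisfies R_K ≤ C·L·( H·S^λ·√(K·S·A^{λ+1}) + H³·S²·A + √(H⁴·S²·A·K) ). -/

import Mathlib

open Finset

namespace AdvMDP

variable {S A : ℕ}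

/-- A per-step transition kernel: a probability distribution over next states
for every (state, action) pair. -/
def IsKernel (p : Fin S → Fin A → Fin S → ℝ) : Prop :=
  (∀ s a s', 0 ≤ p s a s') ∧ ∀ s a, ∑ s', p s a s' = 1

/-- A transition function for an `H`-step episode: a kernel for every step
`h` with `h + 1 < H` (the transition from step `h` to step `h+1`). -/
def IsTrans (H : ℕ) (p : ℕ → Fin S → Fin A → Fin S → ℝ) : Prop :=
  ∀ h, h + 1 < H → IsKernel (p h)

/-- A loss function for an `H`-step episode, with values in `[0,1]`. -/
def IsLoss (H : ℕ) (ℓ : ℕ → Fin S → Fin A → ℝ) : Prop :=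
  ∀ h s a, h < H → 0 ≤ ℓ h s a ∧ ℓ h s a ≤ 1

/-- A (stochastic) Markov policy. -/
def IsPolicy (π : ℕ → Fin S → Fin A → ℝ) : Prop :=
  (∀ h s a, 0 ≤ π h s a) ∧ ∀ h s, ∑ a, π h s a = 1

/-- The distribution over states at step `h` induced by a Markov policy `π`
under transitions `p`, starting from `sinit`. -/
noncomputable def stateDist (p : ℕ → Fin S → Fin A → Fin S → ℝ)
    (π : ℕ → Fin S → Fin A → ℝ) (sinit : Fin S) : ℕ → Fin S → ℝ
  | 0 => fun s => if s = sinit then 1 else 0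
  | h + 1 => fun s' => ∑ s, ∑ a, stateDist p π sinit h s * π h s a * p h s a s'

/-- The value `V₁^{π,p,ℓ}` of a Markov policy: the expected cumulative loss
over an `H`-step episode. -/
noncomputable def value (H : ℕ) (p : ℕ → Fin S → Fin A → Fin S → ℝ)
    (π : ℕ → Fin S → Fin A → ℝ) (ℓ : ℕ → Fin S → Fin A → ℝ) (sinit : Fin S) : ℝ :=
  ∑ h ∈ range H, ∑ s, ∑ a, stateDist p π sinit h s * π h s a * ℓ h s a

/-- The benchmark: the best cumulative value over `K` episodes achievable by a
fixed Markov policy. -/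
noncomputable def bestValue (H K : ℕ) (p : ℕ → ℕ → Fin S → Fin A → Fin S → ℝ)
    (ℓ : ℕ → ℕ → Fin S → Fin A → ℝ) (sinit : Fin S) : ℝ :=
  sInf {x : ℝ | ∃ π : ℕ → Fin S → Fin A → ℝ,
    IsPolicy π ∧ x = ∑ k ∈ range K, value H (p k) π (ℓ k) sinit}

/-- A strategy: a rule assigning to every within-episode trajectory prefix
(the list of past state-action pairs) and current state a distribution over
actions. -/
def IsStrategy (σ : List (Fin S × Fin A) → Fin S → Fin A → ℝ) : Prop :=
  (∀ t s a, 0 ≤ σ t s a) ∧ ∀ t s, ∑ a, σ t s a = 1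

/-- Probability that, starting at step `h` in state `s` with within-episode
history `hist`, the strategy `σ` under transitions `p` produces exactly the
remaining trajectory `rest`. -/
noncomputable def trajProb (p : ℕ → Fin S → Fin A → Fin S → ℝ)
    (σ : List (Fin S × Fin A) → Fin S → Fin A → ℝ) :
    ℕ → Fin S → List (Fin S × Fin A) → List (Fin S × Fin A) → ℝ
  | _, _, _, [] => 1
  | _, s, hist, [(s', a)] => if s' = s then σ hist s a else 0
  | h, s, hist, (s', a) :: (s'', a'') :: rest =>
      (if s' = s then σ hist s a else 0) * p h s' a s'' *
        trajProb p σ (h + 1) s'' (hist ++ [(s', a)]) ((s'', a'') :: rest)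

/-- Probability that strategy `σ` produces the full `H`-step trajectory `t`. -/
noncomputable def trajDist (H : ℕ) (p : ℕ → Fin S → Fin A → Fin S → ℝ)
    (σ : List (Fin S × Fin A) → Fin S → Fin A → ℝ) (sinit : Fin S)
    (t : Fin H → Fin S × Fin A) : ℝ :=
  trajProb p σ 0 sinit [] (List.ofFn t)

/-- Cumulative loss along a trajectory. -/
noncomputable def trajLoss (H : ℕ) (ℓ : ℕ → Fin S → Fin A → ℝ)
    (t : Fin H → Fin S × Fin A) : ℝ :=
  ∑ h : Fin H, ℓ h (t h).1 (t h).2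

/-- The value `V₁^{σ,p,ℓ}` of a history-dependent strategy. -/
noncomputable def stratValue (H : ℕ) (p : ℕ → Fin S → Fin A → Fin S → ℝ)
    (σ : List (Fin S × Fin A) → Fin S → Fin A → ℝ) (ℓ : ℕ → Fin S → Fin A → ℝ)
    (sinit : Fin S) : ℝ :=
  ∑ t : Fin H → Fin S × Fin A, trajDist H p σ sinit t * trajLoss H ℓ t

/-- A (randomized) learning algorithm with per-episode observations of type
`Obs`: a random seed (drawn once, with distribution `w`) together with a map
from the seed and the list of past observations to the strategy played in the
next episode. -/
structure Alg (S A : ℕ) (Obs : Type) where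
  w : ℕ → ℝ
  w_nonneg : ∀ i, 0 ≤ w i
  w_sum : ∑' i, w i = 1
  act : ℕ → List Obs → List (Fin S × Fin A) → Fin S → Fin A → ℝ
  act_strat : ∀ i past, IsStrategy (act i past)

/-- The strategy played by algorithm `alg` (with seed `i`) in episode `k`,
when the realized trajectories so far are `ts` and the per-episode
observations are produced by `obs`. -/
noncomputable def played {Obs : Type} {H K : ℕ} (alg : Alg S A Obs) (i : ℕ)
    (obs : ℕ → (Fin H → Fin S × Fin A) → Obs)
    (ts : Fin K → Fin H → Fin S × Fin A) (k : Fin K) :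
    List (Fin S × Fin A) → Fin S → Fin A → ℝ :=
  alg.act i (List.ofFn fun j : Fin (k : ℕ) =>
    obs (j : ℕ) (ts ⟨(j : ℕ), j.2.trans k.2⟩))

/-- The probability that the interaction of algorithm `alg` (with seed `i`)
with the episodic MDP `(p, obs)` produces the sequence of trajectories `ts`. -/
noncomputable def seqProb {Obs : Type} {H K : ℕ} (alg : Alg S A Obs) (i : ℕ)
    (p : ℕ → ℕ → Fin S → Fin A → Fin S → ℝ)
    (obs : ℕ → (Fin H → Fin S × Fin A) → Obs) (sinit : Fin S)
    (ts : Fin K → Fin H → Fin S × Fin A) : ℝ :=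
  ∏ k : Fin K, trajDist H (p k) (played alg i obs ts k) sinit (ts k)

/-- The realized total value `∑_k V₁^{π^k,p^k,ℓ^k}` of the strategies selected
by the algorithm along the history `(i, ts)`. -/
noncomputable def playedValue {Obs : Type} (H K : ℕ) (alg : Alg S A Obs) (i : ℕ)
    (p : ℕ → ℕ → Fin S → Fin A → Fin S → ℝ) (ℓ : ℕ → ℕ → Fin S → Fin A → ℝ)
    (obs : ℕ → (Fin H → Fin S × Fin A) → Obs) (sinit : Fin S)
    (ts : Fin K → Fin H → Fin S × Fin A) : ℝ :=
  ∑ k : Fin K, stratValue H (p k) (played alg i obs ts k) (ℓ k) sinit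

/-- `E[∑_k V₁^{π^k,p^k,ℓ^k}]`: the expectation, over the algorithm's seed and
the realized trajectories, of the total value of the selected strategies. -/
noncomputable def algValue {Obs : Type} (H K : ℕ) (alg : Alg S A Obs)
    (p : ℕ → ℕ → Fin S → Fin A → Fin S → ℝ) (ℓ : ℕ → ℕ → Fin S → Fin A → ℝ)
    (obs : ℕ → (Fin H → Fin S × Fin A) → Obs) (sinit : Fin S) : ℝ :=
  ∑' i : ℕ, alg.w i * ∑ ts : Fin K → Fin H → Fin S × Fin A,
    seqProb alg i p obs sinit ts * playedValue H K alg i p ℓ obs sinit ts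

/-- The expected regret `E[R_K]` of the algorithm. -/
noncomputable def expRegret {Obs : Type} (H K : ℕ) (alg : Alg S A Obs)
    (p : ℕ → ℕ → Fin S → Fin A → Fin S → ℝ) (ℓ : ℕ → ℕ → Fin S → Fin A → ℝ)
    (obs : ℕ → (Fin H → Fin S × Fin A) → Obs) (sinit : Fin S) : ℝ :=
  algValue H K alg p ℓ obs sinit - bestValue H K p ℓ sinit

open scoped Classical in
/-- The probability of an event `E` (a predicate of the seed and the realized
trajectories) under the interaction of `alg` with the episodic MDP. -/
noncomputable def eventProb {Obs : Type} (H K : ℕ) (alg : Alg S A Obs)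
    (p : ℕ → ℕ → Fin S → Fin A → Fin S → ℝ)
    (obs : ℕ → (Fin H → Fin S × Fin A) → Obs) (sinit : Fin S)
    (E : ℕ → (Fin K → Fin H → Fin S × Fin A) → Prop) : ℝ :=
  ∑' i : ℕ, alg.w i * ∑ ts : Fin K → Fin H → Fin S × Fin A,
    seqProb alg i p obs sinit ts * (if E i ts then 1 else 0)


/-- Observations with bandit feedback: the realized trajectory and the losses
along it. -/
abbrev BanditObs (S A H : ℕ) : Type :=
  (Fin H → Fin S × Fin A) × (Fin H → ℝ)

/-- The bandit observation map. -/
noncomputable def banditObs {S A : ℕ} (H : ℕ)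
    (ℓ : ℕ → ℕ → Fin S → Fin A → ℝ) :
    ℕ → (Fin H → Fin S × Fin A) → BanditObs S A H :=
  fun k t => (t, fun h => ℓ k h (t h).1 (t h).2)

/-! ### Lists of fixed length -/

/-- The finite set of lists of length `n` over a finite type. -/
def listsOf (α : Type*) [Fintype α] : ℕ → Finset (List α)
  | 0 => {[]}
  | n + 1 => (univ ×ˢ listsOf α n).map
      ⟨fun q : α × List α => q.1 :: q.2, fun a b h => by
        obtain ⟨h₁, h₂⟩ := List.cons.inj h
        exact Prod.ext h₁ h₂⟩

theorem sum_listsOf_zero {α : Type*} [Fintype α] (F : List α → ℝ) :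
    ∑ τ ∈ listsOf α 0, F τ = F [] := by
  simp [listsOf]

theorem sum_listsOf_succ {α : Type*} [Fintype α] (n : ℕ) (F : List α → ℝ) :
    ∑ τ ∈ listsOf α (n + 1), F τ = ∑ τ ∈ listsOf α n, ∑ x, F (x :: τ) := by
  rw [listsOf, sum_map, sum_product_right]
  rfl

theorem mem_listsOf {α : Type*} [Fintype α] {n : ℕ} {τ : List α} :
    τ ∈ listsOf α n ↔ τ.length = n := by
  induction n generalizing τ with
  | zero => simp [listsOf]
  | succ n ih =>
    cases τ with
    | nil => simp [listsOf]
    | cons x τ =>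
      rw [listsOf, mem_map, List.length_cons, Nat.add_right_cancel_iff, ← ih]
      constructor
      · rintro ⟨⟨a, b⟩, hb, h⟩
        change a :: b = x :: τ at h
        obtain ⟨-, rfl⟩ := List.cons.inj h
        exact (mem_product.1 hb).2
      · exact fun h => ⟨(x, τ), mem_product.2 ⟨mem_univ _, h⟩, rfl⟩

theorem sum_reverse_ofFn {α : Type*} [Fintype α] (n : ℕ) (F : List α → ℝ) :
    ∑ t : Fin n → α, F (List.ofFn t).reverse = ∑ τ ∈ listsOf α n, F τ := by
  induction n generalizing F with
  | zero => simp [listsOf]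
  | succ n ih =>
    rw [sum_listsOf_succ, ← ih, ← (Fin.snocEquiv fun _ => α).sum_comp, Fintype.sum_prod_type_right]
    refine sum_congr rfl fun t _ => sum_congr rfl fun x _ => ?_
    rw [List.ofFn_succ']
    simp [Fin.snocEquiv]

/-- The first `n` entries (in chronological order) of a list whose head is the most recent
entry. -/
def pre {α : Type*} (n : ℕ) (τ : List α) : List α := τ.drop (τ.length - n)

theorem pre_cons_of_le {α : Type*} {n : ℕ} {τ : List α} (x : α) (h : n ≤ τ.length) :
    pre n (x :: τ) = pre n τ := by
  unfold pre
  rw [List.length_cons, Nat.sub_add_comm h, List.drop_succ_cons]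

theorem pre_of_length {α : Type*} {n : ℕ} {τ : List α} (h : τ.length = n) : pre n τ = τ := by
  simp [pre, h]

theorem length_pre {α : Type*} {n : ℕ} {τ : List α} (h : n ≤ τ.length) :
    (pre n τ).length = n := by
  simp [pre]; omega

/-! ### Plans and path weights -/

/-- Trajectory prefixes, most recent state-action pair first. -/
abbrev Hist (S A : ℕ) : Type := List (Fin S × Fin A)

/-- Families of (unnormalized) transition kernels. -/
abbrev Ker (S A : ℕ) : Type := ℕ → Fin S → Fin A → Fin S → ℝ

/-- A realization plan: the contribution of a strategy to the probability of a prefix. -/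
structure IsPlan (f : Hist S A → ℝ) : Prop where
  nil : f [] = 1
  nonneg : ∀ τ, 0 ≤ f τ
  sum : ∀ τ s, ∑ a, f ((s, a) :: τ) = f τ

theorem IsPlan.cons_le {f : Hist S A → ℝ} (hf : IsPlan f) (x : Fin S × Fin A) (τ : Hist S A) :
    f (x :: τ) ≤ f τ := by
  rw [← hf.sum τ x.1]
  exact single_le_sum (f := fun a => f ((x.1, a) :: τ)) (fun a _ => hf.nonneg _) (mem_univ x.2)

theorem IsPlan.le_one {f : Hist S A → ℝ} (hf : IsPlan f) (τ : Hist S A) : f τ ≤ 1 := by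
  induction τ with
  | nil => exact hf.nil.le
  | cons x τ ih => exact (hf.cons_le x τ).trans ih

/-- The plan of a Markov policy. -/
def markovPlan (π : ℕ → Fin S → Fin A → ℝ) : Hist S A → ℝ
  | [] => 1
  | x :: τ => markovPlan π τ * π τ.length x.1 x.2

theorem isPlan_markovPlan {π : ℕ → Fin S → Fin A → ℝ} (hπ : IsPolicy π) :
    IsPlan (markovPlan π) where
  nil := rfl
  nonneg τ := by
    induction τ with
    | nil => exact zero_le_one
    | cons x τ ih => exact mul_nonneg ih (hπ.1 _ _ _)
  sum τ s := by simp [markovPlan, ← mul_sum, hπ.2]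

theorem isPolicy_uniform (hA : 1 ≤ A) :
    IsPolicy (fun (_ : ℕ) (_ : Fin S) (_ : Fin A) => (1 : ℝ) / A) :=
  ⟨fun _ _ _ => by positivity, fun _ _ => by
    have : (A : ℝ) ≠ 0 := by positivity
    simp [this]⟩

/-- The behaviour strategy realizing a plan. -/
noncomputable def planStrat (f : Hist S A → ℝ) (t : List (Fin S × Fin A)) (s : Fin S)
    (a : Fin A) : ℝ :=
  if f t.reverse = 0 then 1 / A else f ((s, a) :: t.reverse) / f t.reverse

theorem isStrategy_planStrat {f : Hist S A → ℝ} (hA : 1 ≤ A) (hf : IsPlan f) :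
    IsStrategy (planStrat f) := by
  have hA' : (A : ℝ) ≠ 0 := by positivity
  refine ⟨fun t s a => ?_, fun t s => ?_⟩
  · unfold planStrat
    split_ifs
    · positivity
    · exact div_nonneg (hf.nonneg _) (hf.nonneg _)
  · unfold planStrat
    split_ifs with h
    · simp [hA']
    · rw [← sum_div, hf.sum, div_self h]

theorem mul_planStrat {f : Hist S A → ℝ} (hf : IsPlan f) (t : List (Fin S × Fin A))
    (x : Fin S × Fin A) : f t.reverse * planStrat f t x.1 x.2 = f (x :: t.reverse) := by
  unfold planStrat
  split_ifs with h
  · rw [h, zero_mul]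
    exact le_antisymm (hf.nonneg _) (h ▸ hf.cons_le x _)
  · rw [mul_div_cancel₀ _ h]

/-- The weight of entering a state after a prefix. -/
def enter (κ : Ker S A) (s₀ : Fin S) : Hist S A → Fin S → ℝ
  | [], s => if s = s₀ then 1 else 0
  | x :: τ, s => κ τ.length x.1 x.2 s

/-- The contribution of the kernels to the weight of a prefix. -/
def pathW (κ : Ker S A) (s₀ : Fin S) : Hist S A → ℝ
  | [] => 1
  | x :: τ => pathW κ s₀ τ * enter κ s₀ τ x.1

theorem plan_mul_pathW_append {p : Ker S A} {f : Hist S A → ℝ} (hf : IsPlan f) (s₀ : Fin S)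
    (rest : List (Fin S × Fin A)) (x : Fin S × Fin A) (t : List (Fin S × Fin A)) :
    f ((t ++ x :: rest).reverse) * pathW p s₀ (t ++ x :: rest).reverse =
      f t.reverse * pathW p s₀ t.reverse * enter p s₀ t.reverse x.1 *
        trajProb p (planStrat f) t.length x.1 t (x :: rest) := by
  induction rest generalizing x t with
  | nil =>
    have := mul_planStrat hf t x
    simp only [List.reverse_append, List.reverse_cons, List.reverse_nil, List.nil_append,
      List.singleton_append, pathW, trajProb, if_true]
    rw [← this]; ring
  | cons y rest ih =>
    have h := ih y (t ++ [x])
    have h2 := mul_planStrat hf t x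
    rw [List.append_assoc, List.singleton_append] at h
    rw [h]
    simp only [List.reverse_append, List.reverse_cons, List.reverse_nil, List.nil_append,
      List.singleton_append, pathW, trajProb, if_true, enter, List.length_append,
      List.length_reverse, List.length_cons, List.length_nil, zero_add]
    rw [← h2]; ring

theorem trajDist_planStrat {H : ℕ} (hH : 1 ≤ H) {p : Ker S A} {f : Hist S A → ℝ}
    (hf : IsPlan f) (s₀ : Fin S) (t : Fin H → Fin S × Fin A) :
    trajDist H p (planStrat f) s₀ t =
      f (List.ofFn t).reverse * pathW p s₀ (List.ofFn t).reverse := by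
  obtain ⟨H, rfl⟩ : ∃ n, H = n + 1 := ⟨H - 1, by omega⟩
  unfold trajDist
  rw [List.ofFn_succ]
  generalize t 0 = x
  generalize List.ofFn (fun i => t (Fin.succ i)) = rest
  have h := plan_mul_pathW_append (p := p) hf s₀ rest x []
  simp only [List.nil_append, List.reverse_nil, hf.nil, pathW, enter, List.length_nil,
    one_mul] at h
  rw [h]
  split_ifs with hx
  · rw [hx, one_mul]
  · cases rest <;> simp [trajProb, hx]

/-- Nonnegativity of a kernel at the steps used in an `H`-step episode. -/
def KerNonneg (H : ℕ) (κ : Ker S A) : Prop := ∀ h s a s', h + 1 < H → 0 ≤ κ h s a s'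

theorem enter_nonneg {H : ℕ} {κ : Ker S A} (hκ : KerNonneg H κ) (s₀ : Fin S) {τ : Hist S A}
    (hτ : τ.length < H) (s : Fin S) : 0 ≤ enter κ s₀ τ s := by
  cases τ with
  | nil => simp only [enter]; split_ifs <;> norm_num
  | cons x τ => exact hκ _ _ _ _ hτ

theorem pathW_nonneg {H : ℕ} {κ : Ker S A} (hκ : KerNonneg H κ) (s₀ : Fin S) {τ : Hist S A}
    (hτ : τ.length ≤ H) : 0 ≤ pathW κ s₀ τ := by
  induction τ with
  | nil => exact zero_le_one
  | cons x τ ih =>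
    exact mul_nonneg (ih (Nat.le_of_succ_le hτ)) (enter_nonneg hκ s₀ hτ _)

theorem enter_mono {H : ℕ} {κ κ' : Ker S A}
    (hle : ∀ h s a s', h + 1 < H → κ h s a s' ≤ κ' h s a s') (s₀ : Fin S) {τ : Hist S A}
    (hτ : τ.length < H) (s : Fin S) : enter κ s₀ τ s ≤ enter κ' s₀ τ s := by
  cases τ with
  | nil => exact le_rfl
  | cons x τ => exact hle _ _ _ _ hτ

theorem pathW_mono {H : ℕ} {κ κ' : Ker S A} (hκ : KerNonneg H κ)
    (hle : ∀ h s a s', h + 1 < H → κ h s a s' ≤ κ' h s a s') (s₀ : Fin S) {τ : Hist S A}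
    (hτ : τ.length ≤ H) : pathW κ s₀ τ ≤ pathW κ' s₀ τ := by
  induction τ with
  | nil => exact le_rfl
  | cons x τ ih =>
    have h1 := ih (Nat.le_of_succ_le hτ)
    exact mul_le_mul h1 (enter_mono hle s₀ hτ _) (enter_nonneg hκ s₀ hτ _)
      ((pathW_nonneg hκ s₀ (Nat.le_of_succ_le hτ)).trans h1)

theorem sum_enter_of_isTrans {H : ℕ} {p : Ker S A} (hp : IsTrans H p) (s₀ : Fin S)
    {τ : Hist S A} (hτ : τ.length < H) : ∑ s, enter p s₀ τ s = 1 := by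
  cases τ with
  | nil => simp [enter]
  | cons x τ => exact (hp _ hτ).2 _ _

theorem IsTrans.kerNonneg {H : ℕ} {p : Ker S A} (hp : IsTrans H p) : KerNonneg H p :=
  fun h s a s' hh => (hp h hh).1 s a s'

/-- Extending a prefix by one step. -/
theorem sum_plan_mul_pathW_cons {f : Hist S A → ℝ} (hf : IsPlan f) (κ : Ker S A) (s₀ : Fin S)
    (τ : Hist S A) (g : Fin S → ℝ) :
    ∑ x : Fin S × Fin A, f (x :: τ) * pathW κ s₀ (x :: τ) * g x.1 =
      f τ * pathW κ s₀ τ * ∑ s, enter κ s₀ τ s * g s := by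
  rw [Fintype.sum_prod_type, mul_sum]
  refine sum_congr rfl fun s _ => ?_
  simp only [pathW]
  rw [← sum_mul, ← sum_mul, hf.sum]
  ring

/-- Marginalization of the trajectory law onto prefixes. -/
theorem sum_marginal {H : ℕ} {p : Ker S A} (hp : IsTrans H p) {f : Hist S A → ℝ}
    (hf : IsPlan f) (s₀ : Fin S) {n m : ℕ} (hnm : n ≤ m) (hm : m ≤ H) (F : Hist S A → ℝ) :
    ∑ τ ∈ listsOf _ m, f τ * pathW p s₀ τ * F (pre n τ) =
      ∑ τ ∈ listsOf _ n, f τ * pathW p s₀ τ * F τ := by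
  induction m, hnm using Nat.le_induction with
  | base =>
    refine sum_congr rfl fun τ hτ => ?_
    rw [pre_of_length (mem_listsOf.1 hτ)]
  | succ m hnm ih =>
    rw [← ih (by omega), sum_listsOf_succ]
    refine sum_congr rfl fun τ hτ => ?_
    have hl := mem_listsOf.1 hτ
    have h := sum_plan_mul_pathW_cons hf p s₀ τ (fun _ => 1)
    simp only [mul_one] at h
    simp only [pre_cons_of_le _ (hnm.trans hl.ge)]
    rw [← sum_mul, h, sum_enter_of_isTrans hp s₀ (by omega), mul_one]

theorem sum_plan_mul_pathW_eq_one {H : ℕ} {p : Ker S A} (hp : IsTrans H p) {f : Hist S A → ℝ}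
    (hf : IsPlan f) (s₀ : Fin S) {n : ℕ} (hn : n ≤ H) :
    ∑ τ ∈ listsOf _ n, f τ * pathW p s₀ τ = 1 := by
  have h := sum_marginal hp hf s₀ (Nat.zero_le n) hn (fun _ => 1)
  simp only [mul_one] at h
  rw [h, sum_listsOf_zero, hf.nil, pathW, one_mul]

/-- Total mass of prefixes under kernels with bounded row sums. -/
theorem sum_plan_mul_pathW_le {H : ℕ} {κ : Ker S A} (hκ : KerNonneg H κ) {f : Hist S A → ℝ}
    (hf : IsPlan f) (s₀ : Fin S) {c : ℕ → ℝ} (hc : ∀ h, 0 ≤ c h)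
    (hrow : ∀ h s a, h + 1 < H → ∑ s', κ h s a s' ≤ c h) {n : ℕ} (hn : n + 1 ≤ H) :
    ∑ τ ∈ listsOf _ (n + 1), f τ * pathW κ s₀ τ ≤ ∏ h ∈ range n, c h := by
  induction n with
  | zero =>
    rw [sum_listsOf_succ, sum_listsOf_zero]
    have h := sum_plan_mul_pathW_cons hf κ s₀ [] (fun _ => 1)
    simp only [mul_one] at h
    rw [h, hf.nil]
    simp [pathW, enter]
  | succ n ih =>
    rw [sum_listsOf_succ, prod_range_succ]
    refine le_trans ?_ (mul_le_mul_of_nonneg_right (ih (by omega)) (hc n))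
    rw [sum_mul]
    refine sum_le_sum fun τ hτ => ?_
    have hl := mem_listsOf.1 hτ
    have h := sum_plan_mul_pathW_cons hf κ s₀ τ (fun _ => 1)
    simp only [mul_one] at h
    rw [h]
    refine mul_le_mul_of_nonneg_left ?_
      (mul_nonneg (hf.nonneg _) (pathW_nonneg hκ s₀ (by omega)))
    cases τ with
    | nil => simp at hl
    | cons x τ =>
      simp only [List.length_cons, Nat.add_right_cancel_iff] at hl
      simp only [enter, hl]
      exact hrow n _ _ (by omega)

/-- Simulation lemma: the total mass of the difference of two path weights is at most the
accumulated one-step discrepancy along the true law. -/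
theorem sum_pathW_sub_le {H : ℕ} {a b p : Ker S A} (hb : KerNonneg H b)
    (hbp : ∀ h s x s', h + 1 < H → b h s x s' ≤ p h s x s')
    (hba : ∀ h s x s', h + 1 < H → b h s x s' ≤ a h s x s')
    (hrow : ∀ h s x, h + 1 < H → ∑ s', a h s x s' ≤ 1) {f : Hist S A → ℝ}
    (hf : IsPlan f) (s₀ : Fin S) {e : Hist S A → ℝ} (he0 : ∀ τ, 0 ≤ e τ)
    (he : ∀ x τ, τ.length + 1 < H →
      ∑ s', (a τ.length x.1 x.2 s' - b τ.length x.1 x.2 s') ≤ e (x :: τ))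
    {n : ℕ} (hn : n ≤ H) :
    ∑ τ ∈ listsOf _ n, f τ * (pathW a s₀ τ - pathW b s₀ τ) ≤
      ∑ m ∈ range n, ∑ τ ∈ listsOf _ m, f τ * pathW p s₀ τ * e τ := by
  induction n with
  | zero => simp [sum_listsOf_zero, pathW]
  | succ n ih =>
    rw [sum_listsOf_succ, sum_range_succ]
    refine le_trans ?_ (add_le_add_left (ih (by omega)) _)
    rw [← sum_add_distrib]
    refine sum_le_sum fun τ hτ => ?_
    have hl := mem_listsOf.1 hτ
    have h1 := sum_plan_mul_pathW_cons hf a s₀ τ (fun _ => 1)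
    have h2 := sum_plan_mul_pathW_cons hf b s₀ τ (fun _ => 1)
    simp only [mul_one] at h1 h2
    simp only [mul_sub, sum_sub_distrib]
    rw [h1, h2]
    have ha1 : ∑ s, enter a s₀ τ s ≤ 1 := by
      cases τ with
      | nil => simp [enter]
      | cons x τ => exact hrow _ _ _ (by simp at hl; omega)
    have hab : ∑ s, enter a s₀ τ s - ∑ s, enter b s₀ τ s ≤ e τ := by
      cases τ with
      | nil => simpa [enter] using he0 []
      | cons x τ =>
        have := he x τ (by simp at hl; omega)
        rwa [sum_sub_distrib] at this
    have hB0 := pathW_nonneg hb s₀ (τ := τ) (by omega)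
    have hBA := pathW_mono hb hba s₀ (τ := τ) (by omega)
    have hBP := pathW_mono hb hbp s₀ (τ := τ) (by omega)
    have hf0 := hf.nonneg τ
    have e1 : f τ * ((pathW a s₀ τ - pathW b s₀ τ) * (1 - ∑ s, enter a s₀ τ s)) ≥ 0 :=
      mul_nonneg hf0 (mul_nonneg (by linarith) (by linarith))
    have e2 : f τ * (pathW b s₀ τ * (e τ - (∑ s, enter a s₀ τ s - ∑ s, enter b s₀ τ s))) ≥ 0 :=
      mul_nonneg hf0 (mul_nonneg (by linarith) (by linarith))
    have e3 : f τ * ((pathW p s₀ τ - pathW b s₀ τ) * e τ) ≥ 0 :=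
      mul_nonneg hf0 (mul_nonneg (by linarith) (he0 τ))
    nlinarith [e1, e2, e3]

/-! ### Values in terms of prefixes -/

/-- The loss suffered at the last step of a prefix. -/
def lastLoss (ℓ : ℕ → Fin S → Fin A → ℝ) : Hist S A → ℝ
  | [] => 0
  | x :: τ => ℓ τ.length x.1 x.2

/-- The expected cumulative loss of a plan. -/
noncomputable def planValue (H : ℕ) (p : Ker S A) (f : Hist S A → ℝ)
    (ℓ : ℕ → Fin S → Fin A → ℝ) (s₀ : Fin S) : ℝ :=
  ∑ h ∈ range H, ∑ τ ∈ listsOf _ (h + 1), f τ * pathW p s₀ τ * lastLoss ℓ τ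

theorem sum_markovPlan_mul_enter (p : Ker S A) (π : ℕ → Fin S → Fin A → ℝ) (s₀ : Fin S)
    (h : ℕ) (s : Fin S) :
    ∑ τ ∈ listsOf _ h, markovPlan π τ * pathW p s₀ τ * enter p s₀ τ s =
      stateDist p π s₀ h s := by
  induction h generalizing s with
  | zero => simp [sum_listsOf_zero, markovPlan, pathW, enter, stateDist]
  | succ h ih =>
    rw [sum_listsOf_succ, stateDist]
    simp only [← ih, sum_mul]
    rw [sum_comm, ← Fintype.sum_prod_type' (f := fun (s₁ : Fin S) (a : Fin A) =>
      ∑ τ ∈ listsOf _ h, markovPlan π τ * pathW p s₀ τ * enter p s₀ τ s₁ * π h s₁ a *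
        p h s₁ a s)]
    refine sum_congr rfl fun x _ => sum_congr rfl fun τ hτ => ?_
    simp only [markovPlan, pathW, enter, mem_listsOf.1 hτ]
    ring

theorem value_eq_planValue (H : ℕ) (p : Ker S A) (π : ℕ → Fin S → Fin A → ℝ)
    (ℓ : ℕ → Fin S → Fin A → ℝ) (s₀ : Fin S) :
    value H p π ℓ s₀ = planValue H p (markovPlan π) ℓ s₀ := by
  unfold value planValue
  refine sum_congr rfl fun h _ => ?_
  rw [sum_listsOf_succ]
  simp only [← sum_markovPlan_mul_enter, sum_mul]
  rw [← Fintype.sum_prod_type' (f := fun (s₁ : Fin S) (a : Fin A) =>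
      ∑ τ ∈ listsOf _ h, markovPlan π τ * pathW p s₀ τ * enter p s₀ τ s₁ * π h s₁ a *
        ℓ h s₁ a)]
  rw [sum_comm]
  refine sum_congr rfl fun τ hτ => sum_congr rfl fun x _ => ?_
  simp only [markovPlan, pathW, lastLoss, mem_listsOf.1 hτ]
  ring

theorem pre_reverse {α : Type*} {n : ℕ} {l : List α} (h : n ≤ l.length) :
    pre n l.reverse = (l.take n).reverse := by
  rw [pre, List.length_reverse, List.drop_reverse]
  congr 2
  omega

theorem pre_succ_reverse_ofFn {α : Type*} {H : ℕ} (t : Fin H → α) {h : ℕ} (hh : h < H) :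
    pre (h + 1) (List.ofFn t).reverse = t ⟨h, hh⟩ :: pre h (List.ofFn t).reverse := by
  rw [pre_reverse (by simpa using hh), pre_reverse (by simpa using hh.le),
    List.take_succ_eq_append_getElem (by simpa using hh)]
  simp

theorem lastLoss_pre_reverse_ofFn {H : ℕ} (ℓ : ℕ → Fin S → Fin A → ℝ)
    (t : Fin H → Fin S × Fin A) {h : ℕ} (hh : h < H) :
    lastLoss ℓ (pre (h + 1) (List.ofFn t).reverse) = ℓ h (t ⟨h, hh⟩).1 (t ⟨h, hh⟩).2 := by
  rw [pre_succ_reverse_ofFn t hh, lastLoss, length_pre (by simpa using hh.le)]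

theorem trajLoss_eq {H : ℕ} (ℓ : ℕ → Fin S → Fin A → ℝ) (t : Fin H → Fin S × Fin A) :
    trajLoss H ℓ t = ∑ h ∈ range H, lastLoss ℓ (pre (h + 1) (List.ofFn t).reverse) := by
  rw [trajLoss, sum_range]
  exact sum_congr rfl fun h _ => (lastLoss_pre_reverse_ofFn ℓ t h.2).symm

theorem sum_trajDist {H : ℕ} (hH : 1 ≤ H) {p : Ker S A} {f : Hist S A → ℝ} (hf : IsPlan f)
    (s₀ : Fin S) (F : Hist S A → ℝ) :
    ∑ t, trajDist H p (planStrat f) s₀ t * F (List.ofFn t).reverse =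
      ∑ τ ∈ listsOf _ H, f τ * pathW p s₀ τ * F τ := by
  rw [← sum_reverse_ofFn]
  exact sum_congr rfl fun t _ => by rw [trajDist_planStrat hH hf]

theorem stratValue_planStrat {H : ℕ} (hH : 1 ≤ H) {p : Ker S A} (hp : IsTrans H p)
    {f : Hist S A → ℝ} (hf : IsPlan f) (ℓ : ℕ → Fin S → Fin A → ℝ) (s₀ : Fin S) :
    stratValue H p (planStrat f) ℓ s₀ = planValue H p f ℓ s₀ := by
  unfold stratValue planValue
  simp only [trajLoss_eq]
  rw [sum_trajDist hH hf s₀ (fun τ => ∑ h ∈ range H, lastLoss ℓ (pre (h + 1) τ))]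
  simp only [mul_sum]
  rw [sum_comm]
  refine sum_congr rfl fun h hh => ?_
  exact sum_marginal hp hf s₀ (mem_range.1 hh) le_rfl (lastLoss ℓ)

theorem lastLoss_mem {H : ℕ} {ℓ : ℕ → Fin S → Fin A → ℝ} (hℓ : IsLoss H ℓ) {τ : Hist S A}
    (hτ : τ.length ≤ H) : 0 ≤ lastLoss ℓ τ ∧ lastLoss ℓ τ ≤ 1 := by
  cases τ with
  | nil => simp [lastLoss]
  | cons x τ => exact hℓ _ _ _ hτ

theorem planValue_nonneg {H : ℕ} {p : Ker S A} (hp : IsTrans H p) {f : Hist S A → ℝ}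
    (hf : IsPlan f) {ℓ : ℕ → Fin S → Fin A → ℝ} (hℓ : IsLoss H ℓ) (s₀ : Fin S) :
    0 ≤ planValue H p f ℓ s₀ := by
  refine sum_nonneg fun h hh => sum_nonneg fun τ hτ => ?_
  have hl : τ.length ≤ H := by rw [mem_listsOf.1 hτ]; exact mem_range.1 hh
  exact mul_nonneg (mul_nonneg (hf.nonneg _) (pathW_nonneg hp.kerNonneg s₀ hl))
    (lastLoss_mem hℓ hl).1

theorem planValue_le {H : ℕ} {p : Ker S A} (hp : IsTrans H p) {f : Hist S A → ℝ}
    (hf : IsPlan f) {ℓ : ℕ → Fin S → Fin A → ℝ} (hℓ : IsLoss H ℓ) (s₀ : Fin S) :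
    planValue H p f ℓ s₀ ≤ H := by
  have : ∀ h ∈ range H, ∑ τ ∈ listsOf _ (h + 1), f τ * pathW p s₀ τ * lastLoss ℓ τ ≤ 1 := by
    intro h hh
    rw [← sum_plan_mul_pathW_eq_one hp hf s₀ (n := h + 1) (mem_range.1 hh)]
    refine sum_le_sum fun τ hτ => ?_
    have hl : τ.length ≤ H := by rw [mem_listsOf.1 hτ]; exact mem_range.1 hh
    exact mul_le_of_le_one_right (mul_nonneg (hf.nonneg _) (pathW_nonneg hp.kerNonneg s₀ hl))
      (lastLoss_mem hℓ hl).2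
  exact (sum_le_sum this).trans (by simp)

/-! ### Keys: the part of a prefix that determines the adversarial transitions -/

/-- A prefix length, the last state-action pair, and the transitions taken at adversarial
steps. -/
abbrev Key (S A : ℕ) : Type :=
  ℕ × Option (Fin S × Fin A) × List (ℕ × Fin S × Fin A × Fin S)

instance : DecidableEq (Key S A) := fun x y =>
  decidable_of_iff (x.1 = y.1 ∧ x.2.1 = y.2.1 ∧ x.2.2 = y.2.2)
    ⟨fun h => Prod.ext h.1 (Prod.ext h.2.1 h.2.2), fun h => h ▸ ⟨rfl, rfl, rfl⟩⟩

/-- The transitions at adversarial steps along a prefix followed by the given state. -/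
def advKey (Λ : Finset ℕ) : Hist S A → Fin S → List (ℕ × Fin S × Fin A × Fin S)
  | [], _ => []
  | x :: τ, s =>
    if τ.length ∈ Λ then (τ.length, x.1, x.2, s) :: advKey Λ τ x.1 else advKey Λ τ x.1

/-- The key of a prefix. -/
def key (Λ : Finset ℕ) : Hist S A → Key S A
  | [] => (0, none, [])
  | x :: τ => (τ.length + 1, some x, advKey Λ τ x.1)

/-- Kernels replaced by `1` at adversarial steps. -/
def statKer (Λ : Finset ℕ) (κ : Ker S A) : Ker S A :=
  fun h s a s' => if h ∈ Λ then 1 else κ h s a s'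

/-- Kernels replaced by `p` at adversarial steps. -/
def mixKer (Λ : Finset ℕ) (κ p : Ker S A) : Ker S A :=
  fun h s a s' => if h ∈ Λ then p h s a s' else κ h s a s'

theorem mixKer_self (Λ : Finset ℕ) (p : Ker S A) : mixKer Λ p p = p := by
  unfold mixKer; simp

/-- The probability of the adversarial transitions recorded in a key. -/
def advProb (p : Ker S A) (k : List (ℕ × Fin S × Fin A × Fin S)) : ℝ :=
  (k.map fun y => p y.1 y.2.1 y.2.2.1 y.2.2.2).prod

theorem pathW_mixKer (Λ : Finset ℕ) (κ p : Ker S A) (s₀ : Fin S) (τ : Hist S A) :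
    pathW (mixKer Λ κ p) s₀ τ =
      pathW (statKer Λ κ) s₀ τ * advProb p (key Λ τ).2.2 := by
  have aux : ∀ (τ : Hist S A) (s : Fin S),
      pathW (mixKer Λ κ p) s₀ τ * enter (mixKer Λ κ p) s₀ τ s =
        pathW (statKer Λ κ) s₀ τ * enter (statKer Λ κ) s₀ τ s * advProb p (advKey Λ τ s) := by
    intro τ
    induction τ with
    | nil => intro s; simp [pathW, enter, advKey, advProb]
    | cons x τ ih =>
      intro s
      simp only [pathW, ih]
      by_cases hΛ : τ.length ∈ Λ
      · simp only [enter, mixKer, statKer, advKey, if_pos hΛ, advProb, List.map_cons,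
          List.prod_cons]
        ring
      · simp only [enter, mixKer, statKer, advKey, if_neg hΛ]
        ring
  cases τ with
  | nil => simp [pathW, key, advProb]
  | cons x τ => exact aux τ x.1

theorem pathW_mul (κ κ' : Ker S A) (s₀ : Fin S) (τ : Hist S A) :
    pathW κ s₀ τ * pathW κ' s₀ τ = pathW (fun h s a s' => κ h s a s' * κ' h s a s') s₀ τ := by
  induction τ with
  | nil => simp [pathW]
  | cons x τ ih =>
    have : enter κ s₀ τ x.1 * enter κ' s₀ τ x.1 =
        enter (fun h s a s' => κ h s a s' * κ' h s a s') s₀ τ x.1 := by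
      cases τ with
      | nil => simp only [enter]; split_ifs <;> simp
      | cons y τ => rfl
    simp only [pathW]
    rw [← ih, ← this]
    ring

theorem statKer_mul (Λ : Finset ℕ) (κ κ' : Ker S A) :
    (fun h s a s' => statKer Λ κ h s a s' * statKer Λ κ' h s a s') =
      statKer Λ (fun h s a s' => κ h s a s' * κ' h s a s') := by
  funext h s a s'
  unfold statKer
  split_ifs <;> simp

/-- The possible lists of adversarial transitions before step `n`. -/
def advKeys (S A : ℕ) (Λ : Finset ℕ) : ℕ → Finset (List (ℕ × Fin S × Fin A × Fin S))
  | 0 => {[]}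
  | n + 1 => if n ∈ Λ then
      ((univ : Finset (Fin S × Fin A × Fin S)) ×ˢ advKeys S A Λ n).image
        fun q => (n, q.1) :: q.2
    else advKeys S A Λ n

theorem advKey_mem (Λ : Finset ℕ) (τ : Hist S A) (s : Fin S) :
    advKey Λ τ s ∈ advKeys S A Λ τ.length := by
  induction τ generalizing s with
  | nil => simp [advKey, advKeys]
  | cons x τ ih =>
    simp only [advKey, advKeys, List.length_cons]
    split_ifs with h
    · exact mem_image.2 ⟨((x.1, x.2, s), advKey Λ τ x.1), mem_product.2 ⟨mem_univ _, ih _⟩, rfl⟩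
    · exact ih _

theorem sum_advKeys_succ (Λ : Finset ℕ) {n : ℕ} (hn : n ∈ Λ)
    (G : List (ℕ × Fin S × Fin A × Fin S) → ℝ) :
    ∑ k ∈ advKeys S A Λ (n + 1), G k =
      ∑ k ∈ advKeys S A Λ n, ∑ y : Fin S × Fin A × Fin S, G ((n, y) :: k) := by
  rw [advKeys, if_pos hn, sum_image, sum_product_right]
  rintro ⟨a, b⟩ - ⟨a', b'⟩ - h
  simpa using h

theorem card_advKeys (Λ : Finset ℕ) (n : ℕ) :
    (∑ _k ∈ advKeys S A Λ n, (1 : ℝ)) =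
      ∏ t ∈ range n, if t ∈ Λ then (S : ℝ) * A * S else 1 := by
  induction n with
  | zero => simp [advKeys]
  | succ n ih =>
    rw [prod_range_succ]
    by_cases h : n ∈ Λ
    · rw [sum_advKeys_succ Λ h, if_pos h, ← ih, sum_mul]
      refine sum_congr rfl fun k _ => ?_
      simp
      ring
    · rw [if_neg h, mul_one, ← ih, advKeys, if_neg h]

theorem sum_advProb {H : ℕ} {p : Ker S A} (hp : IsTrans H p) (Λ : Finset ℕ) {n : ℕ}
    (hn : n < H) :
    ∑ k ∈ advKeys S A Λ n, advProb p k =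
      ∏ t ∈ range n, if t ∈ Λ then (S : ℝ) * A else 1 := by
  induction n with
  | zero => simp [advKeys, advProb]
  | succ n ih =>
    rw [prod_range_succ]
    by_cases h : n ∈ Λ
    · rw [sum_advKeys_succ Λ h, if_pos h, ← ih (by omega), sum_mul]
      refine sum_congr rfl fun k _ => ?_
      simp only [advProb, List.map_cons, List.prod_cons]
      rw [← sum_mul, Fintype.sum_prod_type]
      simp only [Fintype.sum_prod_type, (hp n hn).2]
      simp
      ring
    · rw [if_neg h, mul_one, ← ih (by omega), advKeys, if_neg h]

theorem prod_ite_mem_le_pow (Λ : Finset ℕ) (n : ℕ) {c : ℝ} (hc : 1 ≤ c) :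
    ∏ t ∈ range n, (if t ∈ Λ then c else 1) ≤ c ^ Λ.card := by
  rw [prod_ite, prod_const, prod_const_one, mul_one]
  exact pow_le_pow_right₀ hc (card_le_card fun t ht => (mem_filter.1 ht).2)

theorem advProb_nonneg {H : ℕ} {p : Ker S A} (hp : KerNonneg H p) (Λ : Finset ℕ) {n : ℕ}
    (hn : n < H) {k : List (ℕ × Fin S × Fin A × Fin S)} (hk : k ∈ advKeys S A Λ n) :
    0 ≤ advProb p k := by
  induction n generalizing k with
  | zero =>
    simp only [advKeys, mem_singleton] at hk
    simp [hk, advProb]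
  | succ n ih =>
    rw [advKeys] at hk
    split_ifs at hk with h
    · obtain ⟨⟨y, k'⟩, hy, rfl⟩ := mem_image.1 hk
      simp only [advProb, List.map_cons, List.prod_cons]
      exact mul_nonneg (hp _ _ _ _ hn) (ih (by omega) (mem_product.1 hy).2)
    · exact ih (by omega) hk

/-- The keys of prefixes of length `h + 1`. -/
def keyLayer (S A : ℕ) (Λ : Finset ℕ) (h : ℕ) : Finset (Key S A) :=
  ((univ : Finset (Fin S × Fin A)) ×ˢ advKeys S A Λ h).image fun q => (h + 1, some q.1, q.2)

/-- The keys of nonempty prefixes of length at most `H`. -/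
def keySet (S A : ℕ) (Λ : Finset ℕ) (H : ℕ) : Finset (Key S A) :=
  (range H).biUnion (keyLayer S A Λ)

theorem fst_of_mem_keyLayer {Λ : Finset ℕ} {h : ℕ} {x : Key S A}
    (hx : x ∈ keyLayer S A Λ h) : x.1 = h + 1 := by
  obtain ⟨q, -, rfl⟩ := mem_image.1 hx
  rfl

theorem sum_keySet (Λ : Finset ℕ) (H : ℕ) (G : Key S A → ℝ) :
    ∑ x ∈ keySet S A Λ H, G x = ∑ h ∈ range H, ∑ x ∈ keyLayer S A Λ h, G x := by
  refine sum_biUnion fun h _ h' _ hne => ?_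
  refine disjoint_left.2 fun x hx hx' => hne ?_
  have := fst_of_mem_keyLayer hx
  have := fst_of_mem_keyLayer hx'
  omega

theorem sum_keyLayer (Λ : Finset ℕ) (h : ℕ) (G : Key S A → ℝ) :
    ∑ x ∈ keyLayer S A Λ h, G x =
      ∑ y : Fin S × Fin A, ∑ k ∈ advKeys S A Λ h, G (h + 1, some y, k) := by
  rw [keyLayer, sum_image, sum_product]
  rintro ⟨a, b⟩ - ⟨a', b'⟩ - h
  simpa using h

theorem key_mem_keyLayer (Λ : Finset ℕ) {h : ℕ} {τ : Hist S A} (hτ : τ.length = h + 1) :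
    key Λ τ ∈ keyLayer S A Λ h := by
  cases τ with
  | nil => simp at hτ
  | cons x τ =>
    simp only [List.length_cons, Nat.add_right_cancel_iff] at hτ
    subst hτ
    exact mem_image.2 ⟨(x, advKey Λ τ x.1), mem_product.2 ⟨mem_univ _, advKey_mem _ _ _⟩, rfl⟩

theorem sum_keySet_fiber (Λ : Finset ℕ) (H : ℕ) (c : Key S A → ℝ) (F : Hist S A → ℝ) :
    ∑ x ∈ keySet S A Λ H, c x * ∑ τ ∈ listsOf _ x.1, (if key Λ τ = x then F τ else 0) =
      ∑ h ∈ range H, ∑ τ ∈ listsOf _ (h + 1), c (key Λ τ) * F τ := by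
  rw [sum_keySet]
  refine sum_congr rfl fun h _ => ?_
  have : ∀ x ∈ keyLayer S A Λ h,
      c x * ∑ τ ∈ listsOf _ x.1, (if key Λ τ = x then F τ else 0) =
        ∑ τ ∈ listsOf _ (h + 1), if key Λ τ = x then c x * F τ else 0 := by
    intro x hx
    rw [fst_of_mem_keyLayer hx, mul_sum]
    exact sum_congr rfl fun τ _ => by rw [mul_ite, mul_zero]
  rw [sum_congr rfl this, sum_comm]
  refine sum_congr rfl fun τ hτ => ?_
  rw [sum_ite_eq, if_pos (key_mem_keyLayer Λ (mem_listsOf.1 hτ))]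

theorem sum_keySet_advProb_le {H : ℕ} {p : Ker S A} (hp : IsTrans H p) (Λ : Finset ℕ)
    (hS : 1 ≤ S) (hA : 1 ≤ A) :
    ∑ x ∈ keySet S A Λ H, advProb p x.2.2 ≤ H * ((S : ℝ) * A) ^ (Λ.card + 1) := by
  have hSA : (1 : ℝ) ≤ (S : ℝ) * A := by exact_mod_cast Nat.mul_pos hS hA
  rw [sum_keySet]
  have : ∀ h ∈ range H, ∑ x ∈ keyLayer S A Λ h, advProb p x.2.2 ≤
      ((S : ℝ) * A) ^ (Λ.card + 1) := by
    intro h hh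
    rw [sum_keyLayer]
    simp only [sum_advProb hp Λ (mem_range.1 hh)]
    rw [sum_const, card_univ, Fintype.card_prod, Fintype.card_fin, Fintype.card_fin,
      nsmul_eq_mul, pow_succ, mul_comm]
    push_cast
    exact mul_le_mul_of_nonneg_right (prod_ite_mem_le_pow Λ h hSA) (by positivity)
  exact (sum_le_sum this).trans (by simp)

theorem card_keySet_le (Λ : Finset ℕ) (H : ℕ) (hS : 1 ≤ S) (hA : 1 ≤ A) :
    ((keySet S A Λ H).card : ℝ) ≤
      H * ((S : ℝ) ^ (2 * Λ.card + 1) * (A : ℝ) ^ (Λ.card + 1)) := by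
  have hSA : (1 : ℝ) ≤ (S : ℝ) * A * S := by exact_mod_cast Nat.mul_pos (Nat.mul_pos hS hA) hS
  rw [card_eq_sum_ones, Nat.cast_sum, Nat.cast_one, sum_keySet]
  have : ∀ h ∈ range H, ∑ x ∈ keyLayer S A Λ h, (1 : ℝ) ≤
      (S : ℝ) ^ (2 * Λ.card + 1) * (A : ℝ) ^ (Λ.card + 1) := by
    intro h hh
    rw [sum_keyLayer]
    simp only [card_advKeys]
    rw [sum_const, card_univ, Fintype.card_prod, Fintype.card_fin, Fintype.card_fin,
      nsmul_eq_mul]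
    push_cast
    refine (mul_le_mul_of_nonneg_left (prod_ite_mem_le_pow Λ h hSA) (by positivity)).trans
      (le_of_eq ?_)
    rw [mul_pow, mul_pow]
    ring
  exact (sum_le_sum this).trans (by simp)

/-- The weight of a key under a plan and the stationary part of the kernels. -/
noncomputable def keyW (Λ : Finset ℕ) (s₀ : Fin S) (f : Hist S A → ℝ) (κ : Ker S A)
    (x : Key S A) : ℝ :=
  ∑ τ ∈ listsOf _ x.1, if key Λ τ = x then f τ * pathW (statKer Λ κ) s₀ τ else 0

theorem fst_le_of_mem_keySet {Λ : Finset ℕ} {H : ℕ} {x : Key S A}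
    (hx : x ∈ keySet S A Λ H) : x.1 ≤ H := by
  obtain ⟨h, hh, hx⟩ := mem_biUnion.1 hx
  rw [fst_of_mem_keyLayer hx]
  exact mem_range.1 hh

theorem advProb_nonneg_of_mem {H : ℕ} {p : Ker S A} (hp : KerNonneg H p) {Λ : Finset ℕ}
    {x : Key S A} (hx : x ∈ keySet S A Λ H) : 0 ≤ advProb p x.2.2 := by
  obtain ⟨h, hh, hx⟩ := mem_biUnion.1 hx
  obtain ⟨q, hq, rfl⟩ := mem_image.1 hx
  exact advProb_nonneg hp Λ (mem_range.1 hh) (mem_product.1 hq).2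

/-- Nonnegativity of a kernel at the stationary steps of an `H`-step episode. -/
def StatNonneg (H : ℕ) (Λ : Finset ℕ) (κ : Ker S A) : Prop :=
  ∀ h s a s', h + 1 < H → h ∉ Λ → 0 ≤ κ h s a s'

/-- Comparison of kernels at the stationary steps of an `H`-step episode. -/
def StatLE (H : ℕ) (Λ : Finset ℕ) (κ κ' : Ker S A) : Prop :=
  ∀ h s a s', h + 1 < H → h ∉ Λ → κ h s a s' ≤ κ' h s a s'

theorem StatNonneg.statKer {H : ℕ} {Λ : Finset ℕ} {κ : Ker S A} (h : StatNonneg H Λ κ) :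
    KerNonneg H (statKer Λ κ) := by
  intro t s a s' ht
  unfold AdvMDP.statKer
  split_ifs with hΛ
  · exact zero_le_one
  · exact h _ _ _ _ ht hΛ

theorem StatNonneg.mixKer {H : ℕ} {Λ : Finset ℕ} {κ p : Ker S A} (h : StatNonneg H Λ κ)
    (hp : KerNonneg H p) : KerNonneg H (mixKer Λ κ p) := by
  intro t s a s' ht
  unfold AdvMDP.mixKer
  split_ifs with hΛ
  · exact hp _ _ _ _ ht
  · exact h _ _ _ _ ht hΛ

theorem StatLE.statKer {H : ℕ} {Λ : Finset ℕ} {κ κ' : Ker S A} (h : StatLE H Λ κ κ') :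
    ∀ t s a s', t + 1 < H → statKer Λ κ t s a s' ≤ statKer Λ κ' t s a s' := by
  intro t s a s' ht
  unfold AdvMDP.statKer
  split_ifs with hΛ
  · exact le_rfl
  · exact h _ _ _ _ ht hΛ

theorem StatLE.mixKer {H : ℕ} {Λ : Finset ℕ} {κ κ' : Ker S A} (h : StatLE H Λ κ κ')
    (p : Ker S A) : ∀ t s a s', t + 1 < H → mixKer Λ κ p t s a s' ≤ mixKer Λ κ' p t s a s' := by
  intro t s a s' ht
  unfold AdvMDP.mixKer
  split_ifs with hΛ
  · exact le_rfl
  · exact h _ _ _ _ ht hΛ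

theorem keyW_nonneg {H : ℕ} {Λ : Finset ℕ} {κ : Ker S A} (hκ : StatNonneg H Λ κ) (s₀ : Fin S)
    {f : Hist S A → ℝ} (hf : IsPlan f) {x : Key S A} (hx : x.1 ≤ H) :
    0 ≤ keyW Λ s₀ f κ x := by
  refine sum_nonneg fun τ hτ => ?_
  split_ifs
  · exact mul_nonneg (hf.nonneg _) (pathW_nonneg hκ.statKer s₀ ((mem_listsOf.1 hτ).trans_le hx))
  · exact le_rfl

theorem keyW_mono {H : ℕ} {Λ : Finset ℕ} {κ κ' : Ker S A} (hκ : StatNonneg H Λ κ)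
    (hle : StatLE H Λ κ κ') (s₀ : Fin S) {f : Hist S A → ℝ} (hf : IsPlan f) {x : Key S A}
    (hx : x.1 ≤ H) : keyW Λ s₀ f κ x ≤ keyW Λ s₀ f κ' x := by
  refine sum_le_sum fun τ hτ => ?_
  split_ifs
  · exact mul_le_mul_of_nonneg_left
      (pathW_mono hκ.statKer hle.statKer s₀ ((mem_listsOf.1 hτ).trans_le hx)) (hf.nonneg _)
  · exact le_rfl

/-- Weighted sums of key weights as sums over prefixes. -/
theorem sum_advProb_mul_keyW (Λ : Finset ℕ) (H : ℕ) (s₀ : Fin S) (f : Hist S A → ℝ)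
    (κ p : Ker S A) (c : Key S A → ℝ) :
    ∑ x ∈ keySet S A Λ H, advProb p x.2.2 * c x * keyW Λ s₀ f κ x =
      ∑ h ∈ range H, ∑ τ ∈ listsOf _ (h + 1),
        f τ * pathW (mixKer Λ κ p) s₀ τ * c (key Λ τ) := by
  unfold keyW
  rw [sum_keySet_fiber Λ H (fun x => advProb p x.2.2 * c x)]
  refine sum_congr rfl fun h _ => sum_congr rfl fun τ _ => ?_
  rw [pathW_mixKer]
  ring

/-- The loss attached to a key. -/
def keyLoss (ℓ : ℕ → Fin S → Fin A → ℝ) (x : Key S A) : ℝ :=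
  match x.2.1 with
  | none => 0
  | some y => ℓ (x.1 - 1) y.1 y.2

theorem keyLoss_key (Λ : Finset ℕ) (ℓ : ℕ → Fin S → Fin A → ℝ) (τ : Hist S A) :
    keyLoss ℓ (key Λ τ) = lastLoss ℓ τ := by
  cases τ <;> simp [key, keyLoss, lastLoss]

theorem keyLoss_mem {H : ℕ} {ℓ : ℕ → Fin S → Fin A → ℝ} (hℓ : IsLoss H ℓ) {Λ : Finset ℕ}
    {x : Key S A} (hx : x ∈ keySet S A Λ H) : 0 ≤ keyLoss ℓ x ∧ keyLoss ℓ x ≤ 1 := by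
  obtain ⟨h, hh, hx⟩ := mem_biUnion.1 hx
  obtain ⟨q, hq, rfl⟩ := mem_image.1 hx
  exact hℓ _ _ _ (by simpa using hh)

theorem planValue_eq_sum_keyW (Λ : Finset ℕ) (H : ℕ) (s₀ : Fin S) (f : Hist S A → ℝ)
    (p : Ker S A) (ℓ : ℕ → Fin S → Fin A → ℝ) :
    planValue H p f ℓ s₀ =
      ∑ x ∈ keySet S A Λ H, advProb p x.2.2 * keyLoss ℓ x * keyW Λ s₀ f p x := by
  rw [sum_advProb_mul_keyW, mixKer_self]
  simp only [keyLoss_key]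
  rfl

theorem sum_keyW_le {H : ℕ} {Λ : Finset ℕ} {p : Ker S A} (hp : IsTrans H p)
    (s₀ : Fin S) {f : Hist S A → ℝ} (hf : IsPlan f) (hS : 1 ≤ S) {h : ℕ} (hh : h < H) :
    ∑ x ∈ keyLayer S A Λ h, keyW Λ s₀ f p x ≤ (S : ℝ) ^ Λ.card := by
  have hS' : (1 : ℝ) ≤ S := by exact_mod_cast hS
  have h1 : ∑ x ∈ keyLayer S A Λ h, keyW Λ s₀ f p x =
      ∑ τ ∈ listsOf _ (h + 1), f τ * pathW (statKer Λ p) s₀ τ := by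
    unfold keyW
    rw [sum_congr rfl fun x hx => by rw [fst_of_mem_keyLayer hx], sum_comm]
    refine sum_congr rfl fun τ hτ => ?_
    rw [sum_ite_eq, if_pos (key_mem_keyLayer Λ (mem_listsOf.1 hτ))]
  have hst : StatNonneg H Λ p := fun t s a s' ht _ => (hp t ht).1 s a s'
  rw [h1]
  refine (sum_plan_mul_pathW_le hst.statKer hf s₀
    (c := fun t => if t ∈ Λ then (S : ℝ) else 1) ?_ ?_ hh).trans
    (prod_ite_mem_le_pow Λ h hS')
  · intro t; positivity
  · intro t s a ht
    unfold statKer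
    by_cases hΛ : t ∈ Λ
    · simp [hΛ]
    · simp [hΛ, (hp t ht).2]

/-! ### Mirror descent with the shifted entropy -/

theorem exp_neg_le_one_sub_add_sq {a : ℝ} (ha : 0 ≤ a) : Real.exp (-a) ≤ 1 - a + a ^ 2 := by
  rcases le_total a 1 with h | h
  · have := (abs_le.1 (Real.abs_exp_sub_one_sub_id_le (x := -a)
      (by rw [abs_neg, abs_of_nonneg ha]; exact h))).2
    nlinarith
  · have : Real.exp (-a) ≤ 1 := Real.exp_le_one_iff.2 (by linarith)
    nlinarith

/-- The Bregman divergence of the entropy shifted by `γ`. -/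
noncomputable def breg (γ y x : ℝ) : ℝ :=
  (y + γ) * Real.log ((y + γ) / (x + γ)) - y + x

theorem sub_le_mul_log_div {a b : ℝ} (ha : 0 < a) (hb : 0 < b) :
    a - b ≤ a * Real.log (a / b) := by
  have h := Real.log_le_sub_one_of_pos (div_pos hb ha)
  rw [← inv_div, Real.log_inv] at h
  have h2 : a * (-Real.log (a / b)) ≤ a * ((a / b)⁻¹ - 1) := mul_le_mul_of_nonneg_left h ha.le
  rw [inv_div, mul_sub, mul_div_cancel₀ _ ha.ne'] at h2
  linarith

theorem breg_nonneg {γ y x : ℝ} (hγ : 0 < γ) (hy : 0 ≤ y) (hx : 0 ≤ x) : 0 ≤ breg γ y x := by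
  have := sub_le_mul_log_div (a := y + γ) (b := x + γ) (by linarith) (by linarith)
  unfold breg
  linarith

theorem breg_sub_le {γ y z x : ℝ} (hγ : 0 < γ) (hy : 0 ≤ y) (hz : 0 ≤ z) (hx : 0 ≤ x) :
    breg γ z x - breg γ y x ≤ (z - y) * Real.log ((z + γ) / (x + γ)) := by
  have hy' : 0 < y + γ := by linarith
  have hz' : 0 < z + γ := by linarith
  have hx' : 0 < x + γ := by linarith
  have := sub_le_mul_log_div hy' hz'
  unfold breg
  rw [Real.log_div hz'.ne' hx'.ne', Real.log_div hy'.ne' hx'.ne']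
  rw [Real.log_div hy'.ne' hz'.ne'] at this
  linarith

theorem breg_three_point {γ u v x : ℝ} (hγ : 0 < γ) (hu : 0 ≤ u) (hv : 0 ≤ v) (hx : 0 ≤ x) :
    (u - v) * Real.log ((v + γ) / (x + γ)) = breg γ u x - breg γ u v - breg γ v x := by
  have hu' : 0 < u + γ := by linarith
  have hv' : 0 < v + γ := by linarith
  have hx' : 0 < x + γ := by linarith
  unfold breg
  rw [Real.log_div hv'.ne' hx'.ne', Real.log_div hu'.ne' hx'.ne', Real.log_div hu'.ne' hv'.ne']
  ring

/-- The stability of a mirror step. -/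
theorem sub_mul_sub_breg_le {γ x y a : ℝ} (hγ : 0 < γ) (hx : 0 ≤ x) (hy : 0 ≤ y) (ha : 0 ≤ a) :
    (x - y) * a - breg γ y x ≤ (x + γ) * a ^ 2 := by
  have hx' : 0 < x + γ := by linarith
  have hy' : 0 < y + γ := by linarith
  have h1 := sub_le_mul_log_div hy' (mul_pos hx' (Real.exp_pos (-a)))
  rw [Real.log_div hy'.ne' (mul_pos hx' (Real.exp_pos _)).ne',
    Real.log_mul hx'.ne' (Real.exp_pos _).ne', Real.log_exp] at h1
  have h2 := mul_le_mul_of_nonneg_left (exp_neg_le_one_sub_add_sq ha) hx'.le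
  unfold breg
  rw [Real.log_div hy'.ne' hx'.ne']
  linarith

/-- The objective of a mirror step. -/
noncomputable def mirrorObj {ι : Type*} (T : Finset ι) (γ : ℝ) (v l w : ι → ℝ) : ℝ :=
  ∑ x ∈ T, (γ * w x * l x + breg γ (w x) (v x))

/-- A minimizer of the mirror objective over a convex set satisfies the three-point
inequality. -/
theorem mirror_three_point {ι : Type*} {T : Finset ι} {γ : ℝ} (hγ : 0 < γ) {D : Set (ι → ℝ)}
    (hD : Convex ℝ D) (hD0 : ∀ w ∈ D, ∀ x, 0 ≤ w x) {v l w u : ι → ℝ} (hv : ∀ x, 0 ≤ v x)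
    (hw : w ∈ D) (hu : u ∈ D) (hmin : ∀ z ∈ D, mirrorObj T γ v l w ≤ mirrorObj T γ v l z) :
    ∑ x ∈ T, (w x - u x) * (γ * l x) ≤
      ∑ x ∈ T, (breg γ (u x) (v x) - breg γ (u x) (w x) - breg γ (w x) (v x)) := by
  have key : ∀ ε : ℝ, 0 < ε → ε ≤ 1 →
      0 ≤ ∑ x ∈ T, ((u x - w x) * (γ * l x) +
        (u x - w x) * Real.log ((w x + ε * (u x - w x) + γ) / (v x + γ))) := by
    intro ε h0 h1
    have hz : (fun x => w x + ε * (u x - w x)) ∈ D := by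
      have := hD hw hu (sub_nonneg.2 h1) h0.le (by ring)
      convert this using 1
      funext x
      simp
      ring
    have h2 := hmin _ hz
    unfold mirrorObj at h2
    rw [← sub_nonneg, ← sum_sub_distrib] at h2
    refine nonneg_of_mul_nonneg_right ?_ h0
    rw [mul_sum]
    refine h2.trans (sum_le_sum fun x _ => ?_)
    have h3 := breg_sub_le hγ (hD0 w hw x) (hD0 _ hz x) (hv x)
    nlinarith
  have hlim : Filter.Tendsto (fun ε : ℝ => ∑ x ∈ T, ((u x - w x) * (γ * l x) +
        (u x - w x) * Real.log ((w x + ε * (u x - w x) + γ) / (v x + γ))))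
      (nhdsWithin 0 (Set.Ioi 0))
      (nhds (∑ x ∈ T, ((u x - w x) * (γ * l x) +
        (u x - w x) * Real.log ((w x + 0 * (u x - w x) + γ) / (v x + γ))))) := by
    refine Filter.Tendsto.mono_left (tendsto_finsetSum _ fun x _ => ?_) nhdsWithin_le_nhds
    refine Filter.Tendsto.const_add _ (Filter.Tendsto.const_mul _ (Filter.Tendsto.log ?_ ?_))
    · exact Continuous.tendsto (by fun_prop) 0
    · have := hD0 w hw x
      have := hv x
      have h1 : 0 < w x + γ := by linarith
      have h2 : 0 < v x + γ := by linarith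
      rw [zero_mul, add_zero]
      positivity
  have h0 := ge_of_tendsto hlim (by
    filter_upwards [Ioc_mem_nhdsGT (zero_lt_one' ℝ)] with ε hε
    exact key ε hε.1 hε.2)
  simp only [zero_mul, add_zero] at h0
  rw [← sub_nonneg, ← sum_sub_distrib]
  refine h0.trans_eq (sum_congr rfl fun x _ => ?_)
  rw [breg_three_point hγ (hD0 u hu x) (hD0 w hw x) (hv x)]
  ring

theorem continuousOn_mirrorObj {ι : Type*} (T : Finset ι) {γ : ℝ} (hγ : 0 < γ)
    {v : ι → ℝ} (hv : ∀ x, 0 ≤ v x) (l : ι → ℝ) {D : Set (ι → ℝ)}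
    (hD0 : ∀ w ∈ D, ∀ x, 0 ≤ w x) : ContinuousOn (mirrorObj T γ v l) D := by
  unfold mirrorObj breg
  refine continuousOn_finsetSum _ fun x _ => ?_
  have h2 : 0 < v x + γ := by have := hv x; linarith
  have hlog : ContinuousOn (fun w : ι → ℝ => Real.log ((w x + γ) / (v x + γ))) D := by
    refine ContinuousOn.log (by fun_prop) fun w hw => ?_
    have : 0 < w x + γ := by have := hD0 w hw x; linarith
    positivity
  fun_prop

/-! ### The feasible sets -/

/-- Bounded weights dominating the lower confidence weights of some plan. -/
def feasible (T : Finset (Key S A)) (Λ : Finset ℕ) (s₀ : Fin S) (B : ℝ) (κ : Ker S A) :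
    Set (Key S A → ℝ) :=
  {v | (∀ x, 0 ≤ v x ∧ v x ≤ B) ∧ ∃ f, IsPlan f ∧ ∀ x ∈ T, keyW Λ s₀ f κ x ≤ v x}

theorem feasible_nonneg {T : Finset (Key S A)} {Λ : Finset ℕ} {s₀ : Fin S} {B : ℝ}
    {κ : Ker S A} : ∀ w ∈ feasible T Λ s₀ B κ, ∀ x, 0 ≤ w x :=
  fun _ hw x => (hw.1 x).1

theorem convex_feasible (T : Finset (Key S A)) (Λ : Finset ℕ) (s₀ : Fin S) (B : ℝ)
    (κ : Ker S A) : Convex ℝ (feasible T Λ s₀ B κ) := by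
  rintro v ⟨hv, f, hf, hfv⟩ w ⟨hw, g, hg, hgw⟩ a b ha hb hab
  refine ⟨fun x => ?_, fun τ => a * f τ + b * g τ, ?_, fun x hx => ?_⟩
  · have := hv x
    have := hw x
    simp only [Pi.add_apply, Pi.smul_apply, smul_eq_mul]
    constructor
    · nlinarith
    · have : B = a * B + b * B := by rw [← add_mul, hab, one_mul]
      nlinarith
  · refine ⟨by simp [hf.nil, hg.nil, hab], fun τ => ?_, fun τ s => ?_⟩
    · exact add_nonneg (mul_nonneg ha (hf.nonneg τ)) (mul_nonneg hb (hg.nonneg τ))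
    · rw [sum_add_distrib, ← mul_sum, ← mul_sum, hf.sum, hg.sum]
  · have h : keyW Λ s₀ (fun τ => a * f τ + b * g τ) κ x =
        a * keyW Λ s₀ f κ x + b * keyW Λ s₀ g κ x := by
      unfold keyW
      rw [mul_sum, mul_sum, ← sum_add_distrib]
      refine sum_congr rfl fun τ _ => ?_
      split_ifs <;> ring
    rw [h]
    exact add_le_add (mul_le_mul_of_nonneg_left (hfv x hx) ha)
      (mul_le_mul_of_nonneg_left (hgw x hx) hb)

theorem isCompact_feasible (T : Finset (Key S A)) (Λ : Finset ℕ) (s₀ : Fin S) (B : ℝ)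
    (κ : Ker S A) : IsCompact (feasible T Λ s₀ B κ) := by
  have hbox : IsCompact ((Set.univ.pi fun _ : Key S A => Set.Icc (0 : ℝ) B) ×ˢ
      (Set.univ.pi fun _ : Hist S A => Set.Icc (0 : ℝ) 1)) :=
    (isCompact_univ_pi fun _ => isCompact_Icc).prod (isCompact_univ_pi fun _ => isCompact_Icc)
  have hclosed : IsClosed {z : (Key S A → ℝ) × (Hist S A → ℝ) | z.2 [] = 1 ∧
      (∀ τ s, ∑ a, z.2 ((s, a) :: τ) = z.2 τ) ∧ ∀ x ∈ T, keyW Λ s₀ z.2 κ x ≤ z.1 x} := by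
    simp only [Set.ofPred_and, Set.ofPred_forall]
    refine IsClosed.inter (isClosed_eq (by fun_prop) (by fun_prop)) (IsClosed.inter ?_ ?_)
    · exact isClosed_iInter fun τ => isClosed_iInter fun s =>
        isClosed_eq (by fun_prop) (by fun_prop)
    · refine isClosed_iInter fun x => isClosed_iInter fun _ => isClosed_le ?_ (by fun_prop)
      unfold keyW
      refine continuous_finsetSum _ fun τ _ => ?_
      split_ifs <;> fun_prop
  convert (hbox.inter_right hclosed).image continuous_fst using 1
  ext v
  simp only [feasible, Set.mem_ofPred_eq, Set.mem_image, Set.mem_inter_iff, Set.mem_prod,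
    Set.mem_pi, Set.mem_univ, true_imp_iff, Set.mem_Icc, Prod.exists, exists_and_right,
    exists_eq_right]
  constructor
  · rintro ⟨hv, f, hf, hfv⟩
    exact ⟨f, ⟨hv, fun τ => ⟨hf.nonneg τ, hf.le_one τ⟩⟩, hf.nil, hf.sum, hfv⟩
  · rintro ⟨f, ⟨hv, hf01⟩, hf1, hfs, hfv⟩
    exact ⟨hv, f, ⟨hf1, fun τ => (hf01 τ).1, hfs⟩, hfv⟩

theorem exists_mirror_min {T : Finset (Key S A)} {Λ : Finset ℕ} {s₀ : Fin S} {B : ℝ}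
    {κ : Ker S A} (h : (feasible T Λ s₀ B κ).Nonempty) {γ : ℝ} (hγ : 0 < γ)
    {v : Key S A → ℝ} (hv : ∀ x, 0 ≤ v x) (l : Key S A → ℝ) :
    ∃ w ∈ feasible T Λ s₀ B κ, ∀ z ∈ feasible T Λ s₀ B κ,
      mirrorObj T γ v l w ≤ mirrorObj T γ v l z :=
  (isCompact_feasible T Λ s₀ B κ).exists_isMinOn h
    (continuousOn_mirrorObj T hγ hv l feasible_nonneg)

open scoped Classical in
/-- The mirror step; `0` if the feasible set is empty. -/
noncomputable def mirrorStep (T : Finset (Key S A)) (Λ : Finset ℕ) (s₀ : Fin S) (B γ : ℝ)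
    (κ : Ker S A) (v l : Key S A → ℝ) : Key S A → ℝ :=
  if h : ∃ w ∈ feasible T Λ s₀ B κ, ∀ z ∈ feasible T Λ s₀ B κ,
      mirrorObj T γ v l w ≤ mirrorObj T γ v l z then h.choose else 0

theorem mirrorStep_nonneg (T : Finset (Key S A)) (Λ : Finset ℕ) (s₀ : Fin S) (B γ : ℝ)
    (κ : Ker S A) (v l : Key S A → ℝ) (x : Key S A) : 0 ≤ mirrorStep T Λ s₀ B γ κ v l x := by
  unfold mirrorStep
  split_ifs with h
  · exact feasible_nonneg _ h.choose_spec.1 x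
  · exact le_rfl

theorem mirrorStep_mem {T : Finset (Key S A)} {Λ : Finset ℕ} {s₀ : Fin S} {B γ : ℝ}
    {κ : Ker S A} (hne : (feasible T Λ s₀ B κ).Nonempty) (hγ : 0 < γ) {v : Key S A → ℝ}
    (hv : ∀ x, 0 ≤ v x) (l : Key S A → ℝ) :
    mirrorStep T Λ s₀ B γ κ v l ∈ feasible T Λ s₀ B κ := by
  have h := exists_mirror_min hne hγ hv l
  unfold mirrorStep
  rw [dif_pos h]
  exact h.choose_spec.1

theorem sum_mirrorStep_sub_le {T : Finset (Key S A)} {Λ : Finset ℕ} {s₀ : Fin S} {B γ : ℝ}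
    {κ : Ker S A} (hγ : 0 < γ) {v u : Key S A → ℝ} (hv : ∀ x, 0 ≤ v x) (l : Key S A → ℝ)
    (hu : u ∈ feasible T Λ s₀ B κ) :
    ∑ x ∈ T, (mirrorStep T Λ s₀ B γ κ v l x - u x) * (γ * l x) ≤
      ∑ x ∈ T, (breg γ (u x) (v x) - breg γ (u x) (mirrorStep T Λ s₀ B γ κ v l x) -
        breg γ (mirrorStep T Λ s₀ B γ κ v l x) (v x)) := by
  have h := exists_mirror_min ⟨u, hu⟩ hγ hv l
  unfold mirrorStep
  rw [dif_pos h]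
  exact mirror_three_point hγ (convex_feasible T Λ s₀ B κ) feasible_nonneg hv
    h.choose_spec.1 hu h.choose_spec.2

/-- One step of mirror descent, measured against a feasible comparator. -/
theorem sum_sub_mirrorStep_le {T : Finset (Key S A)} {Λ : Finset ℕ} {s₀ : Fin S} {B γ : ℝ}
    {κ : Ker S A} (hγ : 0 < γ) {v u l : Key S A → ℝ} (hv : ∀ x, 0 ≤ v x)
    (hl : ∀ x ∈ T, 0 ≤ l x) (hu : u ∈ feasible T Λ s₀ B κ) :
    ∑ x ∈ T, (v x - u x) * (γ * l x) ≤
      ∑ x ∈ T, breg γ (u x) (v x) - ∑ x ∈ T, breg γ (u x) (mirrorStep T Λ s₀ B γ κ v l x) +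
        ∑ x ∈ T, (v x + γ) * (γ * l x) ^ 2 := by
  have h1 := sum_mirrorStep_sub_le hγ hv l hu
  have h2 : ∑ x ∈ T, ((v x - mirrorStep T Λ s₀ B γ κ v l x) * (γ * l x) -
      breg γ (mirrorStep T Λ s₀ B γ κ v l x) (v x)) ≤ ∑ x ∈ T, (v x + γ) * (γ * l x) ^ 2 :=
    sum_le_sum fun x hx => sub_mul_sub_breg_le hγ (hv x) (mirrorStep_nonneg _ _ _ _ _ _ _ _ x)
      (mul_nonneg hγ.le (hl x hx))
  simp only [sum_sub_distrib, sub_mul] at h1 h2 ⊢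
  linarith

/-- A plan witnessing feasibility; the uniform plan for infeasible weights. -/
noncomputable def witnessPlan (T : Finset (Key S A)) (Λ : Finset ℕ) (s₀ : Fin S)
    (κ : Ker S A) (v : Key S A → ℝ) : Hist S A → ℝ :=
  open scoped Classical in
  if h : ∃ f, IsPlan f ∧ ∀ x ∈ T, keyW Λ s₀ f κ x ≤ v x then h.choose
  else markovPlan fun _ _ _ => 1 / A

theorem isPlan_witnessPlan (hA : 1 ≤ A) (T : Finset (Key S A)) (Λ : Finset ℕ) (s₀ : Fin S)
    (κ : Ker S A) (v : Key S A → ℝ) : IsPlan (witnessPlan T Λ s₀ κ v) := by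
  unfold witnessPlan
  split_ifs with h
  · exact h.choose_spec.1
  · exact isPlan_markovPlan (isPolicy_uniform hA)

theorem keyW_witnessPlan_le {T : Finset (Key S A)} {Λ : Finset ℕ} {s₀ : Fin S} {B : ℝ}
    {κ : Ker S A} {v : Key S A → ℝ} (hv : v ∈ feasible T Λ s₀ B κ) {x : Key S A} (hx : x ∈ T) :
    keyW Λ s₀ (witnessPlan T Λ s₀ κ v) κ x ≤ v x := by
  unfold witnessPlan
  rw [dif_pos hv.2]
  exact hv.2.choose_spec.2 x hx

/-! ### The algorithm -/

/-- The parameters of the algorithm: horizon, adversarial steps, initial state, step size,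
confidence parameter and the cap on the weights. -/
structure Params (S A : ℕ) where
  H : ℕ
  Λ : Finset ℕ
  s₀ : Fin S
  γ : ℝ
  conf : ℝ
  cap : ℝ

/-- What is recorded of an episode: the (reversed) trajectory and the observed losses. -/
abbrev Rec (S A : ℕ) : Type := Hist S A × (ℕ → ℝ)

/-- Whether the last state-action pair of a prefix is the given one. -/
def hit (s : Fin S) (a : Fin A) : Hist S A → ℝ
  | [] => 0
  | y :: _ => if y = (s, a) then 1 else 0

/-- Whether the last transition of a prefix is the given one. -/
def hitNext (s : Fin S) (a : Fin A) (s' : Fin S) : Hist S A → ℝ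
  | [] => 0
  | x :: τ => if x.1 = s' then hit s a τ else 0

/-- Number of visits. -/
def cnt (R : List (Rec S A)) (t : ℕ) (s : Fin S) (a : Fin A) : ℝ :=
  (R.map fun r => hit s a (pre (t + 1) r.1)).sum

/-- Number of observed transitions. -/
def cntNext (R : List (Rec S A)) (t : ℕ) (s : Fin S) (a : Fin A) (s' : Fin S) : ℝ :=
  (R.map fun r => hitNext s a s' (pre (t + 2) r.1)).sum

/-- Empirical transitions. -/
noncomputable def phat (R : List (Rec S A)) : Ker S A :=
  fun t s a s' => cntNext R t s a s' / max 1 (cnt R t s a)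

/-- Confidence widths. -/
noncomputable def width (L : ℝ) (R : List (Rec S A)) : Ker S A :=
  fun t s a s' => 3 * √(L * phat R t s a s' / max 1 (cnt R t s a)) + 8 * L / max 1 (cnt R t s a)

/-- Total confidence width of a row. -/
noncomputable def rowWidth (L : ℝ) (R : List (Rec S A)) (t : ℕ) (s : Fin S) (a : Fin A) : ℝ :=
  ∑ s', width L R t s a s'

/-- Normalized upper confidence transitions. -/
noncomputable def kerUp (L : ℝ) (R : List (Rec S A)) : Ker S A :=
  fun t s a s' => (phat R t s a s' + width L R t s a s') / (1 + rowWidth L R t s a)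

/-- Normalized lower confidence transitions. -/
noncomputable def kerLow (L : ℝ) (R : List (Rec S A)) : Ker S A :=
  fun t s a s' => max 0 (phat R t s a s' - width L R t s a s') / (1 + rowWidth L R t s a)

/-- The normalization factors. -/
noncomputable def damp (L : ℝ) (R : List (Rec S A)) : Ker S A :=
  fun t s a _ => 1 / (1 + rowWidth L R t s a)

namespace Params

variable (c : Params S A)

/-- The keys of an episode. -/
def keys : Finset (Key S A) := keySet S A c.Λ c.H

/-- The plan extracted from given weights. -/
noncomputable def planOf (R : List (Rec S A)) (v : Key S A → ℝ) : Hist S A → ℝ :=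
  witnessPlan c.keys c.Λ c.s₀ (kerLow c.conf R) v

/-- The upper confidence weight of a key. -/
noncomputable def upW (R : List (Rec S A)) (v : Key S A → ℝ) (x : Key S A) : ℝ :=
  keyW c.Λ c.s₀ (c.planOf R v) (kerUp c.conf R) x

/-- The loss estimates. -/
noncomputable def estOf (R : List (Rec S A)) (v : Key S A → ℝ) (r : Rec S A) (x : Key S A) : ℝ :=
  if key c.Λ (pre x.1 r.1) = x then
    pathW (statKer c.Λ (damp c.conf R)) c.s₀ (pre x.1 r.1) * r.2 (x.1 - 1) /
      (max (v x) (c.upW R v x) + c.γ)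
  else 0

/-- The weights maintained by mirror descent. -/
noncomputable def wt : List (Rec S A) → Key S A → ℝ
  | [] => mirrorStep c.keys c.Λ c.s₀ c.cap c.γ (kerLow c.conf []) 0 0
  | r :: R => mirrorStep c.keys c.Λ c.s₀ c.cap c.γ (kerLow c.conf (r :: R)) (wt R)
      (c.estOf R (wt R) r)

/-- The plan played after the given records. -/
noncomputable def plan (R : List (Rec S A)) : Hist S A → ℝ := c.planOf R (c.wt R)

/-- The loss estimates of the algorithm. -/
noncomputable def est (R : List (Rec S A)) : Rec S A → Key S A → ℝ := c.estOf R (c.wt R)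

theorem wt_nonneg (R : List (Rec S A)) (x : Key S A) : 0 ≤ c.wt R x := by
  cases R <;> exact mirrorStep_nonneg _ _ _ _ _ _ _ _ x

theorem isPlan_plan (hA : 1 ≤ A) (R : List (Rec S A)) : IsPlan (c.plan R) :=
  isPlan_witnessPlan hA _ _ _ _ _

/-- The feasible set of the mirror step after the given records. -/
def dom (R : List (Rec S A)) : Set (Key S A → ℝ) :=
  feasible c.keys c.Λ c.s₀ c.cap (kerLow c.conf R)

theorem wt_mem (hγ : 0 < c.γ) {R : List (Rec S A)} (h : (c.dom R).Nonempty) :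
    c.wt R ∈ c.dom R := by
  cases R with
  | nil => exact mirrorStep_mem h hγ (fun _ => le_rfl) _
  | cons r R => exact mirrorStep_mem h hγ (c.wt_nonneg R) _

theorem lowW_le_wt (hγ : 0 < c.γ) {R : List (Rec S A)} (h : (c.dom R).Nonempty) {x : Key S A}
    (hx : x ∈ c.keys) : keyW c.Λ c.s₀ (c.plan R) (kerLow c.conf R) x ≤ c.wt R x :=
  keyW_witnessPlan_le (c.wt_mem hγ h) hx

end Params

/-- The record of a bandit observation. -/
noncomputable def recOf {H : ℕ} (o : BanditObs S A H) : Rec S A :=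
  ((List.ofFn o.1).reverse, fun h => if hh : h < H then o.2 ⟨h, hh⟩ else 0)

/-- The algorithm as an `Alg`. -/
noncomputable def Params.alg (c : Params S A) (hA : 1 ≤ A) (H : ℕ) :
    Alg S A (BanditObs S A H) where
  w i := if i = 0 then 1 else 0
  w_nonneg i := by split_ifs <;> norm_num
  w_sum := by simp
  act _ past := planStrat (c.plan (past.reverse.map recOf))
  act_strat _ _ := isStrategy_planStrat hA (c.isPlan_plan hA _)

/-! ### Interaction histories -/

/-- Trajectories of length `H`. -/
abbrev Traj (S A H : ℕ) : Type := Fin H → Fin S × Fin A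

/-- The reversed trajectory. -/
def Traj.hist {H : ℕ} (t : Traj S A H) : Hist S A := (List.ofFn t).reverse

/-- The records of the trajectories of the past episodes, most recent first. -/
noncomputable def recs {H : ℕ} (ℓ : ℕ → ℕ → Fin S → Fin A → ℝ) :
    List (Traj S A H) → List (Rec S A)
  | [] => []
  | t :: past => recOf (banditObs H ℓ past.length t) :: recs ℓ past

theorem reverse_map_recOf {H k : ℕ} (ℓ : ℕ → ℕ → Fin S → Fin A → ℝ)
    (ts : Fin k → Traj S A H) :
    (List.ofFn fun j : Fin k => banditObs H ℓ j (ts j)).reverse.map recOf =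
      recs ℓ (List.ofFn ts).reverse := by
  induction k with
  | zero => simp [recs]
  | succ k ih =>
    rw [List.ofFn_succ', List.ofFn_succ']
    have := ih fun j => ts j.castSucc
    simp [recs] at this ⊢
    exact this

/-! ### Properties of the estimated kernels -/

theorem hit_nonneg (s : Fin S) (a : Fin A) (τ : Hist S A) : 0 ≤ hit s a τ := by
  cases τ <;> simp only [hit]
  · exact le_rfl
  · split_ifs <;> norm_num

theorem hitNext_nonneg (s : Fin S) (a : Fin A) (s' : Fin S) (τ : Hist S A) :
    0 ≤ hitNext s a s' τ := by
  cases τ <;> simp only [hitNext]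
  · exact le_rfl
  · split_ifs
    · exact hit_nonneg _ _ _
    · exact le_rfl

theorem cnt_nonneg (R : List (Rec S A)) (t : ℕ) (s : Fin S) (a : Fin A) : 0 ≤ cnt R t s a :=
  List.sum_nonneg fun x hx => by
    obtain ⟨r, -, rfl⟩ := List.mem_map.1 hx
    exact hit_nonneg _ _ _

theorem cntNext_nonneg (R : List (Rec S A)) (t : ℕ) (s : Fin S) (a : Fin A) (s' : Fin S) :
    0 ≤ cntNext R t s a s' :=
  List.sum_nonneg fun x hx => by
    obtain ⟨r, -, rfl⟩ := List.mem_map.1 hx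
    exact hitNext_nonneg _ _ _ _

theorem phat_nonneg (R : List (Rec S A)) (t : ℕ) (s : Fin S) (a : Fin A) (s' : Fin S) :
    0 ≤ phat R t s a s' :=
  div_nonneg (cntNext_nonneg _ _ _ _ _) (zero_le_one.trans (le_max_left _ _))

theorem width_nonneg {L : ℝ} (hL : 0 ≤ L) (R : List (Rec S A)) (t : ℕ) (s : Fin S) (a : Fin A)
    (s' : Fin S) : 0 ≤ width L R t s a s' := by
  have : 0 < max 1 (cnt R t s a) := zero_lt_one.trans_le (le_max_left _ _)
  unfold width
  positivity

theorem rowWidth_nonneg {L : ℝ} (hL : 0 ≤ L) (R : List (Rec S A)) (t : ℕ) (s : Fin S)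
    (a : Fin A) : 0 ≤ rowWidth L R t s a :=
  sum_nonneg fun _ _ => width_nonneg hL _ _ _ _ _

theorem pre_succ_eq_cons {α : Type*} {n : ℕ} {τ : List α} (h : n < τ.length) :
    ∃ x, pre (n + 1) τ = x :: pre n τ := by
  unfold pre
  have h1 : τ.length - n = τ.length - (n + 1) + 1 := by omega
  refine ⟨τ[τ.length - (n + 1)], ?_⟩
  rw [h1, ← List.cons_getElem_drop_succ]

theorem sum_hitNext (s : Fin S) (a : Fin A) (x : Fin S × Fin A) (τ : Hist S A) :
    ∑ s', hitNext s a s' (x :: τ) = hit s a τ := by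
  simp [hitNext]

theorem sum_cntNext {H : ℕ} {R : List (Rec S A)} (hR : ∀ r ∈ R, r.1.length = H) {t : ℕ}
    (ht : t + 1 < H) (s : Fin S) (a : Fin A) : ∑ s', cntNext R t s a s' = cnt R t s a := by
  induction R with
  | nil => simp [cntNext, cnt]
  | cons r R ih =>
    have h1 := ih fun r' hr' => hR r' (List.mem_cons_of_mem _ hr')
    obtain ⟨x, hx⟩ := pre_succ_eq_cons (n := t + 1) (τ := r.1)
      (by rw [hR r List.mem_cons_self]; exact ht)
    simp only [cntNext, cnt, List.map_cons, List.sum_cons, sum_add_distrib] at h1 ⊢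
    rw [h1, hx, sum_hitNext]

theorem sum_phat_le {H : ℕ} {R : List (Rec S A)} (hR : ∀ r ∈ R, r.1.length = H) {t : ℕ}
    (ht : t + 1 < H) (s : Fin S) (a : Fin A) : ∑ s', phat R t s a s' ≤ 1 := by
  unfold phat
  rw [← sum_div, sum_cntNext hR ht]
  exact div_le_one_of_le₀ (le_max_right _ _) (zero_le_one.trans (le_max_left _ _))

/-- All confidence intervals at stationary steps are valid. -/
def Good (H : ℕ) (Λ : Finset ℕ) (q : Ker S A) (L : ℝ) (R : List (Rec S A)) : Prop :=
  ∀ t s a s', t + 1 < H → t ∉ Λ → |phat R t s a s' - q t s a s'| ≤ width L R t s a s'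

section Kernels

variable {L : ℝ} (hL : 0 ≤ L) (R : List (Rec S A)) (t : ℕ) (s : Fin S) (a : Fin A) (s' : Fin S)

include hL

theorem damp_pos : 0 < damp L R t s a s' := by
  have := rowWidth_nonneg hL R t s a
  unfold damp
  positivity

theorem damp_le_one : damp L R t s a s' ≤ 1 := by
  have := rowWidth_nonneg hL R t s a
  unfold damp
  rw [div_le_one (by positivity)]
  linarith

theorem kerLow_nonneg : 0 ≤ kerLow L R t s a s' := by
  have := rowWidth_nonneg hL R t s a
  unfold kerLow
  positivity

variable {R t s a s'} {q : ℝ}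

theorem kerLow_le_mul_damp (hq : 0 ≤ q) (h : |phat R t s a s' - q| ≤ width L R t s a s') :
    kerLow L R t s a s' ≤ q * damp L R t s a s' := by
  have := rowWidth_nonneg hL R t s a
  unfold kerLow damp
  rw [mul_one_div]
  gcongr
  exact max_le hq (by linarith [(abs_le.1 h).2])

theorem mul_damp_le_kerUp (h : |phat R t s a s' - q| ≤ width L R t s a s') :
    q * damp L R t s a s' ≤ kerUp L R t s a s' := by
  have := rowWidth_nonneg hL R t s a
  unfold kerUp damp
  rw [mul_one_div]
  gcongr
  linarith [(abs_le.1 h).1]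

theorem kerLow_le (hq : 0 ≤ q) (h : |phat R t s a s' - q| ≤ width L R t s a s') :
    kerLow L R t s a s' ≤ q :=
  (kerLow_le_mul_damp hL hq h).trans (mul_le_of_le_one_right hq (damp_le_one hL _ _ _ _ _))

theorem sum_kerUp_le {H : ℕ} (hR : ∀ r ∈ R, r.1.length = H) (ht : t + 1 < H) :
    ∑ s', kerUp L R t s a s' ≤ 1 := by
  have := rowWidth_nonneg hL R t s a
  have h1 := sum_phat_le hR ht s a
  unfold kerUp
  rw [← sum_div, div_le_one (by positivity), sum_add_distrib]
  exact add_le_add h1 le_rfl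

theorem sum_sub_kerLow_le {q : Fin S → ℝ} (hq : ∀ s', 0 ≤ q s') (hq1 : ∑ s', q s' = 1)
    (h : ∀ s', |phat R t s a s' - q s'| ≤ width L R t s a s') :
    ∑ s', (q s' - kerLow L R t s a s') ≤ 3 * min 1 (rowWidth L R t s a) := by
  have hβ := rowWidth_nonneg hL R t s a
  have h1 : ∑ s', (q s' - kerLow L R t s a s') ≤ 1 := by
    rw [← hq1]
    exact sum_le_sum fun s' _ => sub_le_self _ (kerLow_nonneg hL _ _ _ _ _)
  have h2 : ∑ s', (q s' - kerLow L R t s a s') ≤ 3 * rowWidth L R t s a := by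
    have : ∀ s', q s' - kerLow L R t s a s' ≤
        2 * width L R t s a s' + rowWidth L R t s a * q s' := by
      intro s'
      have h3 := abs_le.1 (h s')
      unfold kerLow
      rw [sub_le_iff_le_add, ← sub_le_iff_le_add', le_div_iff₀ (by positivity)]
      refine le_trans ?_ (le_max_right _ _)
      have h4 := width_nonneg hL R t s a s'
      have h5 := mul_nonneg hβ (hq s')
      nlinarith [mul_nonneg hβ h4, mul_nonneg hβ h5]
    refine (sum_le_sum fun s' _ => this s').trans (le_of_eq ?_)
    rw [sum_add_distrib, ← mul_sum, ← mul_sum, hq1]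
    change 2 * rowWidth L R t s a + _ = _
    ring
  rcases le_total 1 (rowWidth L R t s a) with h3 | h3
  · rw [min_eq_left h3]; linarith
  · rw [min_eq_right h3]; exact h2

theorem sum_kerUp_sub_kerLow_le :
    ∑ s', (kerUp L R t s a s' - kerLow L R t s a s') ≤ 2 * min 1 (rowWidth L R t s a) := by
  have hβ := rowWidth_nonneg hL R t s a
  have h1 : ∑ s', (kerUp L R t s a s' - kerLow L R t s a s') ≤
      2 * rowWidth L R t s a / (1 + rowWidth L R t s a) := by
    have : ∀ s', kerUp L R t s a s' - kerLow L R t s a s' ≤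
        2 * width L R t s a s' / (1 + rowWidth L R t s a) := by
      intro s'
      unfold kerUp kerLow
      rw [← sub_div]
      gcongr
      linarith [le_max_right 0 (phat R t s a s' - width L R t s a s')]
    refine (sum_le_sum fun s' _ => this s').trans (le_of_eq ?_)
    rw [← sum_div, ← mul_sum]
    rfl
  refine h1.trans ?_
  rw [div_le_iff₀ (by positivity)]
  rcases le_total 1 (rowWidth L R t s a) with h3 | h3
  · rw [min_eq_left h3]; linarith
  · rw [min_eq_right h3]; nlinarith

end Kernels

/-! ### The loss estimates -/

theorem pathW_le_one {H : ℕ} {κ : Ker S A} (hκ : KerNonneg H κ)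
    (h1 : ∀ h s a s', h + 1 < H → κ h s a s' ≤ 1) (s₀ : Fin S) {τ : Hist S A}
    (hτ : τ.length ≤ H) : pathW κ s₀ τ ≤ 1 := by
  induction τ with
  | nil => exact le_rfl
  | cons x τ ih =>
    refine mul_le_one₀ (ih (Nat.le_of_succ_le hτ)) (enter_nonneg hκ s₀ hτ _) ?_
    cases τ with
    | nil => simp only [enter]; split_ifs <;> norm_num
    | cons y τ => exact h1 _ _ _ _ hτ

theorem Traj.length_hist {H : ℕ} (t : Traj S A H) : t.hist.length = H := by
  simp [Traj.hist]

theorem recOf_fst {H : ℕ} (ℓ : ℕ → ℕ → Fin S → Fin A → ℝ) (k : ℕ) (t : Traj S A H) :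
    (recOf (banditObs H ℓ k t)).1 = t.hist := rfl

theorem recOf_snd {H : ℕ} (ℓ : ℕ → ℕ → Fin S → Fin A → ℝ) (k : ℕ) (t : Traj S A H) {h : ℕ}
    (hh : h < H) : (recOf (banditObs H ℓ k t)).2 h = lastLoss (ℓ k) (pre (h + 1) t.hist) := by
  rw [Traj.hist, lastLoss_pre_reverse_ofFn _ _ hh]
  simp [recOf, banditObs, hh]

theorem length_recs {H : ℕ} (ℓ : ℕ → ℕ → Fin S → Fin A → ℝ) (past : List (Traj S A H)) :
    ∀ r ∈ recs ℓ past, r.1.length = H := by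
  induction past with
  | nil => simp [recs]
  | cons t past ih =>
    intro r hr
    rcases List.mem_cons.1 hr with rfl | hr
    · exact t.length_hist
    · exact ih r hr

theorem fst_of_mem_keySet {Λ : Finset ℕ} {H : ℕ} {x : Key S A} (hx : x ∈ keySet S A Λ H) :
    ∃ h < H, x.1 = h + 1 := by
  obtain ⟨h, hh, hx⟩ := mem_biUnion.1 hx
  exact ⟨h, mem_range.1 hh, fst_of_mem_keyLayer hx⟩

namespace Params

variable (c : Params S A)

/-- The normalization of the loss estimates. -/
noncomputable def den (R : List (Rec S A)) (x : Key S A) : ℝ :=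
  max (c.wt R x) (c.upW R (c.wt R) x) + c.γ

theorem den_pos (hγ : 0 < c.γ) (R : List (Rec S A)) (x : Key S A) : 0 < c.den R x :=
  add_pos_of_nonneg_of_pos ((c.wt_nonneg R x).trans (le_max_left _ _)) hγ

theorem est_recOf (ℓ : ℕ → ℕ → Fin S → Fin A → ℝ) (k : ℕ) (t : Traj S A c.H)
    (R : List (Rec S A)) {x : Key S A} (hx : x ∈ c.keys) :
    c.est R (recOf (banditObs c.H ℓ k t)) x =
      if key c.Λ (pre x.1 t.hist) = x then
        pathW (statKer c.Λ (damp c.conf R)) c.s₀ (pre x.1 t.hist) * (keyLoss (ℓ k) x / c.den R x)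
      else 0 := by
  obtain ⟨h, hh, hxh⟩ := fst_of_mem_keySet hx
  unfold est estOf den
  rw [recOf_fst]
  split_ifs with hk
  · rw [hxh, Nat.add_sub_cancel, recOf_snd ℓ k t hh, ← hxh, ← keyLoss_key c.Λ, hk, mul_div_assoc]
  · rfl

theorem statNonneg_damp (hL : 0 ≤ c.conf) (R : List (Rec S A)) :
    StatNonneg c.H c.Λ (damp c.conf R) := fun _ _ _ _ _ _ => (damp_pos hL _ _ _ _ _).le

theorem est_nonneg (hγ : 0 < c.γ) (hL : 0 ≤ c.conf) {ℓ : ℕ → ℕ → Fin S → Fin A → ℝ}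
    (hℓ : ∀ k, IsLoss c.H (ℓ k)) (k : ℕ) (t : Traj S A c.H) (R : List (Rec S A)) {x : Key S A}
    (hx : x ∈ c.keys) : 0 ≤ c.est R (recOf (banditObs c.H ℓ k t)) x := by
  rw [c.est_recOf ℓ k t R hx]
  split_ifs
  · refine mul_nonneg (pathW_nonneg (c.statNonneg_damp hL R).statKer _ ?_)
      (div_nonneg (keyLoss_mem (hℓ k) hx).1 (c.den_pos hγ R x).le)
    have := fst_le_of_mem_keySet hx
    rw [length_pre (by rwa [t.length_hist])]
    exact this
  · exact le_rfl

theorem den_mul_est_le (hγ : 0 < c.γ) (hL : 0 ≤ c.conf) {ℓ : ℕ → ℕ → Fin S → Fin A → ℝ}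
    (hℓ : ∀ k, IsLoss c.H (ℓ k)) (k : ℕ) (t : Traj S A c.H) (R : List (Rec S A)) {x : Key S A}
    (hx : x ∈ c.keys) :
    c.den R x * c.est R (recOf (banditObs c.H ℓ k t)) x ≤
      if key c.Λ (pre x.1 t.hist) = x then 1 else 0 := by
  have hd := c.den_pos hγ R x
  rw [c.est_recOf ℓ k t R hx]
  split_ifs
  · have hlen : (pre x.1 t.hist).length ≤ c.H := by
      have := fst_le_of_mem_keySet hx
      rw [length_pre (by rwa [t.length_hist])]
      exact this
    have h1 := pathW_nonneg (c.statNonneg_damp hL R).statKer c.s₀ hlen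
    have h2 : pathW (statKer c.Λ (damp c.conf R)) c.s₀ (pre x.1 t.hist) ≤ 1 := by
      refine pathW_le_one (c.statNonneg_damp hL R).statKer (fun h s a s' _ => ?_) _ hlen
      unfold statKer
      split_ifs
      · exact le_rfl
      · exact damp_le_one hL _ _ _ _ _
    have h3 := keyLoss_mem (hℓ k) hx
    rw [mul_left_comm, mul_div_cancel₀ _ hd.ne']
    exact mul_le_one₀ h2 h3.1 h3.2
  · rw [mul_zero]

theorem den_mul_est_le_one (hγ : 0 < c.γ) (hL : 0 ≤ c.conf) {ℓ : ℕ → ℕ → Fin S → Fin A → ℝ}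
    (hℓ : ∀ k, IsLoss c.H (ℓ k)) (k : ℕ) (t : Traj S A c.H) (R : List (Rec S A)) {x : Key S A}
    (hx : x ∈ c.keys) : c.den R x * c.est R (recOf (banditObs c.H ℓ k t)) x ≤ 1 :=
  (c.den_mul_est_le hγ hL hℓ k t R hx).trans (by split_ifs <;> norm_num)

/-- The estimated loss of the weights maintained by the algorithm. -/
noncomputable def estVal (R : List (Rec S A)) (r : Rec S A) : ℝ :=
  ∑ x ∈ c.keys, c.wt R x * c.est R r x

theorem estVal_mem (hγ : 0 < c.γ) (hL : 0 ≤ c.conf) {ℓ : ℕ → ℕ → Fin S → Fin A → ℝ}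
    (hℓ : ∀ k, IsLoss c.H (ℓ k)) (k : ℕ) (t : Traj S A c.H) (R : List (Rec S A)) :
    0 ≤ c.estVal R (recOf (banditObs c.H ℓ k t)) ∧
      c.estVal R (recOf (banditObs c.H ℓ k t)) ≤ c.H := by
  refine ⟨sum_nonneg fun x hx =>
    mul_nonneg (c.wt_nonneg R x) (c.est_nonneg hγ hL hℓ k t R hx), ?_⟩
  have h1 : ∀ x ∈ c.keys, c.wt R x * c.est R (recOf (banditObs c.H ℓ k t)) x ≤
      if key c.Λ (pre x.1 t.hist) = x then 1 else 0 := fun x hx =>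
    (mul_le_mul_of_nonneg_right ((le_max_left _ _).trans (le_add_of_nonneg_right hγ.le))
      (c.est_nonneg hγ hL hℓ k t R hx)).trans (c.den_mul_est_le hγ hL hℓ k t R hx)
  refine (sum_le_sum h1).trans ?_
  unfold keys
  rw [sum_keySet]
  have h2 : ∀ h ∈ range c.H, ∑ x ∈ keyLayer S A c.Λ h,
      (if key c.Λ (pre x.1 t.hist) = x then (1 : ℝ) else 0) ≤ 1 := by
    intro h _
    have : ∀ x ∈ keyLayer S A c.Λ h, (if key c.Λ (pre x.1 t.hist) = x then (1 : ℝ) else 0) =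
        if key c.Λ (pre (h + 1) t.hist) = x then 1 else 0 := fun x hx => by
      rw [fst_of_mem_keyLayer hx]
    rw [sum_congr rfl this, sum_ite_eq]
    split_ifs <;> norm_num
  exact (sum_le_sum h2).trans (by simp)

/-- The probability of a trajectory in the next episode. -/
noncomputable def prob (p : Ker S A) (R : List (Rec S A)) (t : Traj S A c.H) : ℝ :=
  trajDist c.H p (planStrat (c.plan R)) c.s₀ t

theorem sum_prob_mul (hH : 1 ≤ c.H) (hA : 1 ≤ A) {p : Ker S A} (R : List (Rec S A))
    (F : Hist S A → ℝ) :
    ∑ t, c.prob p R t * F t.hist = ∑ τ ∈ listsOf _ c.H, c.plan R τ * pathW p c.s₀ τ * F τ :=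
  sum_trajDist hH (c.isPlan_plan hA R) c.s₀ F

theorem prob_nonneg (hH : 1 ≤ c.H) (hA : 1 ≤ A) {p : Ker S A} (hp : IsTrans c.H p)
    (R : List (Rec S A)) (t : Traj S A c.H) : 0 ≤ c.prob p R t := by
  unfold prob
  rw [trajDist_planStrat hH (c.isPlan_plan hA R)]
  exact mul_nonneg ((c.isPlan_plan hA R).nonneg _)
    (pathW_nonneg hp.kerNonneg _ t.length_hist.le)

theorem sum_prob_mul_pre (hH : 1 ≤ c.H) (hA : 1 ≤ A) {p : Ker S A} (hp : IsTrans c.H p)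
    (R : List (Rec S A)) {n : ℕ} (hn : n ≤ c.H) (F : Hist S A → ℝ) :
    ∑ t, c.prob p R t * F (pre n t.hist) =
      ∑ τ ∈ listsOf _ n, c.plan R τ * pathW p c.s₀ τ * F τ := by
  rw [c.sum_prob_mul hH hA R fun τ => F (pre n τ)]
  exact sum_marginal hp (c.isPlan_plan hA R) c.s₀ hn le_rfl F

theorem sum_prob (hH : 1 ≤ c.H) (hA : 1 ≤ A) {p : Ker S A} (hp : IsTrans c.H p)
    (R : List (Rec S A)) : ∑ t, c.prob p R t = 1 := by
  have := c.sum_prob_mul hH hA (p := p) R fun _ => 1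
  simp only [mul_one] at this
  rw [this, sum_plan_mul_pathW_eq_one hp (c.isPlan_plan hA R) c.s₀ le_rfl]

/-- The conditional expectation of the loss estimates. -/
theorem sum_prob_mul_est (hH : 1 ≤ c.H) (hA : 1 ≤ A) {p : Ker S A} (hp : IsTrans c.H p)
    (ℓ : ℕ → ℕ → Fin S → Fin A → ℝ) (k : ℕ) (R : List (Rec S A)) {x : Key S A}
    (hx : x ∈ c.keys) :
    ∑ t, c.prob p R t * c.est R (recOf (banditObs c.H ℓ k t)) x =
      advProb p x.2.2 * keyLoss (ℓ k) x *
        keyW c.Λ c.s₀ (c.plan R) (fun h s a s' => p h s a s' * damp c.conf R h s a s') x /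
        c.den R x := by
  simp only [c.est_recOf ℓ k _ R hx]
  rw [c.sum_prob_mul_pre hH hA hp R (fst_le_of_mem_keySet hx) fun σ => if key c.Λ σ = x then
        pathW (statKer c.Λ (damp c.conf R)) c.s₀ σ * (keyLoss (ℓ k) x / c.den R x) else 0]
  unfold keyW
  rw [mul_sum, sum_div]
  refine sum_congr rfl fun σ _ => ?_
  split_ifs with hk
  · rw [← mixKer_self c.Λ p, pathW_mixKer, hk, mixKer_self, ← statKer_mul, ← pathW_mul]
    ring
  · simp

end Params

/-! ### The bias of the loss estimates -/

/-- The truncated row width at the last step of a prefix, at stationary steps. -/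
noncomputable def errW (Λ : Finset ℕ) (L : ℝ) (R : List (Rec S A)) : Hist S A → ℝ
  | [] => 0
  | x :: τ => if τ.length ∈ Λ then 0 else min 1 (rowWidth L R τ.length x.1 x.2)

theorem errW_nonneg {Λ : Finset ℕ} {L : ℝ} (hL : 0 ≤ L) (R : List (Rec S A)) (τ : Hist S A) :
    0 ≤ errW Λ L R τ := by
  cases τ with
  | nil => exact le_rfl
  | cons x τ =>
    simp only [errW]
    split_ifs
    · exact le_rfl
    · exact le_min zero_le_one (rowWidth_nonneg hL _ _ _ _)

theorem errW_le_one (Λ : Finset ℕ) (L : ℝ) (R : List (Rec S A)) (τ : Hist S A) :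
    errW Λ L R τ ≤ 1 := by
  cases τ with
  | nil => exact zero_le_one
  | cons x τ =>
    simp only [errW]
    split_ifs
    · exact zero_le_one
    · exact min_le_left _ _

theorem sub_mul_div_max_le {γ T d v u lo : ℝ} (hγ : 0 < γ) (hlo : 0 ≤ lo) (hlod : lo ≤ d)
    (hdu : d ≤ u) (hlov : lo ≤ v) :
    T - v * (d / (max v u + γ)) ≤ (T - lo) + (u - lo) + γ := by
  rcases le_total u v with h | h
  · rw [max_eq_left h]
    have hv : 0 < v + γ := by linarith
    have : d - γ ≤ v * (d / (v + γ)) := by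
      rw [← mul_div_assoc, le_div_iff₀ hv]
      nlinarith
    linarith
  · rw [max_eq_right h]
    have hu : 0 < u + γ := by linarith
    have : 2 * lo - u - γ ≤ v * (d / (u + γ)) := by
      rw [← mul_div_assoc, le_div_iff₀ hu]
      have : lo * lo ≤ v * d := mul_le_mul hlov hlod hlo (hlo.trans hlov)
      nlinarith [sq_nonneg (lo - (u + γ))]
    linarith

namespace Params

variable (c : Params S A)

/-- The sum of the truncated row widths along a trajectory. -/
noncomputable def errSum (R : List (Rec S A)) (τ : Hist S A) : ℝ :=
  ∑ m ∈ range c.H, errW c.Λ c.conf R (pre m τ)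

theorem errSum_mem (hL : 0 ≤ c.conf) (R : List (Rec S A)) (τ : Hist S A) :
    0 ≤ c.errSum R τ ∧ c.errSum R τ ≤ c.H :=
  ⟨sum_nonneg fun _ _ => errW_nonneg hL _ _,
    (sum_le_sum fun _ _ => errW_le_one _ _ _ _).trans (by simp)⟩

theorem sum_prob_mul_errSum (hH : 1 ≤ c.H) (hA : 1 ≤ A) {p : Ker S A} (hp : IsTrans c.H p)
    (R : List (Rec S A)) :
    ∑ t, c.prob p R t * c.errSum R t.hist =
      ∑ m ∈ range c.H, ∑ τ ∈ listsOf _ m, c.plan R τ * pathW p c.s₀ τ * errW c.Λ c.conf R τ := by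
  unfold errSum
  simp only [mul_sum]
  rw [sum_comm]
  exact sum_congr rfl fun m hm => c.sum_prob_mul_pre hH hA hp R (mem_range.1 hm).le _

/-- Comparison of two families of kernels that agree at adversarial steps. -/
theorem sum_advProb_mul_keyW_sub_le (hH : 1 ≤ c.H) (hA : 1 ≤ A) {p : Ker S A}
    (hp : IsTrans c.H p) (hL : 0 ≤ c.conf) (R : List (Rec S A)) {a b : Ker S A} {C : ℝ}
    (hC : 0 ≤ C)
    (hb : StatNonneg c.H c.Λ b) (hbp : StatLE c.H c.Λ b p) (hba : StatLE c.H c.Λ b a)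
    (hrow : ∀ h s x, h + 1 < c.H → h ∉ c.Λ → ∑ s', a h s x s' ≤ 1)
    (he : ∀ h s x, h + 1 < c.H → h ∉ c.Λ →
      ∑ s', (a h s x s' - b h s x s') ≤ C * min 1 (rowWidth c.conf R h s x)) :
    ∑ x ∈ c.keys, advProb p x.2.2 *
        (keyW c.Λ c.s₀ (c.plan R) a x - keyW c.Λ c.s₀ (c.plan R) b x) ≤
      c.H * (C * ∑ t, c.prob p R t * c.errSum R t.hist) := by
  have hf := c.isPlan_plan hA R
  have hsim : ∀ h ∈ range c.H, ∑ τ ∈ listsOf _ (h + 1), c.plan R τ *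
      (pathW (mixKer c.Λ a p) c.s₀ τ - pathW (mixKer c.Λ b p) c.s₀ τ) ≤
        C * ∑ t, c.prob p R t * c.errSum R t.hist := by
    intro h hh
    have hh := mem_range.1 hh
    have h1 := sum_pathW_sub_le (a := mixKer c.Λ a p) (b := mixKer c.Λ b p) (p := p)
      (hb.mixKer hp.kerNonneg)
      (fun t s x s' ht => by
        have := hbp.mixKer p t s x s' ht
        rwa [mixKer_self] at this)
      (hba.mixKer p)
      (fun t s x ht => by
        unfold mixKer
        split_ifs with hΛ
        · exact ((hp t ht).2 s x).le
        · exact hrow t s x ht hΛ) hf c.s₀ (e := fun τ => C * errW c.Λ c.conf R τ)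
      (fun τ => mul_nonneg hC (errW_nonneg hL _ _))
      (fun x τ hτ => by
        by_cases hΛ : τ.length ∈ c.Λ
        · simp [mixKer, errW, hΛ]
        · simpa [mixKer, errW, hΛ] using he _ x.1 x.2 hτ hΛ) (n := h + 1) hh
    refine h1.trans ?_
    rw [c.sum_prob_mul_errSum hH hA hp, mul_sum]
    have hnn : ∀ m ∈ range c.H, ∀ τ ∈ listsOf (Fin S × Fin A) m,
        0 ≤ c.plan R τ * pathW p c.s₀ τ * (C * errW c.Λ c.conf R τ) := fun m hm τ hτ =>
      mul_nonneg (mul_nonneg (hf.nonneg _) (pathW_nonneg hp.kerNonneg _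
        ((mem_listsOf.1 hτ).trans_le (mem_range.1 hm).le))) (mul_nonneg hC (errW_nonneg hL _ _))
    refine (sum_le_sum_of_subset_of_nonneg (range_subset_range.2 hh)
      fun m hm _ => sum_nonneg (hnn m hm)).trans (le_of_eq ?_)
    refine sum_congr rfl fun m _ => ?_
    rw [mul_sum]
    exact sum_congr rfl fun τ _ => by ring
  have h2 : ∀ κ, ∑ x ∈ c.keys, advProb p x.2.2 * keyW c.Λ c.s₀ (c.plan R) κ x =
      ∑ h ∈ range c.H, ∑ τ ∈ listsOf _ (h + 1), c.plan R τ * pathW (mixKer c.Λ κ p) c.s₀ τ := by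
    intro κ
    have := sum_advProb_mul_keyW c.Λ c.H c.s₀ (c.plan R) κ p fun _ => 1
    simp only [mul_one] at this
    exact this
  simp only [mul_sub, sum_sub_distrib]
  rw [h2, h2, ← sum_sub_distrib]
  simp only [← sum_sub_distrib, ← mul_sub]
  exact (sum_le_sum hsim).trans (by simp)

/-- The value of the played plan against the expected estimate. -/
theorem planValue_sub_le (hH : 1 ≤ c.H) (hS : 1 ≤ S) (hA : 1 ≤ A) (hγ : 0 < c.γ)
    (hL : 0 ≤ c.conf) {p : Ker S A} (hp : IsTrans c.H p) {q : Ker S A}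
    (hpq : ∀ h, h ∉ c.Λ → p h = q h) {ℓ : ℕ → ℕ → Fin S → Fin A → ℝ}
    (hℓ : ∀ k, IsLoss c.H (ℓ k)) (k : ℕ) {R : List (Rec S A)}
    (hR : ∀ r ∈ R, r.1.length = c.H) (hgood : Good c.H c.Λ q c.conf R)
    (hdom : (c.dom R).Nonempty) :
    planValue c.H p (c.plan R) (ℓ k) c.s₀ -
        ∑ t, c.prob p R t * c.estVal R (recOf (banditObs c.H ℓ k t)) ≤
      5 * c.H * ∑ t, c.prob p R t * c.errSum R t.hist +
        c.γ * (c.H * ((S : ℝ) * A) ^ (c.Λ.card + 1)) := by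
  have hf := c.isPlan_plan hA R
  have hg : ∀ t s a s', t + 1 < c.H → t ∉ c.Λ →
      |phat R t s a s' - p t s a s'| ≤ width c.conf R t s a s' := fun t s a s' ht hΛ => by
    rw [hpq t hΛ]
    exact hgood t s a s' ht hΛ
  have hlow0 : StatNonneg c.H c.Λ (kerLow c.conf R) := fun t s a s' _ _ =>
    kerLow_nonneg hL R t s a s'
  set pd : Ker S A := fun h s a s' => p h s a s' * damp c.conf R h s a s' with hpd
  have hlowpd : StatLE c.H c.Λ (kerLow c.conf R) pd := fun t s a s' ht hΛ =>
    kerLow_le_mul_damp hL ((hp t ht).1 s a s') (hg t s a s' ht hΛ)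
  have hpdup : StatLE c.H c.Λ pd (kerUp c.conf R) := fun t s a s' ht hΛ =>
    mul_damp_le_kerUp hL (hg t s a s' ht hΛ)
  have hlowp : StatLE c.H c.Λ (kerLow c.conf R) p := fun t s a s' ht hΛ =>
    kerLow_le hL ((hp t ht).1 s a s') (hg t s a s' ht hΛ)
  have hpd0 : StatNonneg c.H c.Λ pd := fun t s a s' ht _ =>
    mul_nonneg ((hp t ht).1 s a s') (damp_pos hL R t s a s').le
  have hlowup : StatLE c.H c.Λ (kerLow c.conf R) (kerUp c.conf R) := fun t s a s' ht hΛ =>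
    (hlowpd t s a s' ht hΛ).trans (hpdup t s a s' ht hΛ)
  have hA1 := c.sum_advProb_mul_keyW_sub_le hH hA hp hL R (a := p) (by norm_num : (0 : ℝ) ≤ 3)
    hlow0 hlowp hlowp (fun h s x hh _ => ((hp h hh).2 s x).le) (fun h s x hh hΛ =>
      sum_sub_kerLow_le hL ((hp h hh).1 s x) ((hp h hh).2 s x) fun s' => hg h s x s' hh hΛ)
  have hA2 := c.sum_advProb_mul_keyW_sub_le hH hA hp hL R (a := kerUp c.conf R)
    (by norm_num : (0 : ℝ) ≤ 2) hlow0 hlowp hlowup (fun h s x hh _ => sum_kerUp_le hL hR hh)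
    (fun h s x _ _ => sum_kerUp_sub_kerLow_le hL)
  have hA3 := mul_le_mul_of_nonneg_left (sum_keySet_advProb_le hp c.Λ hS hA) hγ.le
  have hE : ∑ t, c.prob p R t * c.estVal R (recOf (banditObs c.H ℓ k t)) =
      ∑ x ∈ c.keys, advProb p x.2.2 * keyLoss (ℓ k) x *
        (c.wt R x * (keyW c.Λ c.s₀ (c.plan R) pd x / c.den R x)) := by
    unfold estVal
    simp only [mul_sum]
    rw [sum_comm]
    refine sum_congr rfl fun x hx => ?_
    have := c.sum_prob_mul_est hH hA hp ℓ k R hx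
    rw [sum_congr rfl fun t _ => mul_left_comm _ _ _, ← mul_sum, this]
    ring
  rw [planValue_eq_sum_keyW c.Λ, hE, ← keys, ← sum_sub_distrib]
  have hpt : ∀ x ∈ c.keys, advProb p x.2.2 * keyLoss (ℓ k) x * keyW c.Λ c.s₀ (c.plan R) p x -
      advProb p x.2.2 * keyLoss (ℓ k) x *
        (c.wt R x * (keyW c.Λ c.s₀ (c.plan R) pd x / c.den R x)) ≤
      advProb p x.2.2 * (keyW c.Λ c.s₀ (c.plan R) p x -
          keyW c.Λ c.s₀ (c.plan R) (kerLow c.conf R) x) +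
        advProb p x.2.2 * (keyW c.Λ c.s₀ (c.plan R) (kerUp c.conf R) x -
          keyW c.Λ c.s₀ (c.plan R) (kerLow c.conf R) x) + c.γ * advProb p x.2.2 := by
    intro x hx
    have hxH := fst_le_of_mem_keySet hx
    have hP := advProb_nonneg_of_mem hp.kerNonneg hx
    have hl := keyLoss_mem (hℓ k) hx
    have h0 := keyW_nonneg hlow0 c.s₀ hf hxH
    have h1 := keyW_mono hlow0 hlowpd c.s₀ hf hxH
    have h2 := keyW_mono hpd0 hpdup c.s₀ hf hxH
    have h3 := keyW_mono hlow0 hlowp c.s₀ hf hxH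
    have h4 := sub_mul_div_max_le (T := keyW c.Λ c.s₀ (c.plan R) p x) hγ h0 h1 h2
      (c.lowW_le_wt hγ hdom hx)
    have h5 : keyW c.Λ c.s₀ (c.plan R) p x -
        c.wt R x * (keyW c.Λ c.s₀ (c.plan R) pd x / c.den R x) ≤
        (keyW c.Λ c.s₀ (c.plan R) p x - keyW c.Λ c.s₀ (c.plan R) (kerLow c.conf R) x) +
        (keyW c.Λ c.s₀ (c.plan R) (kerUp c.conf R) x -
          keyW c.Λ c.s₀ (c.plan R) (kerLow c.conf R) x) + c.γ := h4
    rw [← mul_sub]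
    have h6 : 0 ≤ (keyW c.Λ c.s₀ (c.plan R) p x -
        keyW c.Λ c.s₀ (c.plan R) (kerLow c.conf R) x) +
        (keyW c.Λ c.s₀ (c.plan R) (kerUp c.conf R) x -
          keyW c.Λ c.s₀ (c.plan R) (kerLow c.conf R) x) + c.γ := by linarith
    refine (mul_le_mul_of_nonneg_left h5 (mul_nonneg hP hl.1)).trans ?_
    refine (mul_le_mul_of_nonneg_right (mul_le_of_le_one_right hP hl.2) h6).trans (le_of_eq ?_)
    ring
  refine (sum_le_sum hpt).trans ?_
  rw [sum_add_distrib, sum_add_distrib, ← mul_sum]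
  unfold keys at hA1 hA2 ⊢
  linarith

end Params

/-! ### Finite stochastic processes -/

section Sequences

variable {α : Type*}

/-- The probability of a sequence of outcomes, most recent first. -/
def seqW (P : List α → α → ℝ) : List α → ℝ
  | [] => 1
  | t :: past => seqW P past * P past t

/-- The accumulated value of increments along a sequence. -/
def acc (F : List α → α → ℝ) : List α → ℝ
  | [] => 0
  | t :: past => acc F past + F past t

theorem acc_add (F G : List α → α → ℝ) (l : List α) :
    acc (fun past t => F past t + G past t) l = acc F l + acc G l := by
  induction l with
  | nil => simp [acc]
  | cons t l ih => simp only [acc, ih]; ring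

theorem acc_const_mul (b : ℝ) (F : List α → α → ℝ) (l : List α) :
    acc (fun past t => b * F past t) l = b * acc F l := by
  induction l with
  | nil => simp [acc]
  | cons t l ih => simp only [acc, ih]; ring

theorem acc_sub (F G : List α → α → ℝ) (l : List α) :
    acc (fun past t => F past t - G past t) l = acc F l - acc G l := by
  induction l with
  | nil => simp [acc]
  | cons t l ih => simp only [acc, ih]; ring

theorem acc_const (b : ℝ) (l : List α) : acc (fun _ _ => b) l = l.length * b := by
  induction l with
  | nil => simp [acc]
  | cons t l ih => simp only [acc, ih, List.length_cons]; push_cast; ring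

theorem acc_sum {ι : Type*} (T : Finset ι) (F : ι → List α → α → ℝ) (l : List α) :
    acc (fun past t => ∑ i ∈ T, F i past t) l = ∑ i ∈ T, acc (F i) l := by
  induction l with
  | nil => simp [acc]
  | cons t l ih => simp only [acc, ih, sum_add_distrib]

theorem acc_le {F G : List α → α → ℝ} {l : List α}
    (h : ∀ past t, (t :: past) <:+ l → F past t ≤ G past t) : acc F l ≤ acc G l := by
  induction l with
  | nil => exact le_rfl
  | cons t l ih =>
    exact add_le_add (ih fun past t' h' => h past t' (h'.trans (List.suffix_cons t l)))
      (h l t List.suffix_rfl)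

theorem acc_congr {F G : List α → α → ℝ} {l : List α}
    (h : ∀ past t, (t :: past) <:+ l → F past t = G past t) : acc F l = acc G l :=
  le_antisymm (acc_le fun past t ht => (h past t ht).le) (acc_le fun past t ht => (h past t ht).ge)

theorem acc_cut {F : List α → α → ℝ} {l' l : List α} (h : l' <:+ l) :
    acc (fun past t => if past.length < l'.length then F past t else 0) l = acc F l' := by
  obtain ⟨u, rfl⟩ := h
  induction u with
  | nil =>
    refine acc_congr fun past t ht => if_pos ?_
    have := ht.length_le
    simpa using this
  | cons t u ih =>
    rw [List.cons_append, acc, ih, if_neg (by simp), add_zero]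

theorem seqW_nonneg {P : List α → α → ℝ} (h0 : ∀ past t, 0 ≤ P past t) (l : List α) :
    0 ≤ seqW P l := by
  induction l with
  | nil => exact zero_le_one
  | cons t l ih => exact mul_nonneg ih (h0 _ _)

theorem sum_seqW [Fintype α] {P : List α → α → ℝ} (h1 : ∀ past, ∑ t, P past t = 1) (n : ℕ) :
    ∑ l ∈ listsOf α n, seqW P l = 1 := by
  induction n with
  | zero => simp [sum_listsOf_zero, seqW]
  | succ n ih =>
    rw [sum_listsOf_succ, ← ih]
    exact sum_congr rfl fun l _ => by simp only [seqW, ← mul_sum, h1, mul_one]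

variable [Fintype α] {P : List α → α → ℝ} (h0 : ∀ past t, 0 ≤ P past t)

include h0

theorem sum_seqW_mul_exp_le {F : List α → α → ℝ}
    (hF : ∀ past, ∑ t, P past t * Real.exp (F past t) ≤ 1) (n : ℕ) :
    ∑ l ∈ listsOf α n, seqW P l * Real.exp (acc F l) ≤ 1 := by
  induction n with
  | zero => simp [sum_listsOf_zero, seqW, acc]
  | succ n ih =>
    rw [sum_listsOf_succ]
    refine le_trans (sum_le_sum fun l _ => ?_) ih
    have : ∀ t, seqW P (t :: l) * Real.exp (acc F (t :: l)) =
        seqW P l * Real.exp (acc F l) * (P l t * Real.exp (F l t)) := fun t => by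
      simp only [seqW, acc, Real.exp_add]
      ring
    simp only [this, ← mul_sum]
    exact mul_le_of_le_one_right (mul_nonneg (seqW_nonneg h0 l) (Real.exp_pos _).le) (hF l)

open scoped Classical in
/-- A union bound over exponential supermartingales. -/
theorem one_sub_le_sum_seqW (h1 : ∀ past, ∑ t, P past t = 1) {ι : Type*} (I : Finset ι)
    {F : ι → List α → α → ℝ} (hF : ∀ i ∈ I, ∀ past, ∑ t, P past t * Real.exp (F i past t) ≤ 1)
    (b : ℝ) (n : ℕ) {E : List α → Prop}
    (hE : ∀ l ∈ listsOf α n, (∀ i ∈ I, acc (F i) l ≤ b) → E l) :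
    1 - I.card * Real.exp (-b) ≤ ∑ l ∈ listsOf α n, seqW P l * (if E l then 1 else 0) := by
  have h2 : ∑ l ∈ listsOf α n, seqW P l * ∑ i ∈ I, Real.exp (acc (F i) l - b) ≤
      I.card * Real.exp (-b) := by
    simp only [mul_sum]
    rw [sum_comm, ← nsmul_eq_mul]
    refine sum_le_card_nsmul _ _ _ fun i hi => ?_
    have := mul_le_mul_of_nonneg_right (sum_seqW_mul_exp_le h0 (hF i hi) n) (Real.exp_pos (-b)).le
    rw [one_mul, sum_mul] at this
    refine le_trans (le_of_eq (sum_congr rfl fun l _ => ?_)) this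
    rw [sub_eq_add_neg, Real.exp_add, mul_assoc]
  have h3 : ∑ l ∈ listsOf α n, seqW P l * (1 - if E l then 1 else 0) ≤
      ∑ l ∈ listsOf α n, seqW P l * ∑ i ∈ I, Real.exp (acc (F i) l - b) := by
    refine sum_le_sum fun l hl => mul_le_mul_of_nonneg_left ?_ (seqW_nonneg h0 l)
    by_cases hEl : E l
    · rw [if_pos hEl, sub_self]
      exact sum_nonneg fun i _ => (Real.exp_pos _).le
    · rw [if_neg hEl, sub_zero]
      have : ∃ i ∈ I, b < acc (F i) l := by
        by_contra hcon
        push Not at hcon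
        exact hEl (hE l hl hcon)
      obtain ⟨i, hi, hlt⟩ := this
      refine le_trans ?_ (single_le_sum (f := fun i => Real.exp (acc (F i) l - b))
        (fun j _ => (Real.exp_pos _).le) hi)
      exact Real.one_le_exp (by linarith)
  have h4 := sum_seqW h1 n
  simp only [mul_sub, mul_one, sum_sub_distrib, h4] at h3
  linarith

end Sequences

/-! ### Exponential moment bounds -/

theorem exp_neg_le_one_sub_half {y : ℝ} (h0 : 0 ≤ y) (h1 : y ≤ 1) :
    Real.exp (-y) ≤ 1 - y / 2 := by
  have h2 : 0 < Real.exp y := Real.exp_pos y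
  rw [Real.exp_neg, inv_le_iff_one_le_mul₀ h2]
  nlinarith [Real.add_one_le_exp y]

theorem exp_le_one_add_sq {y : ℝ} (h : |y| ≤ 1) : Real.exp y ≤ 1 + y + y ^ 2 := by
  have := (abs_le.1 (Real.abs_exp_sub_one_sub_id_le h)).2
  linarith

section Moments

variable {α : Type*} [Fintype α] {w : α → ℝ} (h0 : ∀ t, 0 ≤ w t) (h1 : ∑ t, w t = 1)

include h0 h1

theorem sum_mul_exp_mean_sub_le {X : α → ℝ} {M θ : ℝ} (hθ : 0 ≤ θ)
    (hX : ∀ t, 0 ≤ X t ∧ X t ≤ M) :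
    ∑ t, w t * Real.exp (θ * ((∑ t', w t' * X t') - X t) - θ ^ 2 * M ^ 2) ≤ 1 := by
  set m := ∑ t', w t' * X t'
  have h2 : ∀ t, w t * Real.exp (θ * (m - X t) - θ ^ 2 * M ^ 2) ≤
      Real.exp (θ * m - θ ^ 2 * M ^ 2) * (w t * (1 + θ ^ 2 * M ^ 2) - θ * (w t * X t)) := by
    intro t
    have h3 := exp_neg_le_one_sub_add_sq (mul_nonneg hθ (hX t).1)
    have h4 : (θ * X t) ^ 2 ≤ θ ^ 2 * M ^ 2 := by
      rw [← mul_pow]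
      exact pow_le_pow_left₀ (mul_nonneg hθ (hX t).1)
        (mul_le_mul_of_nonneg_left (hX t).2 hθ) 2
    have h5 : Real.exp (θ * (m - X t) - θ ^ 2 * M ^ 2) =
        Real.exp (θ * m - θ ^ 2 * M ^ 2) * Real.exp (-(θ * X t)) := by
      rw [← Real.exp_add]
      ring_nf
    rw [h5]
    have h6 : Real.exp (-(θ * X t)) ≤ 1 - θ * X t + θ ^ 2 * M ^ 2 := by linarith
    have h7 := mul_le_mul_of_nonneg_left h6
      (mul_nonneg (h0 t) (Real.exp_pos (θ * m - θ ^ 2 * M ^ 2)).le)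
    linarith
  refine (sum_le_sum fun t _ => h2 t).trans ?_
  rw [← mul_sum, sum_sub_distrib, ← sum_mul, h1, ← mul_sum, one_mul]
  have h8 : 1 + θ ^ 2 * M ^ 2 - θ * m ≤ Real.exp (-(θ * m - θ ^ 2 * M ^ 2)) := by
    have := Real.add_one_le_exp (-(θ * m - θ ^ 2 * M ^ 2))
    linarith
  refine (mul_le_mul_of_nonneg_left h8 (Real.exp_pos _).le).trans ?_
  rw [← Real.exp_add, add_neg_cancel, Real.exp_zero]

theorem sum_mul_exp_half_mean_sub_le {X : α → ℝ} {M : ℝ} (hM : 0 < M)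
    (hX : ∀ t, 0 ≤ X t ∧ X t ≤ M) :
    ∑ t, w t * Real.exp (((∑ t', w t' * X t') / 2 - X t) / M) ≤ 1 := by
  set m := ∑ t', w t' * X t'
  have h2 : ∀ t, w t * Real.exp ((m / 2 - X t) / M) ≤
      Real.exp (m / 2 / M) * (w t - w t * X t / (2 * M)) := by
    intro t
    have h3 := exp_neg_le_one_sub_half (div_nonneg (hX t).1 hM.le) ((div_le_one hM).2 (hX t).2)
    have h5 : Real.exp ((m / 2 - X t) / M) = Real.exp (m / 2 / M) * Real.exp (-(X t / M)) := by
      rw [← Real.exp_add]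
      ring_nf
    rw [h5]
    have h7 := mul_le_mul_of_nonneg_left h3 (mul_nonneg (h0 t) (Real.exp_pos (m / 2 / M)).le)
    refine le_trans (le_of_eq (by ring)) (h7.trans (le_of_eq ?_))
    field_simp
  refine (sum_le_sum fun t _ => h2 t).trans ?_
  rw [← mul_sum, sum_sub_distrib, ← sum_div, h1]
  have h8 : 1 - m / (2 * M) ≤ Real.exp (-(m / 2 / M)) := by
    have := Real.add_one_le_exp (-(m / 2 / M))
    rw [div_div] at this ⊢
    linarith
  refine (mul_le_mul_of_nonneg_left h8 (Real.exp_pos _).le).trans ?_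
  rw [← Real.exp_add, add_neg_cancel, Real.exp_zero]

/-- Implicit exploration makes the upper tail of importance weighted estimates light. -/
theorem sum_mul_exp_sub_le {X : α → ℝ} {γ d b : ℝ} (hγ : 0 < γ) (hd : γ ≤ d)
    (hX : ∀ t, 0 ≤ X t ∧ d * X t ≤ 1) (hb0 : 0 ≤ b)
    (hb : ∑ t, w t * X t ≤ b * ((d - γ) / d)) :
    ∑ t, w t * Real.exp (γ * X t - γ * b) ≤ 1 := by
  have hd0 : 0 < d := hγ.trans_le hd
  have h2 : ∀ t, w t * Real.exp (γ * X t - γ * b) ≤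
      Real.exp (-(γ * b)) * (w t + γ * (1 + γ / d) * (w t * X t)) := by
    intro t
    have hX1 : γ * X t ≤ 1 := (mul_le_mul_of_nonneg_right hd (hX t).1).trans (hX t).2
    have h3 := exp_le_one_add_sq (y := γ * X t)
      (by rw [abs_of_nonneg (mul_nonneg hγ.le (hX t).1)]; exact hX1)
    have h4 : (γ * X t) ^ 2 ≤ γ * (γ / d) * X t := by
      have : X t ≤ 1 / d := by rw [le_div_iff₀ hd0]; linarith [(hX t).2]
      have h5 := mul_le_mul_of_nonneg_left this
        (mul_nonneg (mul_nonneg hγ.le hγ.le) (hX t).1)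
      calc (γ * X t) ^ 2 = γ * γ * X t * X t := by ring
        _ ≤ γ * γ * X t * (1 / d) := h5
        _ = γ * (γ / d) * X t := by ring
    rw [sub_eq_add_neg, Real.exp_add]
    have h6 : Real.exp (γ * X t) ≤ 1 + γ * (1 + γ / d) * X t := by linarith
    have h7 := mul_le_mul_of_nonneg_left h6 (mul_nonneg (h0 t) (Real.exp_pos (-(γ * b))).le)
    linarith
  refine (sum_le_sum fun t _ => h2 t).trans ?_
  rw [← mul_sum, sum_add_distrib, ← mul_sum, h1]
  have h8 : γ * (1 + γ / d) * ∑ t, w t * X t ≤ γ * b := by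
    have h9 : (1 + γ / d) * ((d - γ) / d) ≤ 1 := by
      have : (1 + γ / d) * ((d - γ) / d) = 1 - (γ / d) ^ 2 := by field_simp; ring
      rw [this]
      linarith [sq_nonneg (γ / d)]
    calc γ * (1 + γ / d) * ∑ t, w t * X t ≤ γ * (1 + γ / d) * (b * ((d - γ) / d)) := by gcongr
      _ = γ * b * ((1 + γ / d) * ((d - γ) / d)) := by ring
      _ ≤ γ * b * 1 := by gcongr
      _ = γ * b := mul_one _
  have h10 : 1 + γ * (1 + γ / d) * ∑ t, w t * X t ≤ Real.exp (γ * b) := by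
    have := Real.add_one_le_exp (γ * b)
    linarith
  refine (mul_le_mul_of_nonneg_left h10 (Real.exp_pos _).le).trans ?_
  rw [← Real.exp_add, neg_add_cancel, Real.exp_zero]

end Moments

/-! ### Conditional exponential moments of one episode -/

theorem sum_mul_exp_indicator_le {q : Fin S → ℝ} (h0 : ∀ s, 0 ≤ q s) (h1 : ∑ s, q s = 1)
    {θ : ℝ} (hθ : |θ| ≤ 1) (s' : Fin S) :
    ∑ s, q s * Real.exp (θ * (if s = s' then 1 else 0) - (θ + θ ^ 2) * q s') ≤ 1 := by
  have h2 : ∀ s, q s * Real.exp (θ * (if s = s' then 1 else 0) - (θ + θ ^ 2) * q s') =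
      Real.exp (-((θ + θ ^ 2) * q s')) *
        (q s + if s = s' then q s * (Real.exp θ - 1) else 0) := by
    intro s
    rw [sub_eq_add_neg, Real.exp_add]
    split_ifs <;> simp <;> ring
  simp only [h2]
  rw [← mul_sum, sum_add_distrib, h1, sum_ite_eq' _ s', if_pos (mem_univ _)]
  have h3 : 1 + q s' * (Real.exp θ - 1) ≤ Real.exp ((θ + θ ^ 2) * q s') := by
    have h4 := exp_le_one_add_sq hθ
    have h5 := mul_le_mul_of_nonneg_left h4 (h0 s')
    have := Real.add_one_le_exp ((θ + θ ^ 2) * q s')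
    linarith
  refine (mul_le_mul_of_nonneg_left h3 (Real.exp_pos _).le).trans ?_
  rw [← Real.exp_add, neg_add_cancel, Real.exp_zero]

namespace Params

variable (c : Params S A)

theorem keyW_mul_damp_le_upW (hA : 1 ≤ A) (hL : 0 ≤ c.conf) {p : Ker S A} (hp : IsTrans c.H p)
    {q : Ker S A} (hpq : ∀ h, h ∉ c.Λ → p h = q h) {R : List (Rec S A)}
    (hgood : Good c.H c.Λ q c.conf R) {x : Key S A} (hx : x ∈ c.keys) :
    keyW c.Λ c.s₀ (c.plan R) (fun h s a s' => p h s a s' * damp c.conf R h s a s') x ≤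
      c.upW R (c.wt R) x := by
  refine keyW_mono (H := c.H) (fun t s a s' ht hΛ => ?_) (fun t s a s' ht hΛ => ?_) c.s₀
    (c.isPlan_plan hA R) (fst_le_of_mem_keySet hx)
  · exact mul_nonneg (hp.kerNonneg _ _ _ _ ht) (damp_pos hL _ _ _ _ _).le
  · refine mul_damp_le_kerUp hL ?_
    rw [hpq t hΛ]
    exact hgood t s a s' ht hΛ

theorem sum_prob_mul_exp_est_le (hH : 1 ≤ c.H) (hA : 1 ≤ A) (hγ : 0 < c.γ) (hL : 0 ≤ c.conf)
    {p : Ker S A} (hp : IsTrans c.H p) {q : Ker S A} (hpq : ∀ h, h ∉ c.Λ → p h = q h)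
    {ℓ : ℕ → ℕ → Fin S → Fin A → ℝ} (hℓ : ∀ k, IsLoss c.H (ℓ k)) (k : ℕ) {R : List (Rec S A)}
    (hgood : Good c.H c.Λ q c.conf R) {x : Key S A} (hx : x ∈ c.keys) :
    ∑ t, c.prob p R t * Real.exp (c.γ * c.est R (recOf (banditObs c.H ℓ k t)) x -
      c.γ * (advProb p x.2.2 * keyLoss (ℓ k) x)) ≤ 1 := by
  have h0 : 0 ≤ advProb p x.2.2 * keyLoss (ℓ k) x :=
    mul_nonneg (advProb_nonneg_of_mem hp.kerNonneg hx) (keyLoss_mem (hℓ k) hx).1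
  refine sum_mul_exp_sub_le (d := c.den R x) (fun t => c.prob_nonneg hH hA hp R t)
    (c.sum_prob hH hA hp R) hγ
    (le_add_of_nonneg_left ((c.wt_nonneg R x).trans (le_max_left _ _)))
    (fun t => ⟨c.est_nonneg hγ hL hℓ k t R hx, c.den_mul_est_le_one hγ hL hℓ k t R hx⟩) h0 ?_
  rw [c.sum_prob_mul_est hH hA hp ℓ k R hx, mul_div_assoc]
  refine mul_le_mul_of_nonneg_left (div_le_div_of_nonneg_right ?_ (c.den_pos hγ R x).le) h0
  refine (c.keyW_mul_damp_le_upW hA hL hp hpq hgood hx).trans ?_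
  rw [den, add_sub_cancel_right]
  exact le_max_right _ _

theorem sum_prob_mul_exp_hitNext_le (hH : 1 ≤ c.H) (hA : 1 ≤ A) {p : Ker S A}
    (hp : IsTrans c.H p) (R : List (Rec S A)) {t : ℕ} (ht : t + 1 < c.H) (s : Fin S) (a : Fin A)
    (s' : Fin S) {θ : ℝ} (hθ : |θ| ≤ 1) :
    ∑ τ : Traj S A c.H, c.prob p R τ * Real.exp (θ * hitNext s a s' (pre (t + 2) τ.hist) -
      (θ + θ ^ 2) * p t s a s' * hit s a (pre (t + 1) τ.hist)) ≤ 1 := by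
  have h1 : ∀ τ : Traj S A c.H, pre (t + 1) τ.hist = (pre (t + 2) τ.hist).tail := fun τ => by
    obtain ⟨x, hx⟩ := pre_succ_eq_cons (n := t + 1) (τ := τ.hist) (by rw [τ.length_hist]; exact ht)
    rw [hx, List.tail_cons]
  simp only [h1]
  rw [c.sum_prob_mul_pre hH hA hp R ht fun τ => Real.exp (θ * hitNext s a s' τ -
      (θ + θ ^ 2) * p t s a s' * hit s a τ.tail), sum_listsOf_succ]
  have hf := c.isPlan_plan hA R
  refine le_trans (sum_le_sum fun τ hτ => ?_) (sum_plan_mul_pathW_eq_one hp hf c.s₀ ht.le).le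
  rw [mem_listsOf] at hτ
  have h2 : 0 ≤ c.plan R τ * pathW p c.s₀ τ :=
    mul_nonneg (hf.nonneg _) (pathW_nonneg hp.kerNonneg _ (hτ.trans_le ht.le))
  simp only [hitNext, List.tail_cons]
  rw [sum_plan_mul_pathW_cons hf p c.s₀ τ fun s'' => Real.exp
    (θ * (if s'' = s' then hit s a τ else 0) - (θ + θ ^ 2) * p t s a s' * hit s a τ)]
  refine mul_le_of_le_one_right h2 ?_
  obtain ⟨y, τ, rfl⟩ := List.exists_cons_of_length_eq_add_one hτ
  have hτ' : τ.length = t := by simpa using hτ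
  simp only [enter, hit, hτ']
  have hk := hp t ht
  split_ifs with hy
  · subst hy
    simpa using sum_mul_exp_indicator_le (hk.1 s a) (hk.2 s a) hθ s'
  · simp [hk.2]

end Params

/-! ### Validity of the confidence intervals -/

/-- The tilt used to control the deviation of a count of mean `x`. -/
noncomputable def tilt (L x : ℝ) : ℝ := if L ≤ x then √(L / x) else 1

theorem tilt_mem {L : ℝ} (hL : 0 < L) (x : ℝ) : 0 < tilt L x ∧ tilt L x ≤ 1 := by
  unfold tilt
  split_ifs with h
  · have hx : 0 < x := hL.trans_le h
    exact ⟨Real.sqrt_pos.2 (div_pos hL hx), Real.sqrt_le_one.2 ((div_le_one hx).2 h)⟩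
  · exact ⟨one_pos, le_rfl⟩

theorem le_of_tilt {L m y : ℝ} (hL : 0 < L)
    (h : tilt L m * y ≤ L + tilt L m ^ 2 * m) : y ≤ 2 * √(L * m) + 2 * L := by
  unfold tilt at h
  have h0 : 0 ≤ √(L * m) := Real.sqrt_nonneg _
  split_ifs at h with hle
  · have hm' : 0 < m := hL.trans_le hle
    rw [Real.sq_sqrt (by positivity), div_mul_cancel₀ _ hm'.ne'] at h
    have h1 : 0 < √(L / m) := Real.sqrt_pos.2 (by positivity)
    have h2 : √(L / m) * √(L * m) = L := by
      rw [← Real.sqrt_mul (by positivity), show L / m * (L * m) = L * L by field_simp,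
        Real.sqrt_mul_self hL.le]
    have h3 : √(L / m) * y ≤ √(L / m) * (2 * √(L * m)) := by linarith
    linarith [le_of_mul_le_mul_left h3 h1]
  · linarith

theorem abs_sub_le_of_tilt {L m X : ℝ} (hL : 0 < L)
    (h1 : tilt L m * X - (tilt L m + tilt L m ^ 2) * m ≤ L)
    (h2 : -tilt L m * X - (-tilt L m + (-tilt L m) ^ 2) * m ≤ L) :
    |X - m| ≤ 2 * √(L * m) + 2 * L :=
  abs_le.2 ⟨by linarith [le_of_tilt (y := m - X) hL (by linarith)],
    le_of_tilt hL (by linarith)⟩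

theorem abs_sub_le_of_abs_sub_le {L m X : ℝ} (hL : 0 ≤ L) (hm : 0 ≤ m) (hX : 0 ≤ X)
    (h : |X - m| ≤ 2 * √(L * m) + 2 * L) : |X - m| ≤ 3 * √(L * X) + 8 * L := by
  refine h.trans ?_
  rw [Real.sqrt_mul hL] at h ⊢
  rw [Real.sqrt_mul hL]
  have h1 := Real.sq_sqrt hL
  have h2 := Real.sq_sqrt hm
  have h3 := Real.sq_sqrt hX
  have hl := Real.sqrt_nonneg L
  have hz := Real.sqrt_nonneg m
  have hy := Real.sqrt_nonneg X
  set l := √L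
  set z := √m
  set y := √X
  have h4 := (abs_le.1 h).1
  rw [← h1, ← h2, ← h3] at h4
  have h5 : z ≤ y + 3 * l := by
    by_contra! hcon
    nlinarith [mul_nonneg hl hy]
  rw [← h1]
  nlinarith [mul_nonneg hl hy, mul_le_mul_of_nonneg_left h5 hl]

theorem hit_eq_zero_or_one (s : Fin S) (a : Fin A) (τ : Hist S A) :
    hit s a τ = 0 ∨ hit s a τ = 1 := by
  cases τ with
  | nil => exact Or.inl rfl
  | cons y τ =>
    simp only [hit]
    split_ifs <;> simp

theorem exists_cnt_eq (R : List (Rec S A)) (t : ℕ) (s : Fin S) (a : Fin A) :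
    ∃ n ≤ R.length, cnt R t s a = n := by
  induction R with
  | nil => exact ⟨0, le_rfl, by simp [cnt]⟩
  | cons r R ih =>
    obtain ⟨n, hn, h⟩ := ih
    simp only [cnt, List.map_cons, List.sum_cons, List.length_cons] at h ⊢
    rw [h]
    rcases hit_eq_zero_or_one s a (pre (t + 1) r.1) with h0 | h0
    · exact ⟨n, hn.trans (Nat.le_succ _), by rw [h0, zero_add]⟩
    · exact ⟨n + 1, Nat.succ_le_succ hn, by rw [h0]; push_cast; ring⟩

theorem length_recs_eq {H : ℕ} (ℓ : ℕ → ℕ → Fin S → Fin A → ℝ) (l : List (Traj S A H)) :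
    (recs ℓ l).length = l.length := by
  induction l with
  | nil => rfl
  | cons t l ih => simp [recs, ih]

/-- Increments of the exponential martingales controlling the transition counts. -/
def devInc {H : ℕ} (θ b : ℝ) (t : ℕ) (s : Fin S) (a : Fin A) (s' : Fin S)
    (_ : List (Traj S A H)) (τ : Traj S A H) : ℝ :=
  θ * hitNext s a s' (pre (t + 2) τ.hist) - (θ + θ ^ 2) * b * hit s a (pre (t + 1) τ.hist)

theorem acc_devInc {H : ℕ} (θ b : ℝ) (t : ℕ) (s : Fin S) (a : Fin A) (s' : Fin S)
    (ℓ : ℕ → ℕ → Fin S → Fin A → ℝ) (l : List (Traj S A H)) :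
    acc (devInc θ b t s a s') l =
      θ * cntNext (recs ℓ l) t s a s' - (θ + θ ^ 2) * b * cnt (recs ℓ l) t s a := by
  induction l with
  | nil => simp [acc, recs, cnt, cntNext]
  | cons τ l ih =>
    simp only [acc, ih, devInc, recs, cnt, cntNext, List.map_cons, List.sum_cons, recOf_fst]
    ring

theorem good_of_acc_le {H : ℕ} {Λ : Finset ℕ} {q : Ker S A}
    (hq : ∀ t s a s', t + 1 < H → t ∉ Λ → 0 ≤ q t s a s' ∧ q t s a s' ≤ 1) {L : ℝ} (hL : 1 ≤ L)
    (ℓ : ℕ → ℕ → Fin S → Fin A → ℝ) {l : List (Traj S A H)}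
    (h : ∀ t s a s', t + 1 < H → t ∉ Λ → ∀ n ≤ l.length, ∀ σ : ℝ, (σ = 1 ∨ σ = -1) →
      acc (devInc (σ * tilt L (q t s a s' * n)) (q t s a s') t s a s') l ≤ L) :
    Good H Λ q L (recs ℓ l) := by
  intro t s a s' ht hΛ
  obtain ⟨n, hn, hcnt⟩ := exists_cnt_eq (recs ℓ l) t s a
  rw [length_recs_eq] at hn
  have hL0 : 0 < L := one_pos.trans_le hL
  have h1 := h t s a s' ht hΛ n hn 1 (Or.inl rfl)
  have h2 := h t s a s' ht hΛ n hn (-1) (Or.inr rfl)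
  obtain ⟨hq0, hq1⟩ := hq t s a s' ht hΛ
  rw [acc_devInc (ℓ := ℓ), hcnt] at h1 h2
  simp only [one_mul, neg_one_mul, mul_assoc] at h1 h2
  have hX := cntNext_nonneg (recs ℓ l) t s a s'
  have hdev := abs_sub_le_of_abs_sub_le hL0.le (by positivity) hX
    (abs_sub_le_of_tilt hL0 h1 h2)
  unfold width phat
  rw [hcnt]
  rcases Nat.eq_zero_or_pos n with rfl | hpos
  · have h0 := abs_sub_le_of_tilt hL0 h1 h2
    simp only [Nat.cast_zero, mul_zero, Real.sqrt_zero, sub_zero, zero_add] at h0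
    have h3 := Real.sqrt_nonneg (L * cntNext (recs ℓ l) t s a s')
    simp only [Nat.cast_zero, max_eq_left zero_le_one, div_one]
    rw [abs_le] at h0 ⊢
    constructor <;> linarith
  · have hn1 : (1 : ℝ) ≤ n := by exact_mod_cast hpos
    have hn0 : (0 : ℝ) < n := one_pos.trans_le hn1
    rw [max_eq_right hn1]
    have h3 : √(L * (cntNext (recs ℓ l) t s a s' / n) / n) =
        √(L * cntNext (recs ℓ l) t s a s') / n := by
      rw [show L * (cntNext (recs ℓ l) t s a s' / n) / n =
        L * cntNext (recs ℓ l) t s a s' / (n : ℝ) ^ 2 by field_simp,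
        Real.sqrt_div' _ (sq_nonneg _), Real.sqrt_sq hn0.le]
    have h4 : cntNext (recs ℓ l) t s a s' / n - q t s a s' =
        (cntNext (recs ℓ l) t s a s' - q t s a s' * n) / n := by field_simp
    rw [h3, h4, abs_div, abs_of_pos hn0, ← mul_div_assoc, ← add_div]
    exact div_le_div_of_nonneg_right hdev hn0.le

/-! ### The good event -/

namespace Params

variable (c : Params S A)

/-- The law of the trajectory of the next episode. -/
noncomputable def step (p : ℕ → Ker S A) (ℓ : ℕ → ℕ → Fin S → Fin A → ℝ)
    (past : List (Traj S A c.H)) (t : Traj S A c.H) : ℝ :=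
  c.prob (p past.length) (recs ℓ past) t

/-- The loss estimate of a key in the next episode. -/
noncomputable def estAt (ℓ : ℕ → ℕ → Fin S → Fin A → ℝ) (x : Key S A)
    (past : List (Traj S A c.H)) (t : Traj S A c.H) : ℝ :=
  c.est (recs ℓ past) (recOf (banditObs c.H ℓ past.length t)) x

/-- The estimated value in the next episode. -/
noncomputable def estValAt (ℓ : ℕ → ℕ → Fin S → Fin A → ℝ)
    (past : List (Traj S A c.H)) (t : Traj S A c.H) : ℝ :=
  c.estVal (recs ℓ past) (recOf (banditObs c.H ℓ past.length t))

/-- The confidence widths met in the next episode. -/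
noncomputable def errAt (ℓ : ℕ → ℕ → Fin S → Fin A → ℝ)
    (past : List (Traj S A c.H)) (t : Traj S A c.H) : ℝ :=
  c.errSum (recs ℓ past) t.hist

/-- Conditional expectation given the past episodes. -/
noncomputable def mean (p : ℕ → Ker S A) (ℓ : ℕ → ℕ → Fin S → Fin A → ℝ)
    (G : List (Traj S A c.H) → Traj S A c.H → ℝ) (past : List (Traj S A c.H))
    (_ : Traj S A c.H) : ℝ :=
  ∑ t, c.step p ℓ past t * G past t

/-- The adversarial part of the loss of a key in the next episode. -/
noncomputable def lossAt (p : ℕ → Ker S A) (ℓ : ℕ → ℕ → Fin S → Fin A → ℝ) (x : Key S A)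
    (past : List (Traj S A c.H)) (_ : Traj S A c.H) : ℝ :=
  advProb (p past.length) x.2.2 * keyLoss (ℓ past.length) x

/-- All concentration bounds hold along a sequence of trajectories. -/
structure Concentrated (p : ℕ → Ker S A) (q : Ker S A) (ℓ : ℕ → ℕ → Fin S → Fin A → ℝ)
    (l : List (Traj S A c.H)) : Prop where
  good : ∀ l', l' <:+ l → Good c.H c.Λ q c.conf (recs ℓ l')
  est_le : ∀ x ∈ c.keys, c.γ * acc (c.estAt ℓ x) l ≤ c.γ * acc (c.lossAt p ℓ x) l + c.conf
  estVal_le : acc (c.mean p ℓ (c.estValAt ℓ)) l - acc (c.estValAt ℓ) l ≤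
    c.H * √l.length * (1 + c.conf)
  err_le : acc (c.mean p ℓ (c.errAt ℓ)) l ≤ 2 * acc (c.errAt ℓ) l + 2 * c.H * c.conf

/-- Indices of the deviation inequalities for transition counts. -/
noncomputable def devIndex (n : ℕ) : Finset (ℕ × ℕ × ℝ × ℕ × Fin S × Fin A × Fin S) :=
  range (n + 1) ×ˢ range (n + 1) ×ˢ {1, -1} ×ˢ
    {t ∈ range c.H | t + 1 < c.H ∧ t ∉ c.Λ} ×ˢ univ

/-- Increments of the exponential martingale attached to a deviation inequality. -/
noncomputable def devFun (q : Ker S A) (i : ℕ × ℕ × ℝ × ℕ × Fin S × Fin A × Fin S)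
    (past : List (Traj S A c.H)) (τ : Traj S A c.H) : ℝ :=
  if past.length < i.1 then
    devInc (i.2.2.1 * tilt c.conf (q i.2.2.2.1 i.2.2.2.2.1 i.2.2.2.2.2.1 i.2.2.2.2.2.2 * i.2.1))
      (q i.2.2.2.1 i.2.2.2.2.1 i.2.2.2.2.2.1 i.2.2.2.2.2.2)
      i.2.2.2.1 i.2.2.2.2.1 i.2.2.2.2.2.1 i.2.2.2.2.2.2 past τ
  else 0

theorem card_devIndex_le (n : ℕ) :
    ((c.devIndex n).card : ℝ) ≤ (n + 1) ^ 2 * 2 * c.H * (S ^ 2 * A) := by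
  unfold devIndex
  simp only [card_product, card_range, card_univ, Fintype.card_prod, Fintype.card_fin]
  have h1 : ((range c.H).filter fun t => t + 1 < c.H ∧ t ∉ c.Λ).card ≤ c.H :=
    (card_filter_le _ _).trans (card_range _).le
  have h2 : ({1, -1} : Finset ℝ).card ≤ 2 := card_le_two
  have h3 : (n + 1) * ((n + 1) * (({1, -1} : Finset ℝ).card *
      (((range c.H).filter fun t => t + 1 < c.H ∧ t ∉ c.Λ).card * (S * (A * S))))) ≤
      (n + 1) * ((n + 1) * (2 * (c.H * (S * (A * S))))) := by gcongr
  refine (Nat.cast_le.2 h3).trans (le_of_eq ?_)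
  push_cast
  ring

open scoped Classical in
/-- Increments of the exponential martingale attached to the loss estimate of a key. -/
noncomputable def estFun (p : ℕ → Ker S A) (q : Ker S A) (ℓ : ℕ → ℕ → Fin S → Fin A → ℝ)
    (x : Key S A) (past : List (Traj S A c.H)) (t : Traj S A c.H) : ℝ :=
  if Good c.H c.Λ q c.conf (recs ℓ past) then
    c.γ * c.estAt ℓ x past t - c.γ * c.lossAt p ℓ x past t
  else 0

/-- Increments of the exponential martingales attached to the estimated values and to the
confidence widths. -/
noncomputable def valFun (p : ℕ → Ker S A) (ℓ : ℕ → ℕ → Fin S → Fin A → ℝ) (n : ℕ) (b : Bool)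
    (past : List (Traj S A c.H)) (t : Traj S A c.H) : ℝ :=
  if b then
    1 / (c.H * √n) * (c.mean p ℓ (c.estValAt ℓ) past t - c.estValAt ℓ past t) -
      (1 / (c.H * √n)) ^ 2 * (c.H : ℝ) ^ 2
  else (c.mean p ℓ (c.errAt ℓ) past t / 2 - c.errAt ℓ past t) / c.H

theorem stat_mem {p : ℕ → Ker S A} (hp : ∀ k, IsTrans c.H (p k)) {q : Ker S A}
    (hpq : ∀ k h, h ∉ c.Λ → p k h = q h) (t : ℕ) (s : Fin S) (a : Fin A) (s' : Fin S)
    (ht : t + 1 < c.H) (hΛ : t ∉ c.Λ) : 0 ≤ q t s a s' ∧ q t s a s' ≤ 1 := by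
  rw [← hpq 0 t hΛ]
  have := hp 0 t ht
  refine ⟨this.1 s a s', ?_⟩
  rw [← this.2 s a]
  exact single_le_sum (fun s'' _ => this.1 s a s'') (mem_univ s')

section

variable (hH : 1 ≤ c.H) (hA : 1 ≤ A) (hγ : 0 < c.γ) (hL : 1 ≤ c.conf)
  {p : ℕ → Ker S A} (hp : ∀ k, IsTrans c.H (p k)) {q : Ker S A}
  (hpq : ∀ k h, h ∉ c.Λ → p k h = q h) {ℓ : ℕ → ℕ → Fin S → Fin A → ℝ}
  (hℓ : ∀ k, IsLoss c.H (ℓ k))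

include hH hA hp

theorem step_nonneg (past : List (Traj S A c.H)) (t : Traj S A c.H) : 0 ≤ c.step p ℓ past t :=
  c.prob_nonneg hH hA (hp _) _ _

theorem sum_step (past : List (Traj S A c.H)) : ∑ t, c.step p ℓ past t = 1 :=
  c.sum_prob hH hA (hp _) _

include hpq hL in
theorem sum_step_mul_exp_devFun_le {n : ℕ} {i : ℕ × ℕ × ℝ × ℕ × Fin S × Fin A × Fin S}
    (hi : i ∈ c.devIndex n) (past : List (Traj S A c.H)) :
    ∑ τ, c.step p ℓ past τ * Real.exp (c.devFun q i past τ) ≤ 1 := by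
  obtain ⟨k, m, σ, t, s, a, s'⟩ := i
  simp only [devIndex, mem_product, mem_range, mem_insert, mem_singleton, mem_filter, mem_univ,
    and_true] at hi
  obtain ⟨-, -, hσ, -, ht, hΛ⟩ := hi
  unfold devFun
  split_ifs
  · have h1 := tilt_mem (one_pos.trans_le hL) (q t s a s' * m)
    have h2 : |σ * tilt c.conf (q t s a s' * m)| ≤ 1 := by
      rw [abs_mul, abs_of_pos h1.1]
      rcases hσ with rfl | rfl <;> simpa using h1.2
    have h3 := c.sum_prob_mul_exp_hitNext_le hH hA (hp past.length) (recs ℓ past) ht s a s' h2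
    rw [hpq _ t hΛ] at h3
    exact h3
  · simpa using (c.sum_step hH hA hp past).le

include hpq hL hγ hℓ in
theorem sum_step_mul_exp_estFun_le {x : Key S A} (hx : x ∈ c.keys)
    (past : List (Traj S A c.H)) :
    ∑ t, c.step p ℓ past t * Real.exp (c.estFun p q ℓ x past t) ≤ 1 := by
  unfold estFun
  split_ifs with hg
  · exact c.sum_prob_mul_exp_est_le hH hA hγ (zero_le_one.trans hL) (hp _) (hpq _) hℓ _ hg hx
  · simpa using (c.sum_step hH hA hp past).le

include hL hγ hℓ in
theorem sum_step_mul_exp_valFun_le (n : ℕ) (b : Bool) (past : List (Traj S A c.H)) :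
    ∑ t, c.step p ℓ past t * Real.exp (c.valFun p ℓ n b past t) ≤ 1 := by
  have hL0 := zero_le_one.trans hL
  cases b with
  | true =>
    simp only [valFun, if_true]
    exact sum_mul_exp_mean_sub_le (fun t => c.step_nonneg hH hA hp past t)
      (c.sum_step hH hA hp past) (by positivity)
      (fun t => c.estVal_mem hγ hL0 hℓ _ t _)
  | false =>
    simp only [valFun, Bool.false_eq_true, if_false]
    exact sum_mul_exp_half_mean_sub_le (fun t => c.step_nonneg hH hA hp past t)
      (c.sum_step hH hA hp past) (by exact_mod_cast hH) (fun t => c.errSum_mem hL0 _ _)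

include hpq hL in
omit hA in
theorem concentrated_of_acc_le {l : List (Traj S A c.H)} (hl : l ≠ [])
    (h1 : ∀ i ∈ c.devIndex l.length, acc (c.devFun q i) l ≤ c.conf)
    (h2 : ∀ x ∈ c.keys, acc (c.estFun p q ℓ x) l ≤ c.conf)
    (h3 : ∀ b, acc (c.valFun p ℓ l.length b) l ≤ c.conf) : c.Concentrated p q ℓ l := by
  have hH0 : (0 : ℝ) < c.H := by exact_mod_cast hH
  have hgood : ∀ l', l' <:+ l → Good c.H c.Λ q c.conf (recs ℓ l') := by
    intro l' hl'
    refine good_of_acc_le (c.stat_mem hp hpq) hL ℓ fun t s a s' ht hΛ n hn σ hσ => ?_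
    rw [← acc_cut hl']
    refine h1 (l'.length, n, σ, t, s, a, s') ?_
    have := hl'.length_le
    simp only [devIndex, mem_product, mem_range, mem_insert, mem_singleton, mem_filter, mem_univ,
      and_true]
    exact ⟨by lia, by lia, hσ, by lia, ht, hΛ⟩
  refine ⟨hgood, fun x hx => ?_, ?_, ?_⟩
  · have h4 := h2 x hx
    have h5 : acc (c.estFun p q ℓ x) l =
        acc (fun past t => c.γ * c.estAt ℓ x past t - c.γ * c.lossAt p ℓ x past t) l :=
      acc_congr fun past t ht => if_pos (hgood past ((List.suffix_cons t past).trans ht))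
    rw [h5, acc_sub, acc_const_mul, acc_const_mul] at h4
    linarith
  · have h4 : acc (fun past t =>
        1 / (c.H * √l.length) * (c.mean p ℓ (c.estValAt ℓ) past t - c.estValAt ℓ past t) -
          (1 / (c.H * √l.length)) ^ 2 * (c.H : ℝ) ^ 2) l ≤ c.conf := h3 true
    have hn : (0 : ℝ) < l.length := by exact_mod_cast List.length_pos_iff.2 hl
    have hs := Real.sqrt_pos.2 hn
    rw [acc_sub, acc_const_mul, acc_sub, acc_const] at h4
    have h5 : (l.length : ℝ) * ((1 / (c.H * √l.length)) ^ 2 * (c.H : ℝ) ^ 2) = 1 := by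
      rw [div_pow, mul_pow, Real.sq_sqrt hn.le]
      field_simp
    rw [h5, div_mul_eq_mul_div, one_mul, sub_le_iff_le_add, div_le_iff₀ (by positivity)] at h4
    linarith
  · have h4 : acc (fun past t =>
        (c.mean p ℓ (c.errAt ℓ) past t / 2 - c.errAt ℓ past t) / (c.H : ℝ)) l ≤ c.conf := h3 false
    have h5 : acc (fun past t =>
        (c.mean p ℓ (c.errAt ℓ) past t / 2 - c.errAt ℓ past t) / (c.H : ℝ)) l =
        (acc (c.mean p ℓ (c.errAt ℓ)) l / 2 - acc (c.errAt ℓ) l) / c.H := by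
      have : ∀ (past : List (Traj S A c.H)) t,
          (c.mean p ℓ (c.errAt ℓ) past t / 2 - c.errAt ℓ past t) / (c.H : ℝ) =
          (c.H : ℝ)⁻¹ * (2⁻¹ * c.mean p ℓ (c.errAt ℓ) past t - c.errAt ℓ past t) := by
        intro past t
        ring
      simp only [this]
      rw [acc_const_mul, acc_sub, acc_const_mul]
      ring
    rw [h5, div_le_iff₀ hH0] at h4
    linarith

include hpq hL hγ hℓ in
open scoped Classical in
theorem one_sub_le_sum_seqW_of_concentrated {n : ℕ} (hn : 1 ≤ n) {E : List (Traj S A c.H) → Prop}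
    (hE : ∀ l, l.length = n → c.Concentrated p q ℓ l → E l) :
    1 - ((c.devIndex n).card + c.keys.card + 2 : ℝ) * Real.exp (-c.conf) ≤
      ∑ l ∈ listsOf _ n, seqW (c.step p ℓ) l * (if E l then 1 else 0) := by
  have h := one_sub_le_sum_seqW (c.step_nonneg hH hA hp (ℓ := ℓ)) (c.sum_step hH hA hp)
    ((c.devIndex n).disjSum (c.keys.disjSum (univ : Finset Bool)))
    (F := Sum.elim (c.devFun q) (Sum.elim (c.estFun p q ℓ) (c.valFun p ℓ n)))
    (fun i hi past => by
      rcases i with i | i | i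
      · exact c.sum_step_mul_exp_devFun_le hH hA hL hp hpq (inl_mem_disjSum.1 hi) past
      · exact c.sum_step_mul_exp_estFun_le hH hA hγ hL hp hpq hℓ
          (inl_mem_disjSum.1 (inr_mem_disjSum.1 hi)) past
      · exact c.sum_step_mul_exp_valFun_le hH hA hγ hL hp hℓ n i past)
    c.conf n (E := E) fun l hl hacc => by
      rw [mem_listsOf] at hl
      refine hE l hl (c.concentrated_of_acc_le hH hL hp hpq ?_ ?_ ?_ ?_)
      · rintro rfl
        simp only [List.length_nil] at hl
        lia
      · rw [hl]
        exact fun i hi => hacc (Sum.inl i) (inl_mem_disjSum.2 hi)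
      · exact fun x hx => hacc (Sum.inr (Sum.inl x)) (by simpa using hx)
      · rw [hl]
        exact fun b => hacc (Sum.inr (Sum.inr b)) (by simp)
  refine le_trans (le_of_eq ?_) h
  simp only [card_disjSum, card_univ, Fintype.card_bool]
  push_cast
  ring

end

end Params

/-! ### Regret decomposition -/

theorem keyW_congr {Λ : Finset ℕ} (s₀ : Fin S) (f : Hist S A → ℝ) {κ κ' : Ker S A}
    (h : ∀ t, t ∉ Λ → κ t = κ' t) : keyW Λ s₀ f κ = keyW Λ s₀ f κ' := by
  have : statKer Λ κ = statKer Λ κ' := by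
    funext t s a s'
    unfold statKer
    split_ifs with ht
    · rfl
    · rw [h t ht]
  unfold keyW
  rw [this]

theorem breg_zero_le {γ u B : ℝ} (hγ : 0 < γ) (hu : 0 ≤ u) (huB : u ≤ B) :
    breg γ u 0 ≤ (u + γ) * Real.log ((B + γ) / γ) := by
  have h : Real.log ((u + γ) / (0 + γ)) ≤ Real.log ((B + γ) / γ) := by
    rw [zero_add]
    exact Real.log_le_log (by positivity) (by gcongr)
  have := mul_le_mul_of_nonneg_left h (add_nonneg hu hγ.le)
  unfold breg
  linarith

namespace Params

variable (c : Params S A)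

/-- The weights of a comparator plan. -/
noncomputable def comp (q : Ker S A) (f : Hist S A → ℝ) (x : Key S A) : ℝ :=
  open scoped Classical in if x ∈ c.keys then keyW c.Λ c.s₀ f q x else 0

theorem comp_of_mem (q : Ker S A) (f : Hist S A → ℝ) {x : Key S A} (hx : x ∈ c.keys) :
    c.comp q f x = keyW c.Λ c.s₀ f q x := if_pos hx

/-- The value of the plan played in the next episode. -/
noncomputable def playAt (p : ℕ → Ker S A) (ℓ : ℕ → ℕ → Fin S → Fin A → ℝ)
    (past : List (Traj S A c.H)) (_ : Traj S A c.H) : ℝ :=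
  planValue c.H (p past.length) (c.plan (recs ℓ past)) (ℓ past.length) c.s₀

section

variable (hS : 1 ≤ S) (hcap : c.cap = (S : ℝ) ^ c.Λ.card) {p : ℕ → Ker S A}
  (hp : ∀ k, IsTrans c.H (p k)) {q : Ker S A} (hpq : ∀ k h, h ∉ c.Λ → p k h = q h)
  {f : Hist S A → ℝ} (hf : IsPlan f)

include hp hpq hf

theorem comp_nonneg (x : Key S A) : 0 ≤ c.comp q f x := by
  unfold comp
  split_ifs with hx
  · refine keyW_nonneg (H := c.H) (fun t s a s' ht hΛ => ?_) _ hf (fst_le_of_mem_keySet hx)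
    exact (c.stat_mem hp hpq t s a s' ht hΛ).1
  · exact le_rfl

include hS hcap

theorem sum_comp_layer_le {h : ℕ} (hh : h < c.H) :
    ∑ x ∈ keyLayer S A c.Λ h, c.comp q f x ≤ c.cap := by
  rw [hcap]
  refine le_trans (le_of_eq (sum_congr rfl fun x hx => ?_))
    (sum_keyW_le (hp 0) c.s₀ hf hS hh)
  rw [c.comp_of_mem q f (mem_biUnion.2 ⟨h, mem_range.2 hh, hx⟩),
    keyW_congr c.s₀ f (hpq 0)]

theorem sum_comp_le : ∑ x ∈ c.keys, c.comp q f x ≤ c.H * c.cap := by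
  unfold keys
  rw [sum_keySet]
  refine (sum_le_sum fun h hh =>
    c.sum_comp_layer_le hS hcap hp hpq hf (mem_range.1 hh)).trans ?_
  simp

theorem comp_le_cap (x : Key S A) : c.comp q f x ≤ c.cap := by
  by_cases hx : x ∈ c.keys
  · obtain ⟨h, hh, hx'⟩ := mem_biUnion.1 hx
    exact (single_le_sum (fun y _ => c.comp_nonneg hp hpq hf y) hx').trans
      (c.sum_comp_layer_le hS hcap hp hpq hf (mem_range.1 hh))
  · rw [comp, if_neg hx, hcap]
    positivity

theorem comp_mem_dom (hL : 0 ≤ c.conf) {R : List (Rec S A)}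
    (hgood : Good c.H c.Λ q c.conf R) : c.comp q f ∈ c.dom R := by
  refine ⟨fun x => ⟨c.comp_nonneg hp hpq hf x, c.comp_le_cap hS hcap hp hpq hf x⟩, f, hf,
    fun x hx => ?_⟩
  rw [c.comp_of_mem q f hx]
  refine keyW_mono (H := c.H) (fun t s a s' _ _ => kerLow_nonneg hL _ _ _ _ _)
    (fun t s a s' ht hΛ => ?_) _ hf (fst_le_of_mem_keySet hx)
  exact kerLow_le hL (c.stat_mem hp hpq t s a s' ht hΛ).1 (hgood t s a s' ht hΛ)

theorem sum_breg_comp_le (hγ : 0 < c.γ) :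
    ∑ x ∈ c.keys, breg c.γ (c.comp q f x) 0 ≤
      (c.H * c.cap + c.γ * c.keys.card) * Real.log ((c.cap + c.γ) / c.γ) := by
  have hcap0 : 0 ≤ c.cap := by rw [hcap]; positivity
  refine (sum_le_sum fun x _ => breg_zero_le hγ (c.comp_nonneg hp hpq hf x)
    (c.comp_le_cap hS hcap hp hpq hf x)).trans ?_
  rw [← sum_mul, sum_add_distrib, sum_const, nsmul_eq_mul, mul_comm _ c.γ]
  refine mul_le_mul_of_nonneg_right
    (add_le_add_left (c.sum_comp_le hS hcap hp hpq hf) _) (Real.log_nonneg ?_)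
  rw [one_le_div hγ]
  linarith

end

theorem mirror_regret (hγ : 0 < c.γ) (hL : 0 ≤ c.conf) {ℓ : ℕ → ℕ → Fin S → Fin A → ℝ}
    (hℓ : ∀ k, IsLoss c.H (ℓ k)) {u : Key S A → ℝ} {l : List (Traj S A c.H)}
    (hu : ∀ l', l' <:+ l → u ∈ c.dom (recs ℓ l')) :
    c.γ * acc (c.estValAt ℓ) l + ∑ x ∈ c.keys, breg c.γ (u x) (c.wt (recs ℓ l) x) ≤
      c.γ * ∑ x ∈ c.keys, u x * acc (c.estAt ℓ x) l + ∑ x ∈ c.keys, breg c.γ (u x) 0 +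
        c.γ ^ 2 * ∑ x ∈ c.keys, acc (c.estAt ℓ x) l := by
  induction l with
  | nil =>
    have hu0 := hu [] List.suffix_rfl
    have h := sum_mirrorStep_sub_le hγ (v := 0) (fun _ => le_rfl) 0 hu0
    simp only [Pi.zero_apply, mul_zero, sum_const_zero] at h
    have h1 : ∑ x ∈ c.keys, breg c.γ (c.wt [] x) 0 ≥ 0 :=
      sum_nonneg fun x _ => breg_nonneg hγ (c.wt_nonneg [] x) le_rfl
    simp only [sum_sub_distrib] at h
    simp only [acc, recs, mul_zero, sum_const_zero, zero_add, add_zero]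
    change 0 ≤ _ - ∑ x ∈ c.keys, breg c.γ (u x) (c.wt [] x) -
      ∑ x ∈ c.keys, breg c.γ (c.wt [] x) 0 at h
    linarith
  | cons t l ih =>
    have hih := ih fun l' h => hu l' (h.trans (List.suffix_cons t l))
    have hest : ∀ x ∈ c.keys, 0 ≤ c.estAt ℓ x l t := fun x hx =>
      c.est_nonneg hγ hL hℓ _ t _ hx
    have h := sum_sub_mirrorStep_le hγ (v := c.wt (recs ℓ l)) (l := fun x => c.estAt ℓ x l t)
      (c.wt_nonneg _) hest (hu (t :: l) List.suffix_rfl)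
    have h1 : ∑ x ∈ c.keys, (c.wt (recs ℓ l) x + c.γ) * (c.γ * c.estAt ℓ x l t) ^ 2 ≤
        c.γ ^ 2 * ∑ x ∈ c.keys, c.estAt ℓ x l t := by
      rw [mul_sum]
      refine sum_le_sum fun x hx => ?_
      have h2 : (c.wt (recs ℓ l) x + c.γ) * c.estAt ℓ x l t ≤ 1 :=
        (mul_le_mul_of_nonneg_right (by unfold den; gcongr; exact le_max_left _ _)
          (hest x hx)).trans (c.den_mul_est_le_one hγ hL hℓ _ t _ hx)
      have h3 := mul_le_mul_of_nonneg_left h2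
        (mul_nonneg (sq_nonneg c.γ) (hest x hx))
      linarith
    have h4 : ∑ x ∈ c.keys, (c.wt (recs ℓ l) x - u x) * (c.γ * c.estAt ℓ x l t) =
        c.γ * c.estValAt ℓ l t - c.γ * ∑ x ∈ c.keys, u x * c.estAt ℓ x l t := by
      unfold estValAt estVal
      rw [mul_sum, mul_sum, ← sum_sub_distrib]
      refine sum_congr rfl fun x _ => ?_
      unfold estAt
      ring
    have h5 : ∑ x ∈ c.keys, breg c.γ (u x) (c.wt (recs ℓ (t :: l)) x) =
        ∑ x ∈ c.keys, breg c.γ (u x) (mirrorStep c.keys c.Λ c.s₀ c.cap c.γ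
          (kerLow c.conf (recs ℓ (t :: l))) (c.wt (recs ℓ l)) (fun x => c.estAt ℓ x l t) x) := rfl
    rw [h4] at h
    simp only [acc, mul_add, sum_add_distrib]
    rw [h5]
    linarith

theorem regret_le (hH : 1 ≤ c.H) (hS : 1 ≤ S) (hA : 1 ≤ A)
    (hcap : c.cap = (S : ℝ) ^ c.Λ.card) (hγ : 0 < c.γ) (hL : 0 ≤ c.conf) {p : ℕ → Ker S A}
    (hp : ∀ k, IsTrans c.H (p k)) {q : Ker S A} (hpq : ∀ k h, h ∉ c.Λ → p k h = q h)
    {ℓ : ℕ → ℕ → Fin S → Fin A → ℝ} (hℓ : ∀ k, IsLoss c.H (ℓ k)) {f : Hist S A → ℝ}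
    (hf : IsPlan f) {l : List (Traj S A c.H)} (hl : c.Concentrated p q ℓ l) :
    acc (c.playAt p ℓ) l -
        acc (fun past _ => planValue c.H (p past.length) f (ℓ past.length) c.s₀) l ≤
      10 * c.H * acc (c.errAt ℓ) l + 10 * (c.H : ℝ) ^ 2 * c.conf +
        2 * l.length * c.γ * (c.H * ((S : ℝ) * A) ^ (c.Λ.card + 1)) +
        c.H * √l.length * (1 + c.conf) + c.conf * (c.H * c.cap + c.γ * c.keys.card) / c.γ +
        (c.H * c.cap + c.γ * c.keys.card) * Real.log ((c.cap + c.γ) / c.γ) / c.γ := by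
  set W : ℝ := c.H * ((S : ℝ) * A) ^ (c.Λ.card + 1)
  have h1 : acc (c.playAt p ℓ) l ≤ acc (c.mean p ℓ (c.estValAt ℓ)) l +
      5 * c.H * acc (c.mean p ℓ (c.errAt ℓ)) l + l.length * (c.γ * W) := by
    rw [← acc_const_mul, ← acc_const (c.γ * W) l, ← acc_add, ← acc_add]
    refine acc_le fun past t ht => ?_
    have hg := hl.good past ((List.suffix_cons t past).trans ht)
    have := c.planValue_sub_le hH hS hA hγ hL (hp past.length) (hpq _) hℓ past.length
      (length_recs ℓ past) hg ⟨_, c.comp_mem_dom hS hcap hp hpq hf hL hg⟩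
    unfold playAt mean step estValAt errAt
    linarith
  have h2 := c.mirror_regret hγ hL hℓ (u := c.comp q f) (l := l) fun l' hl' =>
    c.comp_mem_dom hS hcap hp hpq hf hL (hl.good l' hl')
  have h3 : 0 ≤ ∑ x ∈ c.keys, breg c.γ (c.comp q f x) (c.wt (recs ℓ l) x) :=
    sum_nonneg fun x _ => breg_nonneg hγ (c.comp_nonneg hp hpq hf x) (c.wt_nonneg _ x)
  have h4 := c.sum_breg_comp_le hS hcap hp hpq hf hγ
  have h5 : c.γ * ∑ x ∈ c.keys, c.comp q f x * acc (c.estAt ℓ x) l ≤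
      c.γ * acc (fun past _ => planValue c.H (p past.length) f (ℓ past.length) c.s₀) l +
        c.conf * (c.H * c.cap) := by
    have h6 : acc (fun past _ => planValue c.H (p past.length) f (ℓ past.length) c.s₀) l =
        ∑ x ∈ c.keys, c.comp q f x * acc (c.lossAt p ℓ x) l := by
      simp only [← acc_const_mul]
      rw [← acc_sum]
      refine acc_congr fun past t _ => ?_
      rw [planValue_eq_sum_keyW c.Λ]
      refine sum_congr rfl fun x hx => ?_
      rw [c.comp_of_mem q f hx, keyW_congr c.s₀ f (hpq past.length), lossAt]
      ring
    rw [h6]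
    have h7 := mul_le_mul_of_nonneg_left (c.sum_comp_le hS hcap hp hpq hf) hL
    refine le_trans ?_ (add_le_add_right h7 _)
    rw [mul_sum, mul_sum, mul_sum, ← sum_add_distrib]
    refine sum_le_sum fun x hx => ?_
    have := mul_le_mul_of_nonneg_left (hl.est_le x hx) (c.comp_nonneg hp hpq hf x)
    linarith
  have h8 : c.γ * ∑ x ∈ c.keys, acc (c.estAt ℓ x) l ≤
      l.length * (c.γ * W) + c.conf * c.keys.card := by
    have h9 : ∑ x ∈ c.keys, acc (c.lossAt p ℓ x) l ≤ l.length * W := by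
      rw [← acc_sum, ← acc_const W l]
      refine acc_le fun past t _ => ?_
      refine (sum_le_sum fun x hx => ?_).trans
        (sum_keySet_advProb_le (hp past.length) c.Λ hS hA)
      exact mul_le_of_le_one_right (advProb_nonneg_of_mem (hp _).kerNonneg hx)
        (keyLoss_mem (hℓ _) hx).2
    have h10 : c.γ * ∑ x ∈ c.keys, acc (c.estAt ℓ x) l ≤
        c.γ * ∑ x ∈ c.keys, acc (c.lossAt p ℓ x) l + c.conf * c.keys.card := by
      rw [mul_sum, mul_sum, mul_comm c.conf, ← nsmul_eq_mul, ← sum_const, ← sum_add_distrib]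
      exact sum_le_sum fun x hx => hl.est_le x hx
    have := mul_le_mul_of_nonneg_left h9 hγ.le
    linarith
  have h11 : acc (c.estValAt ℓ) l ≤
      acc (fun past _ => planValue c.H (p past.length) f (ℓ past.length) c.s₀) l +
      (c.conf * (c.H * c.cap) / c.γ +
        (c.H * c.cap + c.γ * c.keys.card) * Real.log ((c.cap + c.γ) / c.γ) / c.γ +
        (l.length * (c.γ * W) + c.conf * c.keys.card)) := by
    refine le_of_mul_le_mul_left ?_ hγ
    rw [mul_add, mul_add, mul_add, mul_div_cancel₀ _ hγ.ne', mul_div_cancel₀ _ hγ.ne']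
    have h12 := mul_le_mul_of_nonneg_left h8 hγ.le
    linarith
  have h13 : c.conf * (c.H * c.cap + c.γ * c.keys.card) / c.γ =
      c.conf * (c.H * c.cap) / c.γ + c.conf * c.keys.card := by
    field_simp
  have h14 := mul_le_mul_of_nonneg_left hl.err_le (by positivity : (0 : ℝ) ≤ 5 * c.H)
  have h15 := hl.estVal_le
  rw [h13]
  linarith

end Params

/-! ### The accumulated confidence widths -/

theorem inv_sqrt_max_le {n : ℝ} (hn : 0 ≤ n) : 1 / √(max 1 n) ≤ 3 * (√(n + 1) - √n) := by
  have h1 : (1 : ℝ) ≤ √(max 1 n) := Real.one_le_sqrt.2 (le_max_left _ _)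
  have h2 : √n ≤ √(max 1 n) := Real.sqrt_le_sqrt (le_max_right _ _)
  have h3 : √(n + 1) ≤ 2 * √(max 1 n) := by
    refine Real.sqrt_le_iff.2 ⟨by positivity, ?_⟩
    rw [mul_pow, Real.sq_sqrt (zero_le_one.trans (le_max_left _ _))]
    linarith [le_max_left 1 n, le_max_right 1 n]
  have h4 := Real.sq_sqrt hn
  have h5 := Real.sq_sqrt (by linarith : 0 ≤ n + 1)
  have h6 : √n ≤ √(n + 1) := Real.sqrt_le_sqrt (by linarith)
  rw [div_le_iff₀ (by linarith)]
  have h7 : (√(n + 1) - √n) * (√(n + 1) + √n) = 1 := by nlinarith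
  nlinarith [mul_nonneg (sub_nonneg.2 h6) (by linarith : 0 ≤ 3 * √(max 1 n) - (√(n + 1) + √n))]

theorem inv_max_le {n : ℝ} (hn : 0 ≤ n) :
    1 / max 1 n ≤ 3 * (Real.log (n + 1 + 1) - Real.log (n + 1)) := by
  have h := Real.one_sub_inv_le_log_of_pos (x := (n + 1 + 1) / (n + 1)) (by positivity)
  rw [Real.log_div (by positivity) (by positivity), inv_div] at h
  have h1 : 1 - (n + 1) / (n + 1 + 1) = 1 / (n + 1 + 1) := by field_simp; ring
  have h2 : 1 / max 1 n ≤ 3 * (1 / (n + 1 + 1)) := by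
    rw [mul_one_div, div_le_div_iff₀ (zero_lt_one.trans_le (le_max_left _ _)) (by positivity)]
    linarith [le_max_left 1 n, le_max_right 1 n]
  linarith

theorem rowWidth_le {L : ℝ} (hL : 0 ≤ L) {H : ℕ} {R : List (Rec S A)}
    (hR : ∀ r ∈ R, r.1.length = H) {t : ℕ} (ht : t + 1 < H) (s : Fin S) (a : Fin A) :
    rowWidth L R t s a ≤ 3 * √(S * L) * (1 / √(max 1 (cnt R t s a))) +
      8 * (S * L) * (1 / max 1 (cnt R t s a)) := by
  set m : ℝ := max 1 (cnt R t s a)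
  have hm : 0 < m := zero_lt_one.trans_le (le_max_left _ _)
  have h1 : ∑ s', √(L * phat R t s a s' / m) ≤ √(S * L) * (1 / √m) := by
    have h2 := Real.sum_sqrt_mul_sqrt_le (univ : Finset (Fin S)) (f := fun _ => 1)
      (g := fun s' => L * phat R t s a s' / m) (fun _ => zero_le_one)
      (fun s' => by have := phat_nonneg R t s a s'; positivity)
    simp only [Real.sqrt_one, one_mul, sum_const, card_univ, Fintype.card_fin, nsmul_eq_mul,
      mul_one] at h2
    refine h2.trans ?_
    rw [← sum_div, ← mul_sum, Real.sqrt_mul (Nat.cast_nonneg _), mul_assoc, mul_one_div,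
      ← Real.sqrt_div hL]
    gcongr
    exact mul_le_of_le_one_right hL (sum_phat_le hR ht s a)
  unfold rowWidth width
  rw [sum_add_distrib, ← mul_sum, sum_const, card_univ, Fintype.card_fin, nsmul_eq_mul]
  refine add_le_add (by linarith) (le_of_eq ?_)
  ring

/-- The potential controlling the accumulated confidence widths of a state-action pair. -/
noncomputable def potential (b n : ℝ) : ℝ := 9 * √b * √n + 24 * b * Real.log (n + 1)

theorem potential_step {b n y : ℝ} (hb : 0 ≤ b) (hn : 0 ≤ n) (hy : y = 0 ∨ y = 1) :
    potential b n + y * (3 * √b * (1 / √(max 1 n)) + 8 * b * (1 / max 1 n)) ≤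
      potential b (y + n) := by
  rcases hy with rfl | rfl
  · simp
  · unfold potential
    rw [add_comm 1 n]
    have h1 := mul_le_mul_of_nonneg_left (inv_sqrt_max_le hn) (by positivity : 0 ≤ 3 * √b)
    have h2 := mul_le_mul_of_nonneg_left (inv_max_le hn) (by positivity : 0 ≤ 8 * b)
    linarith

theorem sum_hit_le (τ : Hist S A) : ∑ x : Fin S × Fin A, hit x.1 x.2 τ ≤ 1 := by
  cases τ <;> simp [hit]

theorem sum_cnt_le (R : List (Rec S A)) (t : ℕ) :
    ∑ x : Fin S × Fin A, cnt R t x.1 x.2 ≤ R.length := by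
  induction R with
  | nil => simp [cnt]
  | cons r R ih =>
    simp only [cnt, List.map_cons, List.sum_cons, sum_add_distrib, List.length_cons] at ih ⊢
    push_cast
    linarith [sum_hit_le (pre (t + 1) r.1)]

theorem sum_potential_cnt_le {b : ℝ} (hb : 0 ≤ b) (R : List (Rec S A)) (t : ℕ) :
    ∑ x : Fin S × Fin A, potential b (cnt R t x.1 x.2) ≤
      9 * √b * √(S * A * R.length) + 24 * b * (S * A * Real.log (R.length + 1)) := by
  unfold potential
  rw [sum_add_distrib, ← mul_sum, ← mul_sum]
  gcongr
  · have h := Real.sum_sqrt_mul_sqrt_le (univ : Finset (Fin S × Fin A)) (f := fun _ => 1)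
      (g := fun x => cnt R t x.1 x.2) (fun _ => zero_le_one) (fun x => cnt_nonneg _ _ _ _)
    simp only [Real.sqrt_one, one_mul, sum_const, card_univ, Fintype.card_prod, Fintype.card_fin,
      nsmul_eq_mul, mul_one] at h
    push_cast at h
    refine h.trans ?_
    rw [← Real.sqrt_mul (by positivity)]
    gcongr
    exact sum_cnt_le R t
  · have h : ∀ x ∈ (univ : Finset (Fin S × Fin A)),
        Real.log (cnt R t x.1 x.2 + 1) ≤ Real.log (R.length + 1) := fun x _ => by
      obtain ⟨n, hn, h⟩ := exists_cnt_eq R t x.1 x.2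
      have := cnt_nonneg R t x.1 x.2
      gcongr
      rw [h]
      exact_mod_cast hn
    refine (sum_le_card_nsmul _ _ _ h).trans (le_of_eq ?_)
    rw [card_univ, Fintype.card_prod, Fintype.card_fin, Fintype.card_fin, nsmul_eq_mul]
    push_cast
    ring

theorem errW_pre_succ_le {Λ : Finset ℕ} {L : ℝ} (hL : 0 ≤ L) (R : List (Rec S A)) {τ : Hist S A}
    {t : ℕ} (ht : t < τ.length) :
    errW Λ L R (pre (t + 1) τ) ≤
      ∑ x : Fin S × Fin A, hit x.1 x.2 (pre (t + 1) τ) * rowWidth L R t x.1 x.2 := by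
  obtain ⟨x, hx⟩ := pre_succ_eq_cons ht
  have h : (pre t τ).length = t := by rw [length_pre]; lia
  have h1 : ∑ y : Fin S × Fin A, hit y.1 y.2 (x :: pre t τ) * rowWidth L R t y.1 y.2 =
      rowWidth L R t x.1 x.2 := by simp [hit]
  rw [hx, h1]
  simp only [errW, h]
  split_ifs
  · exact rowWidth_nonneg hL _ _ _ _
  · exact min_le_right _ _

namespace Params

variable (c : Params S A)

theorem acc_errAt_le_sum_potential (hL : 0 ≤ c.conf) (ℓ : ℕ → ℕ → Fin S → Fin A → ℝ)
    (l : List (Traj S A c.H)) :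
    acc (c.errAt ℓ) l ≤ ∑ t ∈ range (c.H - 1), ∑ x : Fin S × Fin A,
      potential (S * c.conf) (cnt (recs ℓ l) t x.1 x.2) := by
  induction l with
  | nil => simp [acc, recs, cnt, potential]
  | cons τ l ih =>
    have h : c.errAt ℓ l τ ≤ ∑ t ∈ range (c.H - 1), ∑ x : Fin S × Fin A,
        hit x.1 x.2 (pre (t + 1) τ.hist) * rowWidth c.conf (recs ℓ l) t x.1 x.2 := by
      have h0 : ∑ m ∈ range c.H, errW c.Λ c.conf (recs ℓ l) (pre m τ.hist) ≤
          ∑ t ∈ range (c.H - 1), errW c.Λ c.conf (recs ℓ l) (pre (t + 1) τ.hist) := by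
        generalize recs ℓ l = R, τ.hist = σ
        cases c.H with
        | zero => simp
        | succ n => simp [sum_range_succ', pre, errW]
      refine h0.trans (sum_le_sum fun t ht => errW_pre_succ_le hL _ ?_)
      rw [mem_range] at ht
      rw [Traj.length_hist]
      lia
    refine (add_le_add ih h).trans ?_
    simp only [← sum_add_distrib]
    refine sum_le_sum fun t ht => sum_le_sum fun x _ => ?_
    rw [mem_range] at ht
    have h2 : cnt (recs ℓ (τ :: l)) t x.1 x.2 =
        hit x.1 x.2 (pre (t + 1) τ.hist) + cnt (recs ℓ l) t x.1 x.2 := by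
      simp [cnt, recs, recOf_fst]
    have h3 := rowWidth_le hL (length_recs ℓ l) (by lia : t + 1 < c.H) x.1 x.2
    rw [h2]
    refine le_trans ?_ (potential_step (mul_nonneg (Nat.cast_nonneg S) hL)
      (cnt_nonneg _ _ _ _) (hit_eq_zero_or_one _ _ _))
    gcongr
    exact hit_nonneg _ _ _

theorem acc_errAt_le (hL : 0 ≤ c.conf) (ℓ : ℕ → ℕ → Fin S → Fin A → ℝ)
    (l : List (Traj S A c.H)) :
    acc (c.errAt ℓ) l ≤ c.H * (9 * √(S * c.conf) * √(S * A * l.length) +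
      24 * (S * c.conf) * (S * A * Real.log (l.length + 1))) := by
  refine (c.acc_errAt_le_sum_potential hL ℓ l).trans ?_
  have hb : 0 ≤ (S : ℝ) * c.conf := mul_nonneg (Nat.cast_nonneg S) hL
  refine (sum_le_card_nsmul _ _ _ fun t _ => sum_potential_cnt_le hb (recs ℓ l) t).trans ?_
  rw [card_range, nsmul_eq_mul, length_recs_eq]
  have : 0 ≤ Real.log ((l.length : ℝ) + 1) := Real.log_nonneg (by simp)
  gcongr
  exact Nat.sub_le _ _

end Params

/-! ### The probability of an event in terms of interaction histories -/

theorem acc_length {α : Type*} (g : ℕ → ℝ) (l : List α) :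
    acc (fun past _ => g past.length) l = ∑ k ∈ range l.length, g k := by
  induction l with
  | nil => rfl
  | cons t l ih => rw [acc, ih, List.length_cons, sum_range_succ]

namespace Params

variable (c : Params S A)

theorem played_alg (hA : 1 ≤ A) (ℓ : ℕ → ℕ → Fin S → Fin A → ℝ) {K : ℕ}
    (ts : Fin K → Traj S A c.H) (k : Fin K) (i : ℕ) :
    played (c.alg hA c.H) i (banditObs c.H ℓ) ts k =
      planStrat (c.plan (recs ℓ (List.ofFn fun j : Fin k => ts ⟨j, j.2.trans k.2⟩).reverse)) := by
  rw [← reverse_map_recOf]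
  rfl

theorem seqProb_alg (hA : 1 ≤ A) (p : ℕ → Ker S A) (ℓ : ℕ → ℕ → Fin S → Fin A → ℝ) {K : ℕ}
    (ts : Fin K → Traj S A c.H) (i : ℕ) :
    seqProb (c.alg hA c.H) i p (banditObs c.H ℓ) c.s₀ ts =
      seqW (c.step p ℓ) (List.ofFn ts).reverse := by
  simp only [seqProb, played_alg]
  induction K with
  | zero => simp [seqW]
  | succ K ih =>
    rw [Fin.prod_univ_castSucc, List.ofFn_succ', List.concat_eq_append, List.reverse_append,
      List.reverse_singleton, List.singleton_append]
    refine congrArg₂ (· * ·) (ih fun j => ts j.castSucc) ?_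
    simp only [step, List.length_reverse, List.length_ofFn]
    rfl

theorem playedValue_alg (hH : 1 ≤ c.H) (hA : 1 ≤ A) {p : ℕ → Ker S A}
    (hp : ∀ k, IsTrans c.H (p k)) (ℓ : ℕ → ℕ → Fin S → Fin A → ℝ) {K : ℕ}
    (ts : Fin K → Traj S A c.H) (i : ℕ) :
    playedValue c.H K (c.alg hA c.H) i p ℓ (banditObs c.H ℓ) c.s₀ ts =
      acc (c.playAt p ℓ) (List.ofFn ts).reverse := by
  simp only [playedValue, played_alg, stratValue_planStrat hH (hp _) (c.isPlan_plan hA _)]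
  induction K with
  | zero => simp [acc]
  | succ K ih =>
    rw [Fin.sum_univ_castSucc, List.ofFn_succ', List.concat_eq_append, List.reverse_append,
      List.reverse_singleton, List.singleton_append]
    refine congrArg₂ (· + ·) (ih fun j => ts j.castSucc) ?_
    simp only [playAt, List.length_reverse, List.length_ofFn]
    rfl

open scoped Classical in
theorem sum_seqW_le_eventProb (hH : 1 ≤ c.H) (hA : 1 ≤ A) {p : ℕ → Ker S A}
    (hp : ∀ k, IsTrans c.H (p k)) (ℓ : ℕ → ℕ → Fin S → Fin A → ℝ) {K : ℕ}
    {E : ℕ → (Fin K → Traj S A c.H) → Prop} {E' : List (Traj S A c.H) → Prop}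
    (h : ∀ ts, E' (List.ofFn ts).reverse → E 0 ts) :
    ∑ l ∈ listsOf _ K, seqW (c.step p ℓ) l * (if E' l then 1 else 0) ≤
      eventProb c.H K (c.alg hA c.H) p (banditObs c.H ℓ) c.s₀ E := by
  have h1 : eventProb c.H K (c.alg hA c.H) p (banditObs c.H ℓ) c.s₀ E =
      ∑ ts, seqW (c.step p ℓ) (List.ofFn ts).reverse * (if E 0 ts then 1 else 0) := by
    unfold eventProb
    rw [tsum_eq_single 0 fun i hi => by simp [alg, hi]]
    simp only [seqProb_alg]
    simp [alg]
  rw [h1, ← sum_reverse_ofFn]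
  refine sum_le_sum fun ts _ => mul_le_mul_of_nonneg_left ?_
    (seqW_nonneg (c.step_nonneg hH hA hp) _)
  by_cases h2 : E' (List.ofFn ts).reverse
  · simp [h2, h ts h2]
  · rw [if_neg h2]
    split_ifs <;> norm_num

end Params

theorem le_bestValue {H K : ℕ} (hA : 1 ≤ A) {p : ℕ → Ker S A}
    {ℓ : ℕ → ℕ → Fin S → Fin A → ℝ} {s₀ : Fin S} {b : ℝ}
    (h : ∀ π, IsPolicy π → b ≤ ∑ k ∈ range K, value H (p k) π (ℓ k) s₀) :
    b ≤ bestValue H K p ℓ s₀ := by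
  refine le_csInf ⟨_, _, isPolicy_uniform hA, rfl⟩ ?_
  rintro x ⟨π, hπ, rfl⟩
  exact h π hπ

/-! ### The choice of parameters -/

/-- The regret bound after plugging in the step size, with `w = S ^ λ` and `z = A ^ (λ + 1)`. -/
theorem regret_bound_le {K S A H w z e κ L : ℝ} (hK : 1 ≤ K) (hS : 1 ≤ S) (hA : 1 ≤ A)
    (hH : 1 ≤ H) (hw : 1 ≤ w) (hz : 1 ≤ z) (hL : 1 ≤ L) (hlog : Real.log (2 * K) ≤ L)
    (hKN : w ^ 2 * S * z ≤ K) (hκ : κ ≤ H * (w ^ 2 * S * z)) (hκ0 : 0 ≤ κ)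
    (he : e ≤ H * (9 * √(S * (2 * L)) * √(S * A * K) +
      24 * (S * (2 * L)) * (S * A * Real.log (K + 1)))) :
    10 * H * e + 10 * H ^ 2 * (2 * L) + 2 * K * (1 / √(K * S * z)) * (H * (w * S * z)) +
        H * √K * (1 + 2 * L) + 2 * L * (H * w + 1 / √(K * S * z) * κ) / (1 / √(K * S * z)) +
        (H * w + 1 / √(K * S * z) * κ) *
          Real.log ((w + 1 / √(K * S * z)) / (1 / √(K * S * z))) / (1 / √(K * S * z)) ≤
      500 * L ^ 2 * (H * w * √(K * S * z) + H ^ 3 * S ^ 2 * A + √(H ^ 4 * S ^ 2 * A * K)) := by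
  have hKSz : 0 < K * S * z := by positivity
  set q : ℝ := √(K * S * z)
  have hq : 0 < q := Real.sqrt_pos.2 hKSz
  have hq2 : q ^ 2 = K * S * z := Real.sq_sqrt hKSz.le
  have hL2 : L ≤ L ^ 2 := by nlinarith
  have hwq2 : (w * q) ^ 2 = K * (w ^ 2 * S * z) := by rw [mul_pow, hq2]; ring
  have hwq : w * q ≤ K := by
    refine le_of_sq_le_sq ?_ (by linarith)
    rw [hwq2, sq K]
    gcongr
  have hNq : w ^ 2 * S * z ≤ w * q := by
    refine le_of_sq_le_sq ?_ (by positivity)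
    rw [hwq2, sq (_ * z)]
    exact mul_le_mul_of_nonneg_right hKN (by positivity)
  have hKq : √K ≤ w * q := by
    refine Real.sqrt_le_iff.2 ⟨by positivity, ?_⟩
    rw [hwq2]
    refine le_mul_of_one_le_right (by positivity) ?_
    exact one_le_mul_of_one_le_of_one_le
      (one_le_mul_of_one_le_of_one_le (one_le_pow₀ hw) hS) hz
  have hκq : κ ≤ H * (w * q) := hκ.trans (by gcongr)
  have hlog1 : Real.log (K + 1) ≤ L := (Real.log_le_log (by positivity) (by linarith)).trans hlog
  have hlog2 : Real.log (w * q + 1) ≤ L :=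
    (Real.log_le_log (by positivity) (by linarith)).trans hlog
  have hM : √(H ^ 4 * S ^ 2 * A * K) = H ^ 2 * S * √(A * K) := by
    rw [show H ^ 4 * S ^ 2 * A * K = (H ^ 2 * S) ^ 2 * (A * K) by ring,
      Real.sqrt_mul (by positivity), Real.sqrt_sq (by positivity)]
  set M := √(A * K)
  have he' : 10 * H * e ≤
      L ^ 2 * (180 * (H ^ 2 * S * M)) + L ^ 2 * (480 * (H ^ 3 * S ^ 2 * A)) := by
    have h1 : √(S * (2 * L)) * √(S * A * K) ≤ 2 * L * (S * M) := by
      rw [← Real.sqrt_mul (by positivity), show S * (2 * L) * (S * A * K) =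
        S ^ 2 * ((2 * L) * (A * K)) by ring, Real.sqrt_mul (by positivity),
        Real.sqrt_sq (by positivity), Real.sqrt_mul (by positivity)]
      have : √(2 * L) ≤ 2 * L := Real.sqrt_le_iff.2 ⟨by positivity, by nlinarith⟩
      have h2 : √(2 * L) * M ≤ 2 * L * M := by gcongr
      nlinarith
    have h2 : S * (2 * L) * (S * A * Real.log (K + 1)) ≤ S * (2 * L) * (S * A * L) := by gcongr
    have h3 : 10 * H * e ≤ 10 * H * (H * (9 * (2 * L * (S * M)) +
        24 * (S * (2 * L) * (S * A * L)))) := by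
      gcongr
      refine he.trans ?_
      gcongr H * ?_
      linarith
    have h4 : L * (H ^ 2 * S * M) ≤ L ^ 2 * (H ^ 2 * S * M) := by gcongr
    have h5 : L ^ 2 * (H ^ 2 * S ^ 2 * A) ≤ L ^ 2 * (H ^ 3 * S ^ 2 * A) := by
      gcongr
      · norm_num
    nlinarith
  have h2 : 10 * H ^ 2 * (2 * L) ≤ L ^ 2 * (20 * (H ^ 3 * S ^ 2 * A)) := by
    have h5 : H ^ 2 * 1 * 1 ≤ H ^ 3 * S ^ 2 * A := by
      gcongr
      · norm_num
      · exact one_le_pow₀ hS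
    have h6 : L * (H ^ 2 * 1 * 1) ≤ L ^ 2 * (H ^ 3 * S ^ 2 * A) := by gcongr
    linarith
  have h3 : 2 * K * (1 / q) * (H * (w * S * z)) ≤ L ^ 2 * (2 * (H * w * q)) := by
    have h5 : 2 * K * (1 / q) * (H * (w * S * z)) = 2 * (H * w * q) := by
      field_simp
      rw [hq2]
    rw [h5]
    exact le_mul_of_one_le_left (by positivity) (one_le_pow₀ hL)
  have h4 : H * √K * (1 + 2 * L) ≤ L ^ 2 * (3 * (H * w * q)) := by
    have : H * √K * (1 + 2 * L) ≤ H * (w * q) * (3 * L ^ 2) := by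
      gcongr
      linarith
    linarith
  have h5 : 2 * L * (H * w + 1 / q * κ) / (1 / q) ≤ L ^ 2 * (4 * (H * w * q)) := by
    have h6 : 2 * L * (H * w + 1 / q * κ) / (1 / q) = 2 * L * (H * w * q + κ) := by field_simp
    rw [h6]
    have : 2 * L * (H * w * q + κ) ≤ 2 * L ^ 2 * (H * w * q + H * (w * q)) := by gcongr
    linarith
  have h6 : (H * w + 1 / q * κ) * Real.log ((w + 1 / q) / (1 / q)) / (1 / q) ≤
      L ^ 2 * (2 * (H * w * q)) := by
    have h7 : (w + 1 / q) / (1 / q) = w * q + 1 := by field_simp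
    have h8 : (H * w + 1 / q * κ) * Real.log (w * q + 1) / (1 / q) =
        (H * w * q + κ) * Real.log (w * q + 1) := by field_simp
    rw [h7, h8]
    have : (H * w * q + κ) * Real.log (w * q + 1) ≤ (H * w * q + H * (w * q)) * L ^ 2 := by
      gcongr
      · exact Real.log_nonneg (by linarith [mul_pos (by linarith : 0 < w) hq])
      · exact hlog2.trans hL2
    linarith
  rw [hM]
  have h7 : 0 ≤ L ^ 2 * (H ^ 2 * S * M) := by positivity
  have h8 : 0 ≤ L ^ 2 * (H * w * q) := by positivity
  linarith

theorem union_bound_le {K S A H δ d κ : ℝ} (hK : 1 ≤ K) (hS : 1 ≤ S) (hA : 1 ≤ A) (hH : 1 ≤ H)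
    (hδ : 0 < δ) (hδ1 : δ < 1) (hd : d ≤ (K + 1) ^ 2 * 2 * H * (S ^ 2 * A)) (hκ : κ ≤ H * K) :
    (d + κ + 2) * Real.exp (-(2 * (1 + Real.log (K * S * A * H / δ)))) ≤ 9 * δ := by
  set M := K * S * A * H
  have hM1 : 1 ≤ M := one_le_mul_of_one_le_of_one_le (one_le_mul_of_one_le_of_one_le
    (one_le_mul_of_one_le_of_one_le hK hS) hA) hH
  have hM0 : 0 < M := by linarith
  have h1 : d + κ + 2 ≤ 11 * M ^ 2 := by
    have h2 : (K + 1) ^ 2 * 2 * H * (S ^ 2 * A) ≤ (2 * K) ^ 2 * 2 * H ^ 2 * (S ^ 2 * A ^ 2) := by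
      gcongr
      · linarith
      · exact le_self_pow₀ hH two_ne_zero
      · exact le_self_pow₀ hA two_ne_zero
    have h3 : H * K * 1 * 1 ≤ H * K * S * A := by gcongr
    have h4 : M ≤ M ^ 2 := le_self_pow₀ hM1 two_ne_zero
    have h5 : (2 * K) ^ 2 * 2 * H ^ 2 * (S ^ 2 * A ^ 2) = 8 * M ^ 2 := by ring
    have h6 : H * K * S * A = M := by ring
    linarith
  have h2 : Real.exp (-(2 * (1 + Real.log (M / δ)))) = Real.exp (-2) * (δ / M) ^ 2 := by
    rw [show -(2 * (1 + Real.log (M / δ))) = -2 + (-Real.log (M / δ) + -Real.log (M / δ)) by ring,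
      Real.exp_add, Real.exp_add, Real.exp_neg (Real.log _), Real.exp_log (by positivity), inv_div]
    ring
  have h3 : Real.exp (-2) ≤ 1 / 3 := by
    rw [Real.exp_neg, ← one_div]
    exact one_div_le_one_div_of_le (by norm_num) (by linarith [Real.add_one_le_exp 2])
  rw [h2]
  calc (d + κ + 2) * (Real.exp (-2) * (δ / M) ^ 2)
      ≤ 11 * M ^ 2 * (1 / 3 * (δ / M) ^ 2) := by gcongr
    _ = 11 / 3 * (δ * δ) := by field_simp
    _ ≤ 9 * δ := by nlinarith

namespace Params

variable (c : Params S A)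

/-- The regret against every Markov policy is at most `B`. -/
def RegretLe (p : ℕ → Ker S A) (ℓ : ℕ → ℕ → Fin S → Fin A → ℝ) (B : ℝ)
    (l : List (Traj S A c.H)) : Prop :=
  ∀ π, IsPolicy π → acc (c.playAt p ℓ) l -
    acc (fun past _ => planValue c.H (p past.length) (markovPlan π) (ℓ past.length) c.s₀) l ≤ B

variable {c} (hA : 1 ≤ A) {p : ℕ → Ker S A}
  (hp : ∀ k, IsTrans c.H (p k)) {ℓ : ℕ → ℕ → Fin S → Fin A → ℝ} (hℓ : ∀ k, IsLoss c.H (ℓ k))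
  {B : ℝ}

include hA hp

theorem regret_le_of_regretLe (hH : 1 ≤ c.H) {K : ℕ} {ts : Fin K → Traj S A c.H}
    (h : c.RegretLe p ℓ B (List.ofFn ts).reverse) (i : ℕ) :
    playedValue c.H K (c.alg hA c.H) i p ℓ (banditObs c.H ℓ) c.s₀ ts -
      bestValue c.H K p ℓ c.s₀ ≤ B := by
  rw [c.playedValue_alg hH hA hp, sub_le_comm]
  refine le_bestValue hA fun π hπ => ?_
  have h1 := h π hπ
  rw [acc_length (fun k => planValue c.H (p k) (markovPlan π) (ℓ k) c.s₀)] at h1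
  simp only [List.length_reverse, List.length_ofFn] at h1
  simp only [value_eq_planValue]
  linarith

include hℓ

theorem regretLe_of_length_mul_le {l : List (Traj S A c.H)} (h : l.length * c.H ≤ B) :
    c.RegretLe p ℓ B l := by
  intro π hπ
  refine le_trans ?_ h
  rw [← acc_sub, ← acc_const (c.H : ℝ) l]
  refine acc_le fun past t _ => ?_
  exact (sub_le_self _ (planValue_nonneg (hp _) (isPlan_markovPlan hπ) (hℓ _) _)).trans
    (planValue_le (hp _) (c.isPlan_plan hA _) (hℓ _) _)

theorem regretLe_of_concentrated (hH : 1 ≤ c.H) (hS : 1 ≤ S) {K : ℕ} (hK : 1 ≤ K)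
    {L : ℝ} (hL : 1 ≤ L) (hlog : Real.log (2 * K) ≤ L) (hcap : c.cap = (S : ℝ) ^ c.Λ.card)
    (hγ : c.γ = 1 / √((K : ℝ) * S * (A : ℝ) ^ (c.Λ.card + 1))) (hconf : c.conf = 2 * L)
    (hKN : ((S : ℝ) ^ c.Λ.card) ^ 2 * S * (A : ℝ) ^ (c.Λ.card + 1) ≤ K) {q : Ker S A}
    (hpq : ∀ k h, h ∉ c.Λ → p k h = q h) {l : List (Traj S A c.H)} (hlK : l.length = K)
    (hl : c.Concentrated p q ℓ l) :
    c.RegretLe p ℓ (500 * L ^ 2 * ((c.H : ℝ) * (S : ℝ) ^ c.Λ.card *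
      √((K : ℝ) * S * (A : ℝ) ^ (c.Λ.card + 1)) + (c.H : ℝ) ^ 3 * (S : ℝ) ^ 2 * A +
        √((c.H : ℝ) ^ 4 * (S : ℝ) ^ 2 * A * K))) l := by
  intro π hπ
  have hK' : (1 : ℝ) ≤ K := by exact_mod_cast hK
  have hS' : (1 : ℝ) ≤ S := by exact_mod_cast hS
  have hA' : (1 : ℝ) ≤ A := by exact_mod_cast hA
  have hH' : (1 : ℝ) ≤ c.H := by exact_mod_cast hH
  have hγ0 : 0 < c.γ := by rw [hγ]; positivity
  have hκ : (c.keys.card : ℝ) ≤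
      c.H * (((S : ℝ) ^ c.Λ.card) ^ 2 * S * (A : ℝ) ^ (c.Λ.card + 1)) := by
    refine (card_keySet_le c.Λ c.H hS hA).trans (le_of_eq ?_)
    ring
  have he := c.acc_errAt_le (by linarith) ℓ l
  have h := c.regret_le hH hS hA hcap hγ0 (by linarith) hp hpq hℓ (isPlan_markovPlan hπ) hl
  rw [hlK, hconf] at he h
  rw [hcap, hγ] at h
  refine h.trans (le_trans (le_of_eq ?_) (regret_bound_le hK' hS' hA' hH' (one_le_pow₀ hS')
    (one_le_pow₀ hA') hL hlog hKN hκ (Nat.cast_nonneg _) he))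
  ring

end Params

/-- **Regret of `COM-OMD`** (Theorem `thm:first_regret`).  There are a
universal constant `C > 0` and a polylogarithmic factor
`(1 + log(K·S·A·H/δ))^n` such that, in the partially adversarial setting with
a known set `Λ` of adversarial steps (`|Λ| = λ`) and bandit feedback, the
algorithm `COM-OMD` (with `η = γ = 1/√(K·A^{λ+1}·S)`, depending on the
confidence parameter `δ`) guarantees: for every `δ ∈ (0,1)`, with probability
at least `1 − 9δ`, the regret satisfies
`R_K ≤ C·L·(H·S^λ·√(K·S·A^{λ+1}) + H³·S²·A + √(H⁴·S²·A·K))`. -/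
theorem com_omd_regret :
    ∃ C : ℝ, 0 < C ∧ ∃ n : ℕ,
      ∀ (S A H K lam : ℕ), 1 ≤ S → 2 ≤ A → 1 ≤ H → 1 ≤ K →
      ∀ (sinit : Fin S) (Λ : Finset ℕ),
        Λ ⊆ Finset.range (H - 1) → Λ.card = lam →
      ∃ algOf : ℝ → Alg S A (BanditObs S A H),
        ∀ (p : ℕ → ℕ → Fin S → Fin A → Fin S → ℝ)
          (ℓ : ℕ → ℕ → Fin S → Fin A → ℝ),
          (∀ k, IsTrans H (p k)) → (∀ k, IsLoss H (ℓ k)) →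
          -- partially adversarial transitions: stationary off `Λ`
          (∃ pstat : ℕ → Fin S → Fin A → Fin S → ℝ,
            ∀ k h, h ∉ Λ → p k h = pstat h) →
          ∀ δ : ℝ, 0 < δ → δ < 1 →
            1 - 9 * δ ≤
              eventProb H K (algOf δ) p (banditObs H ℓ) sinit
                (fun i ts =>
                  playedValue H K (algOf δ) i p ℓ (banditObs H ℓ) sinit ts -
                      bestValue H K p ℓ sinit ≤
                    C * (1 + Real.log ((K : ℝ) * S * A * H / δ)) ^ n *
                      ((H : ℝ) * (S : ℝ) ^ lam *
                          Real.sqrt ((K : ℝ) * S * (A : ℝ) ^ (lam + 1)) +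
                        (H : ℝ) ^ 3 * (S : ℝ) ^ 2 * A +
                        Real.sqrt ((H : ℝ) ^ 4 * (S : ℝ) ^ 2 * A * K))) := by
  refine ⟨500, by norm_num, 2, ?_⟩
  intro S A H K lam hS hA2 hH hK sinit Λ _ hlam
  subst hlam
  have hA : 1 ≤ A := by lia
  let c : ℝ → Params S A := fun δ =>
    { H := H
      Λ := Λ
      s₀ := sinit
      γ := 1 / √((K : ℝ) * S * (A : ℝ) ^ (Λ.card + 1))
      conf := 2 * (1 + Real.log ((K : ℝ) * S * A * H / δ))
      cap := (S : ℝ) ^ Λ.card }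
  refine ⟨fun δ => (c δ).alg hA H, fun p ℓ hp hℓ hq δ hδ hδ1 => ?_⟩
  obtain ⟨q, hpq⟩ := hq
  have hK' : (1 : ℝ) ≤ K := by exact_mod_cast hK
  have hS' : (1 : ℝ) ≤ S := by exact_mod_cast hS
  have hA' : (1 : ℝ) ≤ A := by exact_mod_cast hA
  have hA2' : (2 : ℝ) ≤ A := by exact_mod_cast hA2
  have hH' : (1 : ℝ) ≤ H := by exact_mod_cast hH
  have h2K : 2 * (K : ℝ) ≤ K * S * A * H / δ := by
    rw [le_div_iff₀ hδ]
    calc 2 * (K : ℝ) * δ ≤ 2 * K * 1 := by gcongr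
      _ = K * 1 * 2 * 1 := by ring
      _ ≤ K * S * A * H := by gcongr
  set L : ℝ := 1 + Real.log ((K : ℝ) * S * A * H / δ) 
  have hlog : Real.log (2 * K) ≤ L := by
    have := Real.log_le_log (by linarith) h2K
    linarith
  have hL : 1 ≤ L := by
    have : 0 ≤ Real.log ((K : ℝ) * S * A * H / δ) := Real.log_nonneg (by linarith)
    linarith
  classical
  set B : ℝ := 500 * L ^ 2 * ((H : ℝ) * (S : ℝ) ^ Λ.card *
    √((K : ℝ) * S * (A : ℝ) ^ (Λ.card + 1)) + (H : ℝ) ^ 3 * (S : ℝ) ^ 2 * A +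
      √((H : ℝ) ^ 4 * (S : ℝ) ^ 2 * A * K))
  refine le_trans ?_ ((c δ).sum_seqW_le_eventProb hH hA hp ℓ (E' := (c δ).RegretLe p ℓ B)
    fun ts h => Params.regret_le_of_regretLe (c := c δ) hA hp hH h 0)
  by_cases hKN : ((S : ℝ) ^ Λ.card) ^ 2 * S * (A : ℝ) ^ (Λ.card + 1) ≤ K
  · refine le_trans ?_ ((c δ).one_sub_le_sum_seqW_of_concentrated hH hA (q := q)
      (show 0 < 1 / √((K : ℝ) * S * (A : ℝ) ^ (Λ.card + 1)) by positivity)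
      (show 1 ≤ 2 * L by linarith) hp hpq hℓ hK fun l hl hc =>
        Params.regretLe_of_concentrated (c := c δ) hA hp hℓ hH hS hK hL hlog rfl rfl rfl hKN hpq
          hl hc)
    refine sub_le_sub_left (union_bound_le hK' hS' hA' hH' hδ hδ1
      ((c δ).card_devIndex_le K) ?_) 1
    refine (card_keySet_le Λ H hS hA).trans ?_
    gcongr
    refine le_trans (le_of_eq ?_) hKN
    ring
  · have hB1 : (K : ℝ) * H ≤ B := by
      have h1 : (K : ℝ) ≤ (S : ℝ) ^ Λ.card * √((K : ℝ) * S * (A : ℝ) ^ (Λ.card + 1)) := by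
        refine le_of_sq_le_sq ?_ (by positivity)
        rw [mul_pow, Real.sq_sqrt (by positivity)]
        nlinarith
      have h2 : 1 ≤ 500 * L ^ 2 := by nlinarith
      have h3 : (K : ℝ) * H ≤ H * (S : ℝ) ^ Λ.card *
          √((K : ℝ) * S * (A : ℝ) ^ (Λ.card + 1)) := by nlinarith
      refine le_trans ?_ (le_mul_of_one_le_left (by positivity) h2)
      have h4 : 0 ≤ (H : ℝ) ^ 3 * (S : ℝ) ^ 2 * A := by positivity
      have h5 : 0 ≤ √((H : ℝ) ^ 4 * (S : ℝ) ^ 2 * A * K) := by positivity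
      linarith
    have h1 : ∑ l ∈ listsOf _ K, seqW ((c δ).step p ℓ) l *
        (if (c δ).RegretLe p ℓ B l then 1 else 0) = 1 := by
      refine Eq.trans ?_ (sum_seqW ((c δ).sum_step (ℓ := ℓ) hH hA hp) K)
      refine sum_congr rfl fun l hl => ?_
      rw [if_pos, mul_one]
      refine Params.regretLe_of_length_mul_le (c := c δ) hA hp hℓ ?_
      rwa [mem_listsOf.1 hl]
    rw [h1]
    linarith

end AdvMDP
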